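/- Fix real numbers A, B ≥ 1. There is a constant C = C(A,B) > 0 such that uniformly for all real x ≥ 3, all nonzero integers a with 0 < |a| ≤ x/(log x)^{A+B+1}, all real M with 1 ≤ M ≤ (log x)^A, and all real R with 2|a|M ≤ R ≤ x^{1/2}, one has | (1/((φ(|a|)/|a|) · x/(2M))) · Σ_{x/(2M) < q ≤ x/M, gcd(q,a)=1} ( ψ*(x;q,a) − ρ_R*(x;q,a) ) | ≤ C/(log x)^B, where q runs over integers coprime to a. -/

import Mathlib

open Finset Real

/-- Vaughan's function `F_R(n) = ∑_{r ≤ R} μ(r)² μ((r,n)) φ((r,n)) / φ(r)`. -/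
noncomputable def FR (R : ℝ) (n : ℤ) : ℝ :=
  ∑ r ∈ Finset.Icc 1 ⌊R⌋₊,
    (ArithmeticFunction.moebius r : ℝ) ^ 2 *
      (ArithmeticFunction.moebius (Int.gcd (r : ℤ) n) : ℝ) *
      (Nat.totient (Int.gcd (r : ℤ) n) : ℝ) / (Nat.totient r : ℝ)

/-- `ρ_R^*(x;q,a) = ∑_{n ≤ x, n ≡ a (q), n > a} F_R(n)`. -/
noncomputable def rhoStar (R x : ℝ) (q : ℕ) (a : ℤ) : ℝ :=
  ∑ n ∈ (Finset.Icc 1 ⌊x⌋₊).filter (fun n : ℕ => a < (n : ℤ) ∧ (q : ℤ) ∣ (n : ℤ) - a),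
    FR R n

/-- `ψ^*(x;q,a) = ∑_{n ≤ x, n ≡ a (q), n > a} Λ(n)`. -/
noncomputable def psiStar (x : ℝ) (q : ℕ) (a : ℤ) : ℝ :=
  ∑ n ∈ (Finset.Icc 1 ⌊x⌋₊).filter (fun n : ℕ => a < (n : ℤ) ∧ (q : ℤ) ∣ (n : ℤ) - a),
    ArithmeticFunction.vonMangoldt n

namespace SiegelWalfisz

/-- The mean value of a Dirichlet character over a period. -/
noncomputable def charMean {q : ℕ} [NeZero q] (χ : DirichletCharacter ℂ q) : ℂ :=
  (∑ a : ZMod q, χ a) / q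

lemma charMean_of_ne_one {q : ℕ} [NeZero q] {χ : DirichletCharacter ℂ q} (h : χ ≠ 1) :
    charMean χ = 0 := by
  simp [charMean, MulChar.sum_eq_zero_of_ne_one h]

lemma norm_charMean_le {q : ℕ} [NeZero q] (χ : DirichletCharacter ℂ q) : ‖charMean χ‖ ≤ 1 := by
  have hq : (0 : ℝ) < q := by exact_mod_cast (NeZero.pos q)
  rw [charMean, norm_div, Complex.norm_natCast, div_le_one hq]
  calc ‖∑ a : ZMod q, χ a‖ ≤ ∑ a : ZMod q, (1 : ℝ) :=
        norm_sum_le_of_le _ fun a _ ↦ χ.norm_le_one a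
    _ = q := by simp [ZMod.card]

lemma sum_range_add_eq_sum_zmod {q : ℕ} [NeZero q] (f : ZMod q → ℂ) (n : ℕ) :
    ∑ i ∈ range q, f ((n + i : ℕ) : ZMod q) = ∑ a, f a := by
  rw [Finset.sum_range]
  have hb : Function.Bijective (fun i : Fin q ↦ ((n + i : ℕ) : ZMod q)) := by
    rw [Fintype.bijective_iff_injective_and_card]
    refine ⟨fun i j hij ↦ ?_, by simp [ZMod.card]⟩
    simp only [Nat.cast_add, add_right_inj] at hij
    rw [ZMod.natCast_eq_natCast_iff, Nat.ModEq, Nat.mod_eq_of_lt i.2, Nat.mod_eq_of_lt j.2] at hij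
    exact Fin.ext hij
  exact hb.sum_comp f

lemma norm_sum_range_sub_charMean_le {q : ℕ} [NeZero q] (χ : DirichletCharacter ℂ q) (n : ℕ) :
    ‖∑ k ∈ range n, χ k - charMean χ * n‖ ≤ 2 * q := by
  have hq : (0 : ℝ) < q := by exact_mod_cast (NeZero.pos q)
  induction n using Nat.strong_induction_on with
  | _ n ih =>
    by_cases h : n < q
    · have h1 : ‖∑ k ∈ range n, χ k‖ ≤ n := by
        calc ‖∑ k ∈ range n, χ k‖ ≤ ∑ k ∈ range n, (1 : ℝ) :=
              norm_sum_le_of_le _ fun a _ ↦ χ.norm_le_one a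
          _ = n := by simp
      have h2 : ‖charMean χ * n‖ ≤ n := by
        rw [norm_mul, Complex.norm_natCast]
        exact mul_le_of_le_one_left (by positivity) (norm_charMean_le χ)
      have h3 : (n : ℝ) ≤ q := by exact_mod_cast h.le
      linarith [norm_sub_le (∑ k ∈ range n, χ k) (charMean χ * n)]
    · obtain ⟨m, rfl⟩ := Nat.exists_eq_add_of_le (not_lt.mp h)
      have h1 := ih m (by have := NeZero.pos q; omega)
      have h2 : charMean χ * q = ∑ a : ZMod q, χ a := by
        rw [charMean, div_mul_cancel₀]
        exact_mod_cast hq.ne'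
      rw [add_comm q m, sum_range_add, sum_range_add_eq_sum_zmod (fun a ↦ χ a) m, Nat.cast_add,
        mul_add, h2]
      simpa using h1

/-- The deviation of a character sum from its expected value. -/
noncomputable def charDev {q : ℕ} [NeZero q] (χ : DirichletCharacter ℂ q) (t : ℝ) : ℂ :=
  ∑ k ∈ Icc 1 ⌊t⌋₊, χ k - charMean χ * t

lemma sum_Icc_one_eq (f : ℕ → ℂ) (n : ℕ) :
    ∑ k ∈ Icc 1 n, f k = ∑ k ∈ range (n + 1), f k - f 0 := by
  rw [Finset.sum_range_succ', Finset.range_eq_Ico, Finset.sum_Ico_add' f 0 n 1]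
  simp only [add_sub_cancel_right]
  rfl

lemma norm_charDev_le {q : ℕ} [NeZero q] (χ : DirichletCharacter ℂ q) {t : ℝ} (ht : 0 ≤ t) :
    ‖charDev χ t‖ ≤ 4 * q := by
  have hq : (1 : ℝ) ≤ q := by exact_mod_cast (NeZero.pos q)
  have h1 := norm_sum_range_sub_charMean_le χ (⌊t⌋₊ + 1)
  have h2 : charDev χ t = (∑ k ∈ range (⌊t⌋₊ + 1), χ k - charMean χ * (⌊t⌋₊ + 1 : ℕ)) - χ (0 : ℕ)
      + charMean χ * ((⌊t⌋₊ + 1 - t : ℝ) : ℂ) := by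
    rw [charDev, sum_Icc_one_eq (fun k ↦ χ k)]
    push_cast
    ring
  have h3 : ‖charMean χ * ((⌊t⌋₊ + 1 - t : ℝ) : ℂ)‖ ≤ 1 := by
    rw [norm_mul, Complex.norm_real]
    refine mul_le_one₀ (norm_charMean_le χ) (norm_nonneg _) ?_
    rw [Real.norm_eq_abs, abs_le]
    constructor <;> linarith [Nat.floor_le ht, Nat.lt_floor_add_one t]
  have h4 : ‖χ ((0 : ℕ) : ZMod q)‖ ≤ 1 := χ.norm_le_one _
  rw [h2]
  refine (norm_add_le _ _).trans ?_
  have := norm_sub_le (∑ k ∈ range (⌊t⌋₊ + 1), χ k - charMean χ * (⌊t⌋₊ + 1 : ℕ)) (χ (0 : ℕ))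
  linarith

lemma measurable_charDev {q : ℕ} [NeZero q] (χ : DirichletCharacter ℂ q) :
    Measurable (charDev χ) := by
  have h : Measurable fun t : ℝ ↦ (fun n : ℕ ↦ ∑ k ∈ Icc 1 n, χ k) ⌊t⌋₊ :=
    (measurable_from_nat (f := fun n : ℕ ↦ ∑ k ∈ Icc 1 n, χ k)).comp Nat.measurable_floor
  exact h.sub (by fun_prop)

/-- The integral appearing in the continuation of the tail of a Dirichlet `L`-series. -/
noncomputable def tailInt {q : ℕ} [NeZero q] (χ : DirichletCharacter ℂ q) (N : ℕ) (s : ℂ) : ℂ :=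
  ∫ t in Set.Ioi (N : ℝ), (charDev χ t - charDev χ N) * (t : ℂ) ^ (-(s + 1))

lemma norm_tailInt_integrand_le {q : ℕ} [NeZero q] (χ : DirichletCharacter ℂ q) {N : ℕ}
    {s : ℂ} {t : ℝ} (ht : (N : ℝ) < t) :
    ‖(charDev χ t - charDev χ N) * (t : ℂ) ^ (-(s + 1))‖ ≤ 8 * q * t ^ (-(s.re + 1)) := by
  have h0 : 0 < t := lt_of_le_of_lt (Nat.cast_nonneg N) ht
  rw [norm_mul, Complex.norm_cpow_eq_rpow_re_of_pos h0]
  simp only [Complex.neg_re, Complex.add_re, Complex.one_re]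
  gcongr
  linarith [norm_sub_le (charDev χ t) (charDev χ N), norm_charDev_le χ h0.le,
    norm_charDev_le χ (Nat.cast_nonneg (α := ℝ) N)]

lemma norm_tailInt_le {q : ℕ} [NeZero q] (χ : DirichletCharacter ℂ q) {N : ℕ} (hN : 0 < N)
    {s : ℂ} (hs : 0 < s.re) :
    ‖tailInt χ N s‖ ≤ 8 * q * ((N : ℝ) ^ (-s.re) / s.re) := by
  have hN' : (0 : ℝ) < N := by exact_mod_cast hN
  have h1 : ∫ t in Set.Ioi (N : ℝ), 8 * q * t ^ (-(s.re + 1)) =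
      8 * q * ((N : ℝ) ^ (-s.re) / s.re) := by
    rw [MeasureTheory.integral_const_mul, integral_Ioi_rpow_of_lt (by linarith) hN']
    congr 1
    rw [show -(s.re + 1) + 1 = -s.re by ring, neg_div_neg_eq]
  rw [← h1]
  refine MeasureTheory.norm_integral_le_of_norm_le
    ((integrableOn_Ioi_rpow_of_lt (by linarith) hN').const_mul _) ?_
  filter_upwards [MeasureTheory.ae_restrict_mem measurableSet_Ioi] with t ht
  exact norm_tailInt_integrand_le χ ht

open Filter Asymptotics in
lemma differentiableAt_tailInt {q : ℕ} [NeZero q] (χ : DirichletCharacter ℂ q) {N : ℕ}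
    (hN : 0 < N) {s : ℂ} (hs : 0 < s.re) : DifferentiableAt ℂ (tailInt χ N) s := by
  have hN' : (0 : ℝ) < N := by exact_mod_cast hN
  set g : ℝ → ℂ := Set.indicator (Set.Ioi (N : ℝ)) fun t ↦ charDev χ t - charDev χ N with hg
  have hmeas : Measurable g :=
    ((measurable_charDev χ).sub measurable_const).indicator measurableSet_Ioi
  have hbd : ∀ t, ‖g t‖ ≤ 8 * q := by
    intro t
    rw [hg, Set.indicator_apply]
    split_ifs with h
    · have h0 : 0 < t := lt_trans hN' h
      linarith [norm_sub_le (charDev χ t) (charDev χ N), norm_charDev_le χ h0.le,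
        norm_charDev_le χ (Nat.cast_nonneg (α := ℝ) N)]
    · simp
  have heq : tailInt χ N = fun s ↦ mellin g (-s) := by
    ext s
    rw [tailInt, mellin, ← MeasureTheory.integral_indicator measurableSet_Ioi,
      ← MeasureTheory.integral_indicator measurableSet_Ioi]
    congr 1
    ext t
    simp only [Set.indicator_apply, hg, Set.mem_Ioi, smul_eq_mul]
    by_cases h : (N : ℝ) < t
    · rw [if_pos h, if_pos (hN'.trans h), if_pos h, mul_comm, show -s - 1 = -(s + 1) by ring]
    · simp [h]
  rw [heq]
  refine DifferentiableAt.fun_comp' s (g := mellin g) (f := fun s ↦ -s) ?_ (by fun_prop)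
  refine mellin_differentiableAt_of_isBigO_rpow (a := 0) (b := (-s).re - 1) ?_ ?_ ?_ ?_ ?_
  · refine MeasureTheory.LocallyIntegrable.locallyIntegrableOn ?_ _
    refine MeasureTheory.LocallyIntegrable.mono
      (MeasureTheory.locallyIntegrable_const (8 * q : ℝ)) hmeas.aestronglyMeasurable ?_
    exact Eventually.of_forall fun t ↦ (hbd t).trans (Real.le_norm_self _)
  · simp only [neg_zero, Real.rpow_zero]
    exact IsBigO.of_bound (8 * q) (Eventually.of_forall fun t ↦ by simpa using hbd t)
  · simpa using hs
  · refine (isBigO_zero _ _).congr' ?_ EventuallyEq.rfl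
    filter_upwards [mem_nhdsWithin_of_mem_nhds (Iio_mem_nhds hN')] with t ht
    have : ¬ (N : ℝ) < t := not_lt.mpr (Set.mem_Iio.mp ht).le
    simp [hg, this]
  · linarith


/-- The entire function `(s - 1) L(s, χ)`. -/
noncomputable def lfunOne {q : ℕ} [NeZero q] (χ : DirichletCharacter ℂ q) : ℂ → ℂ :=
  open Classical in
  if χ = 1 then DirichletCharacter.LFunctionTrivChar₁ q
  else fun s ↦ (s - 1) * DirichletCharacter.LFunction χ s

lemma differentiable_lfunOne {q : ℕ} [NeZero q] (χ : DirichletCharacter ℂ q) :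
    Differentiable ℂ (lfunOne χ) := by
  rw [lfunOne]
  split_ifs with h
  · exact DirichletCharacter.differentiable_LFunctionTrivChar₁ q
  · exact (differentiable_id.sub_const 1).mul (DirichletCharacter.differentiable_LFunction h)

lemma lfunOne_eq_mul {q : ℕ} [NeZero q] (χ : DirichletCharacter ℂ q) {s : ℂ} (hs : s ≠ 1) :
    lfunOne χ s = (s - 1) * DirichletCharacter.LFunction χ s := by
  rw [lfunOne]
  split_ifs with h
  · rw [DirichletCharacter.LFunctionTrivChar₁, Function.update_of_ne hs, h]
  · rfl

lemma lfunOne_eq_of_one_lt_re {q : ℕ} [NeZero q] (χ : DirichletCharacter ℂ q) {N : ℕ} (hN : 0 < N)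
    {s : ℂ} (hs : 1 < s.re) :
    lfunOne χ s = (s - 1) * ∑ n ∈ Icc 1 N, χ n * (n : ℂ) ^ (-s) + charMean χ * (N : ℂ) ^ (1 - s)
      + (s - 1) * s * tailInt χ N s := by
  have hN' : (0 : ℝ) < N := by exact_mod_cast hN
  have hs0 : s ≠ 0 := by rintro rfl; simp at hs; linarith
  have hs1 : s ≠ 1 := by rintro rfl; simp at hs
  have hs1' : s - 1 ≠ 0 := sub_ne_zero.mpr hs1
  rw [lfunOne_eq_mul χ hs1, DirichletCharacter.LFunction_eq_LSeries χ hs]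
  set g : ℕ → ℂ := fun n ↦ if n ≤ N then χ n else 0 with hg
  set f : ℕ → ℂ := fun n ↦ if n ≤ N then 0 else χ n with hf
  have hfg : (fun n : ℕ ↦ χ n) = g + f := by
    ext n
    simp only [hg, hf, Pi.add_apply]
    split_ifs <;> simp
  have hgs : ∀ n ∉ Icc 1 N, LSeries.term g s n = 0 := by
    intro n hn
    rcases Nat.eq_zero_or_pos n with h | h
    · simp [h]
    · have : ¬ n ≤ N := fun h' ↦ hn (mem_Icc.mpr ⟨h, h'⟩)
      rw [LSeries.term_of_ne_zero h.ne']
      simp [hg, this]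
  have hgS : LSeriesSummable g s := summable_of_ne_finset_zero (s := Icc 1 N) hgs
  have hS : LSeriesSummable (fun n : ℕ ↦ χ n) s := χ.LSeriesSummable_of_one_lt_re hs
  have hfS : LSeriesSummable f s := by
    have : f = (fun n : ℕ ↦ χ n) - g := by rw [hfg]; simp
    rw [this]
    exact hS.sub hgS
  have hfb : ∀ n, ‖f n‖ ≤ 1 := by
    intro n
    simp only [hf]
    split_ifs
    · simp
    · exact χ.norm_le_one _
  have hLg : LSeries g s = ∑ n ∈ Icc 1 N, χ n * (n : ℂ) ^ (-s) := by
    rw [LSeries, tsum_eq_sum hgs]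
    refine sum_congr rfl fun n hn ↦ ?_
    rw [mem_Icc] at hn
    rw [LSeries.term_of_ne_zero (by omega), Complex.cpow_neg, div_eq_mul_inv]
    simp [hg, hn.2]
  have hLf : LSeries f s = s * ∫ t in Set.Ioi (1 : ℝ), (∑ k ∈ Icc 1 ⌊t⌋₊, f k) * t ^ (-(s + 1)) := by
    refine LSeries_eq_mul_integral' f zero_le_one hs ?_
    refine Asymptotics.IsBigO.of_bound 1 (Filter.Eventually.of_forall fun n ↦ ?_)
    rw [Real.norm_of_nonneg (sum_nonneg fun _ _ ↦ norm_nonneg _), one_mul, Real.rpow_one]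
    calc ∑ k ∈ Icc 1 n, ‖f k‖ ≤ ∑ k ∈ Icc 1 n, (1 : ℝ) := sum_le_sum fun k _ ↦ hfb k
      _ = n := by simp
      _ ≤ _ := Real.le_norm_self _
  have hsum : ∀ t : ℝ, (N : ℝ) < t → ∑ k ∈ Icc 1 ⌊t⌋₊, f k =
      (charDev χ t - charDev χ N) + charMean χ * (t - N) := by
    intro t ht
    have h1 : N ≤ ⌊t⌋₊ := Nat.le_floor ht.le
    rw [charDev, charDev, Nat.floor_natCast]
    have h2 : ∑ k ∈ Icc 1 ⌊t⌋₊, χ k = ∑ k ∈ Icc 1 ⌊t⌋₊, g k + ∑ k ∈ Icc 1 ⌊t⌋₊, f k := by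
      rw [← sum_add_distrib]
      exact sum_congr rfl fun k _ ↦ congrFun hfg k
    have h3 : ∑ k ∈ Icc 1 ⌊t⌋₊, g k = ∑ k ∈ Icc 1 N, χ k := by
      rw [hg, ← sum_filter]
      refine sum_congr ?_ fun _ _ ↦ rfl
      ext k
      simp only [mem_filter, mem_Icc]
      omega
    rw [h2, h3]
    push_cast
    ring
  have hinteg : ∫ t in Set.Ioi (1 : ℝ), (∑ k ∈ Icc 1 ⌊t⌋₊, f k) * t ^ (-(s + 1)) =
      ∫ t in Set.Ioi (N : ℝ), ((charDev χ t - charDev χ N) * (t : ℂ) ^ (-(s + 1)) +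
        (charMean χ * (t : ℂ) ^ (-s) - charMean χ * N * (t : ℂ) ^ (-(s + 1)))) := by
    have h1 : ∀ t ∈ Set.Ioi (1 : ℝ) \ Set.Ioi (N : ℝ),
        (∑ k ∈ Icc 1 ⌊t⌋₊, f k) * (t : ℂ) ^ (-(s + 1)) = 0 := by
      intro t ht
      have h2 : ⌊t⌋₊ ≤ N := Nat.floor_le_of_le (not_lt.mp ht.2)
      rw [sum_eq_zero, zero_mul]
      intro k hk
      rw [mem_Icc] at hk
      simp [hf, hk.2.trans h2]
    rw [MeasureTheory.setIntegral_eq_of_subset_of_forall_sdiff_eq_zero measurableSet_Ioi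
      (Set.Ioi_subset_Ioi (by exact_mod_cast hN)) h1]
    refine MeasureTheory.setIntegral_congr_fun measurableSet_Ioi fun t ht ↦ ?_
    have ht0 : (t : ℂ) ≠ 0 := by exact_mod_cast (hN'.trans ht).ne'
    have h3 : (t : ℂ) ^ (-s) = t * (t : ℂ) ^ (-(s + 1)) := by
      rw [show -s = 1 + -(s + 1) by ring, Complex.cpow_add _ _ ht0, Complex.cpow_one]
    rw [hsum t ht, h3]
    ring
  have hi1 : MeasureTheory.IntegrableOn (fun t : ℝ ↦ (t : ℂ) ^ (-s)) (Set.Ioi (N : ℝ)) :=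
    integrableOn_Ioi_cpow_of_lt (by simpa using hs) hN'
  have hi2 : MeasureTheory.IntegrableOn (fun t : ℝ ↦ (t : ℂ) ^ (-(s + 1))) (Set.Ioi (N : ℝ)) :=
    integrableOn_Ioi_cpow_of_lt (by simp; linarith) hN'
  have hi0 : MeasureTheory.IntegrableOn
      (fun t : ℝ ↦ (charDev χ t - charDev χ N) * (t : ℂ) ^ (-(s + 1))) (Set.Ioi (N : ℝ)) := by
    refine MeasureTheory.Integrable.bdd_mul (c := 8 * q) hi2
      ((measurable_charDev χ).sub measurable_const).aestronglyMeasurable ?_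
    filter_upwards [MeasureTheory.ae_restrict_mem measurableSet_Ioi] with t ht
    have h0 : 0 < t := hN'.trans ht
    linarith [norm_sub_le (charDev χ t) (charDev χ N), norm_charDev_le χ h0.le,
      norm_charDev_le χ (Nat.cast_nonneg (α := ℝ) N)]
  have hval : ∫ t in Set.Ioi (1 : ℝ), (∑ k ∈ Icc 1 ⌊t⌋₊, f k) * t ^ (-(s + 1)) =
      tailInt χ N s + charMean χ * (N : ℂ) ^ (1 - s) / (s * (s - 1)) := by
    have hi3 : MeasureTheory.IntegrableOn (fun t : ℝ ↦ charMean χ * (t : ℂ) ^ (-s) -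
        charMean χ * N * (t : ℂ) ^ (-(s + 1))) (Set.Ioi (N : ℝ)) :=
      (hi1.const_mul _).sub (hi2.const_mul _)
    rw [hinteg, MeasureTheory.integral_add hi0 hi3,
      MeasureTheory.integral_sub (hi1.const_mul _) (hi2.const_mul _),
      MeasureTheory.integral_const_mul, MeasureTheory.integral_const_mul,
      integral_Ioi_cpow_of_lt (by simpa using hs) hN',
      integral_Ioi_cpow_of_lt (by simp; linarith) hN', ← tailInt]
    congr 1
    have hNc : ((N : ℝ) : ℂ) ≠ 0 := by exact_mod_cast hN'.ne'
    have h4 : ((N : ℝ) : ℂ) ^ (-s + 1) = (N : ℝ) * ((N : ℝ) : ℂ) ^ (-s) := by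
      rw [Complex.cpow_add _ _ hNc, Complex.cpow_one, mul_comm]
    have h5 : ((N : ℝ) : ℂ) ^ (1 - s) = (N : ℝ) * ((N : ℝ) : ℂ) ^ (-s) := by
      rw [← h4]; ring_nf
    rw [show -(s + 1) + 1 = -s by ring, h4]
    rw [Complex.ofReal_natCast] at *
    rw [h5]
    have h6 : -s + 1 ≠ 0 := by rw [neg_add_eq_sub]; exact sub_ne_zero.mpr hs1.symm
    field_simp
    ring
  rw [hfg, LSeries_add hgS hfS, hLg, hLf, hval]
  field_simp
  ring

lemma lfunOne_eq {q : ℕ} [NeZero q] (χ : DirichletCharacter ℂ q) {N : ℕ} (hN : 0 < N)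
    {s : ℂ} (hs : 0 < s.re) :
    lfunOne χ s = (s - 1) * ∑ n ∈ Icc 1 N, χ n * (n : ℂ) ^ (-s) + charMean χ * (N : ℂ) ^ (1 - s)
      + (s - 1) * s * tailInt χ N s := by
  have hU : IsOpen {z : ℂ | 0 < z.re} := isOpen_lt continuous_const Complex.continuous_re
  have hNc : (N : ℂ) ≠ 0 := by exact_mod_cast hN.ne'
  refine AnalyticOnNhd.eqOn_of_preconnected_of_eventuallyEq (U := {z : ℂ | 0 < z.re})
    (f := lfunOne χ) (g := fun s ↦ (s - 1) * ∑ n ∈ Icc 1 N, χ n * (n : ℂ) ^ (-s) +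
      charMean χ * (N : ℂ) ^ (1 - s) + (s - 1) * s * tailInt χ N s) (z₀ := 2)
    ((differentiable_lfunOne χ).differentiableOn.analyticOnNhd hU)
    (DifferentiableOn.analyticOnNhd ?_ hU) (convex_halfSpace_re_gt 0).isPreconnected
    (by simp) ?_ hs
  · intro z hz
    refine DifferentiableAt.differentiableWithinAt ?_
    refine DifferentiableAt.add (DifferentiableAt.add (DifferentiableAt.mul (by fun_prop)
      (DifferentiableAt.fun_sum fun n hn ↦ ?_)) ?_) (DifferentiableAt.mul (by fun_prop)
      (differentiableAt_tailInt χ hN hz))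
    · have : (n : ℂ) ≠ 0 := by
        have := (mem_Icc.mp hn).1
        exact_mod_cast (by omega : n ≠ 0)
      exact (differentiableAt_id.neg.const_cpow (Or.inl this)).const_mul _
    · exact ((differentiableAt_id.const_sub 1).const_cpow (Or.inl hNc)).const_mul _
  · have : {z : ℂ | 1 < z.re} ∈ nhds (2 : ℂ) :=
      (isOpen_lt continuous_const Complex.continuous_re).mem_nhds (by simp)
    filter_upwards [this] with z hz
    exact lfunOne_eq_of_one_lt_re χ hN hz

/-- The analytic conductor of a character modulo `q` at height `t`. -/
noncomputable def cond (q : ℕ) (t : ℝ) : ℝ := q * (|t| + 2)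

lemma two_le_cond (q : ℕ) [NeZero q] (t : ℝ) : 2 ≤ cond q t := by
  have hq : (1 : ℝ) ≤ q := by exact_mod_cast (NeZero.pos q)
  have := abs_nonneg t
  rw [cond]
  nlinarith

lemma norm_natCast_cpow_neg_le {n N : ℕ} (hn : 0 < n) (hnN : n ≤ N) {δ : ℝ} {s : ℂ}
    (hδ : 0 ≤ δ) (hs : 1 - δ ≤ s.re) : ‖(n : ℂ) ^ (-s)‖ ≤ (N : ℝ) ^ δ * (n : ℝ)⁻¹ := by
  have hn' : (1 : ℝ) ≤ n := by exact_mod_cast hn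
  rw [Complex.norm_natCast_cpow_of_pos hn]
  calc (n : ℝ) ^ (-s).re ≤ (n : ℝ) ^ (δ + -1) := by
        refine Real.rpow_le_rpow_of_exponent_le hn' ?_
        simp only [Complex.neg_re]
        linarith
    _ = (n : ℝ) ^ δ * (n : ℝ)⁻¹ := by rw [Real.rpow_add (by linarith), Real.rpow_neg_one]
    _ ≤ (N : ℝ) ^ δ * (n : ℝ)⁻¹ := by gcongr

lemma norm_lfunOne_le {δ : ℝ} (hδ : 0 < δ) (hδ' : δ ≤ 1 / 2) : ∃ C : ℝ, 0 < C ∧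
    ∀ (q : ℕ) [NeZero q] (χ : DirichletCharacter ℂ q) (s : ℂ), 1 - δ ≤ s.re → s.re ≤ 4 →
      ‖lfunOne χ s‖ ≤ C * cond q s.im ^ (2 * δ) * (‖s - 1‖ + ‖charMean χ‖) := by
  refine ⟨2 * (33 + 1 / δ), by positivity, fun q _ χ s hs1 hs2 ↦ ?_⟩
  have hq : (0 : ℝ) < q := by exact_mod_cast (NeZero.pos q)
  set z := cond q s.im with hz
  have hz2 : 2 ≤ z := two_le_cond q s.im
  set N := ⌈z⌉₊ with hN
  have hzN : z ≤ N := Nat.le_ceil z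
  have hN1 : 0 < N := Nat.ceil_pos.mpr (by linarith)
  have hN1' : (1 : ℝ) ≤ N := by exact_mod_cast hN1
  have hN2 : (N : ℝ) ≤ 2 * z := by linarith [Nat.ceil_lt_add_one (show 0 ≤ z by linarith)]
  have hre : 0 < s.re := by linarith
  have hNd : 1 ≤ (N : ℝ) ^ δ := Real.one_le_rpow hN1' hδ.le
  have hlog : Real.log N ≤ (N : ℝ) ^ δ / δ := Real.log_le_rpow_div (by linarith) hδ
  have hN2d : (N : ℝ) ^ (2 * δ) = (N : ℝ) ^ δ * (N : ℝ) ^ δ := by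
    rw [two_mul, Real.rpow_add (by linarith)]
  have hsum : ‖∑ n ∈ Icc 1 N, χ n * (n : ℂ) ^ (-s)‖ ≤ (1 + 1 / δ) * (N : ℝ) ^ (2 * δ) := by
    calc ‖∑ n ∈ Icc 1 N, χ n * (n : ℂ) ^ (-s)‖
        ≤ ∑ n ∈ Icc 1 N, (N : ℝ) ^ δ * (n : ℝ)⁻¹ := by
          refine norm_sum_le_of_le _ fun n hn ↦ ?_
          rw [mem_Icc] at hn
          rw [norm_mul]
          refine (mul_le_of_le_one_left (norm_nonneg _) (χ.norm_le_one _)).trans ?_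
          exact norm_natCast_cpow_neg_le hn.1 hn.2 hδ.le hs1
      _ = (N : ℝ) ^ δ * (harmonic N : ℝ) := by
          rw [← mul_sum, harmonic_eq_sum_Icc]
          push_cast
          rfl
      _ ≤ (N : ℝ) ^ δ * (1 + Real.log N) := by
          gcongr
          exact harmonic_le_one_add_log N
      _ ≤ (N : ℝ) ^ δ * ((N : ℝ) ^ δ + (N : ℝ) ^ δ / δ) := by gcongr
      _ = _ := by rw [hN2d]; ring
  have hsn : ‖s‖ ≤ 2 * (|s.im| + 2) := by
    have := Complex.norm_le_abs_re_add_abs_im s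
    rw [abs_of_pos hre] at this
    have := abs_nonneg s.im
    linarith
  have htail : ‖s * tailInt χ N s‖ ≤ 32 * (N : ℝ) ^ (2 * δ) := by
    have h1 : (N : ℝ) ^ (-s.re) ≤ (N : ℝ) ^ δ * z⁻¹ := by
      have := norm_natCast_cpow_neg_le hN1 le_rfl hδ.le hs1
      rw [Complex.norm_natCast_cpow_of_pos hN1] at this
      refine this.trans ?_
      gcongr
    have h2 : (N : ℝ) ^ (-s.re) / s.re ≤ (N : ℝ) ^ δ * z⁻¹ / (1 / 2) := by
      gcongr
      linarith
    rw [norm_mul]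
    calc ‖s‖ * ‖tailInt χ N s‖ ≤
          (2 * (|s.im| + 2)) * (8 * q * ((N : ℝ) ^ δ * z⁻¹ / (1 / 2))) := by
          gcongr
          refine (norm_tailInt_le χ hN1 hre).trans ?_
          gcongr
      _ = 32 * (N : ℝ) ^ δ * (z * z⁻¹) := by rw [hz, cond]; ring
      _ = 32 * (N : ℝ) ^ δ * 1 := by rw [mul_inv_cancel₀ (by linarith)]
      _ ≤ 32 * (N : ℝ) ^ (2 * δ) := by rw [hN2d]; nlinarith
  have hmid : ‖(N : ℂ) ^ (1 - s)‖ ≤ (N : ℝ) ^ (2 * δ) := by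
    rw [Complex.norm_natCast_cpow_of_pos hN1]
    refine Real.rpow_le_rpow_of_exponent_le hN1' ?_
    simp only [Complex.sub_re, Complex.one_re]
    linarith
  have hNz : (N : ℝ) ^ (2 * δ) ≤ 2 * z ^ (2 * δ) := by
    calc (N : ℝ) ^ (2 * δ) ≤ (2 * z) ^ (2 * δ) := by gcongr
      _ = 2 ^ (2 * δ) * z ^ (2 * δ) := by rw [Real.mul_rpow (by norm_num) (by linarith)]
      _ ≤ 2 ^ (1 : ℝ) * z ^ (2 * δ) := by
          gcongr
          · norm_num
          · linarith
      _ = _ := by rw [Real.rpow_one]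
  rw [lfunOne_eq χ hN1 hre, mul_assoc (s - 1)]
  calc ‖(s - 1) * ∑ n ∈ Icc 1 N, χ n * (n : ℂ) ^ (-s) + charMean χ * (N : ℂ) ^ (1 - s)
      + (s - 1) * (s * tailInt χ N s)‖
      ≤ ‖s - 1‖ * ((1 + 1 / δ) * (N : ℝ) ^ (2 * δ)) + ‖charMean χ‖ * (N : ℝ) ^ (2 * δ)
        + ‖s - 1‖ * (32 * (N : ℝ) ^ (2 * δ)) := by
        refine (norm_add₃_le).trans ?_
        rw [norm_mul, norm_mul, norm_mul (s - 1)]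
        gcongr
    _ ≤ (33 + 1 / δ) * (‖s - 1‖ + ‖charMean χ‖) * (N : ℝ) ^ (2 * δ) := by
        have : 0 ≤ (32 + 1 / δ) * ‖charMean χ‖ * (N : ℝ) ^ (2 * δ) := by positivity
        nlinarith
    _ ≤ (33 + 1 / δ) * (‖s - 1‖ + ‖charMean χ‖) * (2 * z ^ (2 * δ)) := by gcongr
    _ = _ := by ring

lemma cond_le_two_mul {q : ℕ} {t t' : ℝ} (h : |t'| ≤ 2 * |t| + 2) : cond q t' ≤ 2 * cond q t := by
  rw [cond, cond]
  have : (0 : ℝ) ≤ q := Nat.cast_nonneg q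
  nlinarith

lemma cond_rpow_le {q : ℕ} [NeZero q] {t t' : ℝ} (h : |t'| ≤ 2 * |t| + 2) {ε : ℝ} (hε : 0 ≤ ε)
    (hε' : ε ≤ 1) : cond q t' ^ ε ≤ 2 * cond q t ^ ε := by
  have h1 := two_le_cond q t
  have h2 := two_le_cond q t'
  calc cond q t' ^ ε ≤ (2 * cond q t) ^ ε :=
        Real.rpow_le_rpow (by linarith) (cond_le_two_mul h) hε
    _ = 2 ^ ε * cond q t ^ ε := Real.mul_rpow (by norm_num) (by linarith)
    _ ≤ 2 ^ (1 : ℝ) * cond q t ^ ε := by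
        gcongr
        norm_num
    _ = _ := by rw [Real.rpow_one]

lemma norm_LFunction_le_of_ne_one {δ : ℝ} (hδ : 0 < δ) (hδ' : δ ≤ 1 / 2) : ∃ C : ℝ, 0 < C ∧
    ∀ (q : ℕ) [NeZero q] (χ : DirichletCharacter ℂ q) (s : ℂ), s ≠ 1 → 1 - δ ≤ s.re → s.re ≤ 4 →
      ‖DirichletCharacter.LFunction χ s‖ ≤
        C * cond q s.im ^ (2 * δ) * (1 + ‖charMean χ‖ / ‖s - 1‖) := by
  obtain ⟨C, hC, h⟩ := norm_lfunOne_le hδ hδ'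
  refine ⟨C, hC, fun q _ χ s hs hs1 hs2 ↦ ?_⟩
  have h1 := h q χ s hs1 hs2
  have h2 : 0 < ‖s - 1‖ := norm_pos_iff.mpr (sub_ne_zero.mpr hs)
  rw [lfunOne_eq_mul χ hs, norm_mul] at h1
  rw [← mul_le_mul_iff_right₀ h2]
  refine h1.trans (le_of_eq ?_)
  field_simp

lemma norm_LFunction_le {δ : ℝ} (hδ : 0 < δ) (hδ' : δ ≤ 1 / 2) : ∃ C : ℝ, 0 < C ∧
    ∀ (q : ℕ) [NeZero q] (χ : DirichletCharacter ℂ q) (s : ℂ), (χ ≠ 1 ∨ s ≠ 1) →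
      1 - δ ≤ s.re → s.re ≤ 4 → ‖DirichletCharacter.LFunction χ s‖ ≤
        C * cond q s.im ^ (2 * δ) * (1 + ‖charMean χ‖ / ‖s - 1‖) := by
  obtain ⟨C, hC, h⟩ := norm_LFunction_le_of_ne_one hδ hδ'
  refine ⟨C, hC, fun q _ χ s hs hs1 hs2 ↦ ?_⟩
  by_cases hs' : s = 1
  swap
  · exact h q χ s hs' hs1 hs2
  have hχ : χ ≠ 1 := by tauto
  subst hs'
  have hd : Continuous fun x : ℝ ↦ ‖DirichletCharacter.LFunction χ (1 + x)‖ :=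
    ((DirichletCharacter.differentiable_LFunction hχ).continuous.comp (by fun_prop)).norm
  have ht := (hd.tendsto 0).mono_left (nhdsWithin_le_nhds (s := Set.Ioi 0))
  simp only [Complex.ofReal_zero, add_zero] at ht
  simp only [charMean_of_ne_one hχ, norm_zero, zero_div, add_zero, mul_one]
  refine le_of_tendsto ht ?_
  filter_upwards [Ioo_mem_nhdsGT (show (0 : ℝ) < 1 by norm_num)] with x hx
  have h1 := h q χ (1 + x) (by simpa using hx.1.ne') (by simp; linarith [hx.1])
    (by simp; linarith [hx.2])
  simpa [charMean_of_ne_one hχ] using h1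

lemma norm_LFunction_deriv_le {δ : ℝ} (hδ : 0 < δ) (hδ' : δ ≤ 1 / 2) : ∃ C : ℝ, 0 < C ∧
    ∀ (q : ℕ) [NeZero q] (χ : DirichletCharacter ℂ q) (s : ℂ), (χ ≠ 1 ∨ 1 ≤ ‖s - 1‖) →
      1 ≤ s.re → s.re ≤ 2 →
      (∀ s', ‖s' - s‖ ≤ δ → ‖DirichletCharacter.LFunction χ s'‖ ≤ C * cond q s.im ^ (2 * δ)) ∧
      ‖deriv (DirichletCharacter.LFunction χ) s‖ ≤ C * cond q s.im ^ (2 * δ) := by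
  obtain ⟨C, hC, h⟩ := norm_LFunction_le hδ hδ'
  refine ⟨C * 6 / δ, by positivity, fun q _ χ s hs hs1 hs2 ↦ ?_⟩
  have hz := two_le_cond q s.im
  have key : ∀ s', ‖s' - s‖ ≤ δ →
      ‖DirichletCharacter.LFunction χ s'‖ ≤ C * 6 * cond q s.im ^ (2 * δ) := by
    intro s' hs'
    have h1 : |s'.re - s.re| ≤ δ := by
      simpa using (Complex.abs_re_le_norm (s' - s)).trans hs'
    have h2 : |s'.im - s.im| ≤ δ := by
      simpa using (Complex.abs_im_le_norm (s' - s)).trans hs'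
    have h3 : |s'.im| ≤ 2 * |s.im| + 2 := by
      have := abs_sub_abs_le_abs_sub s'.im s.im
      have := abs_nonneg s.im
      linarith
    rw [abs_le] at h1
    have h4 : (χ ≠ 1 ∨ s' ≠ 1) ∧ ‖charMean χ‖ / ‖s' - 1‖ ≤ 2 := by
      rcases hs with hs | hs
      · exact ⟨Or.inl hs, by simp [charMean_of_ne_one hs]⟩
      · have h5 : 1 / 2 ≤ ‖s' - 1‖ := by
          have := norm_sub_norm_le (s - 1) (s - s')
          rw [show s - 1 - (s - s') = s' - 1 by ring, norm_sub_rev s s'] at this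
          linarith
        refine ⟨Or.inr fun h6 ↦ by simp [h6] at h5; linarith, ?_⟩
        rw [div_le_iff₀ (by linarith)]
        linarith [norm_charMean_le χ]
    calc ‖DirichletCharacter.LFunction χ s'‖
        ≤ C * cond q s'.im ^ (2 * δ) * (1 + ‖charMean χ‖ / ‖s' - 1‖) :=
          h q χ s' h4.1 (by linarith) (by linarith)
      _ ≤ C * (2 * cond q s.im ^ (2 * δ)) * (1 + 2) := by
          have := cond_rpow_le (q := q) h3 (ε := 2 * δ) (by linarith) (by linarith)
          have : 0 ≤ cond q s.im ^ (2 * δ) := by positivity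
          gcongr
          exact h4.2
      _ = _ := by ring
  have hp : 0 ≤ cond q s.im ^ (2 * δ) := by positivity
  constructor
  · intro s' hs'
    refine (key s' hs').trans ?_
    gcongr
    rw [le_div_iff₀ hδ]
    nlinarith
  · have h5 : ∀ s', ‖s' - s‖ ≤ δ → χ ≠ 1 ∨ s' ≠ 1 := by
      intro s' hs'
      by_contra! hcon
      rw [hcon.2, norm_sub_rev] at hs'
      rcases hs with hs | hs
      · exact hs hcon.1
      · linarith
    have hd : DiffContOnCl ℂ (DirichletCharacter.LFunction χ) (Metric.ball s δ) := by
      refine DifferentiableOn.diffContOnCl fun s' hs' ↦ ?_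
      rw [closure_ball _ hδ.ne', Metric.mem_closedBall, dist_eq_norm] at hs'
      exact (DirichletCharacter.differentiableAt_LFunction χ s'
        (h5 s' hs').symm).differentiableWithinAt
    refine (Complex.norm_deriv_le_of_forall_mem_sphere_norm_le hδ hd fun s' hs' ↦ ?_).trans
      (le_of_eq (by ring : C * 6 * cond q s.im ^ (2 * δ) / δ = _))
    rw [mem_sphere_iff_norm] at hs'
    refine key s' ?_
    linarith

/-- The zero-free argument based on `3 + 4 cos θ + cos 2θ ≥ 0`, in quantitative form. -/
lemma norm_ge_of_product_ge_one {f g h : ℝ → ℂ} {B y : ℝ} (hB : 1 ≤ B) (hy : 0 < y) (hy1 : y ≤ 1)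
    (hprod : ∀ x, y ≤ x → x ≤ 1 → 1 ≤ ‖f x‖ ^ 3 * ‖g x‖ ^ 4 * ‖h x‖)
    (hf : ∀ x, y ≤ x → x ≤ 1 → x * ‖f x‖ ≤ B) (hh : ∀ x, y ≤ x → x ≤ 1 → ‖h x‖ ≤ B)
    (hg : ∀ x, y ≤ x → x ≤ 1 → ‖g x - g y‖ ≤ B * (x - y)) : 1 / (16 * B ^ 7) ≤ ‖g y‖ := by
  have hB0 : 0 < B := by linarith
  have main : ∀ x, y ≤ x → x ≤ 1 → x ^ 3 / B ^ 4 ≤ ‖g x‖ ^ 4 := by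
    intro x hx hx1
    have hx0 : 0 < x := by linarith
    rw [div_le_iff₀ (by positivity)]
    calc x ^ 3 ≤ x ^ 3 * (‖f x‖ ^ 3 * ‖g x‖ ^ 4 * ‖h x‖) :=
          le_mul_of_one_le_right (by positivity) (hprod x hx hx1)
      _ = (x * ‖f x‖) ^ 3 * ‖g x‖ ^ 4 * ‖h x‖ := by ring
      _ ≤ B ^ 3 * ‖g x‖ ^ 4 * B := by
          gcongr
          · exact hf x hx hx1
          · exact hh x hx hx1
      _ = _ := by ring
  set x0 : ℝ := 1 / (16 * B ^ 8) with hx0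
  have hx0p : 0 < x0 := by positivity
  have hx0B : x0 * (16 * B ^ 8) = 1 := by rw [hx0]; field_simp
  have hx01 : x0 ≤ 1 := by
    rw [hx0, div_le_one (by positivity)]
    have : 1 ≤ B ^ 8 := one_le_pow₀ hB
    linarith
  have big : ∀ x, y ≤ x → x0 ≤ x → x ≤ 1 → 2 * B * x0 ≤ ‖g x‖ := by
    intro x hx hx' hx1
    refine le_of_pow_le_pow_left₀ (n := 4) (by norm_num) (norm_nonneg _) ?_
    refine le_trans ?_ (main x hx hx1)
    rw [le_div_iff₀ (by positivity)]
    calc (2 * B * x0) ^ 4 * B ^ 4 = x0 ^ 3 * (x0 * (16 * B ^ 8)) := by ring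
      _ = x0 ^ 3 := by rw [hx0B, mul_one]
      _ ≤ x ^ 3 := by gcongr
  have hgoal : 1 / (16 * B ^ 7) = B * x0 := by rw [hx0]; field_simp
  rw [hgoal]
  rcases le_total x0 y with h1 | h1
  · have := big y le_rfl h1 hy1
    nlinarith [mul_pos hB0 hx0p]
  · have h2 := big x0 h1 le_rfl hx01
    have h3 := hg x0 h1 hx01
    have h4 := norm_sub_norm_le (g x0) (g y)
    nlinarith [mul_pos hB0 hy]

open scoped ComplexOrder Nat in
lemma exists_taylor_coeff {a : ℕ → ℂ} (ha : 0 ≤ a) (ha1 : a 1 = 1)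
    (hsum : ∀ s : ℂ, 1 < s.re → LSeriesSummable a s) {P : ℂ → ℂ}
    (hPa : ∀ s : ℂ, 1 < s.re → P s = (s - 1) * LSeries a s) :
    ∃ b : ℕ → ℝ, (∀ m, 0 ≤ b m) ∧ 1 ≤ b 0 ∧
      ∀ m, (m ! : ℂ)⁻¹ * iteratedDeriv m (dslope P 1) 2 = (-1) ^ m * (b m - P 1) := by
  have habs : LSeries.abscissaOfAbsConv a ≤ (1 : ℝ) :=
    LSeries.abscissaOfAbsConv_le_of_forall_lt_LSeriesSummable fun y hy ↦ hsum y (by simpa using hy)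
  have habs2 : LSeries.abscissaOfAbsConv a < (2 : ℝ) :=
    lt_of_le_of_lt habs (by exact_mod_cast one_lt_two)
  have hD : ∀ m, 0 ≤ (-1) ^ m * iteratedDeriv m (LSeries a) 2 := by
    intro m
    simpa using LSeries.iteratedDeriv_alternating ha habs2 m
  have hopen : IsOpen {s : ℂ | 1 < s.re} := isOpen_lt continuous_const Complex.continuous_re
  have h2mem : {s : ℂ | 1 < s.re} ∈ nhds (2 : ℂ) := hopen.mem_nhds (by simp)
  have hne : ∀ s : ℂ, 1 < s.re → s - 1 ≠ 0 := by
    intro s hs h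
    rw [sub_eq_zero.mp h] at hs
    simp at hs
  have hg : dslope P 1 =ᶠ[nhds 2] (LSeries a - fun s ↦ P 1 * (s - 1)⁻¹) := by
    filter_upwards [h2mem] with s hs
    have h := hne s hs
    rw [dslope_of_ne _ (sub_ne_zero.mp h), slope_def_field, hPa s hs, Pi.sub_apply]
    field_simp
  have hLdiff : DifferentiableOn ℂ (LSeries a) {s : ℂ | 1 < s.re} := by
    intro s hs
    exact (LSeries_hasDerivAt (lt_of_le_of_lt habs (by exact_mod_cast hs))
      ).differentiableAt.differentiableWithinAt
  have hinv : ∀ m, iteratedDeriv m (fun s : ℂ ↦ P 1 * (s - 1)⁻¹) 2 = P 1 * ((-1) ^ m * m !) := by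
    intro m
    rw [iteratedDeriv_const_mul_field, iteratedDeriv_comp_sub_const m (fun s : ℂ ↦ s⁻¹) 1,
      iteratedDeriv_eq_iterate]
    change P 1 * deriv^[m] Inv.inv (2 - 1) = _
    rw [iter_deriv_inv]
    norm_num
  have hiter : ∀ m, iteratedDeriv m (dslope P 1) 2 =
      iteratedDeriv m (LSeries a) 2 - P 1 * ((-1) ^ m * m !) := by
    intro m
    rw [hg.iteratedDeriv_eq, iteratedDeriv_sub, hinv]
    · exact ((hLdiff.analyticAt h2mem).contDiffAt)
    · have : AnalyticAt ℂ (fun s : ℂ ↦ P 1 * (s - 1)⁻¹) 2 := by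
        have : ∀ᶠ s in nhds (2 : ℂ), DifferentiableAt ℂ (fun s : ℂ ↦ P 1 * (s - 1)⁻¹) s := by
          filter_upwards [h2mem] with s hs
          exact DifferentiableAt.const_mul
            ((differentiableAt_id.sub_const (1 : ℂ)).fun_inv (hne s hs)) _
        exact Complex.analyticAt_iff_eventually_differentiableAt.mpr this
      exact this.contDiffAt
  refine ⟨fun m ↦ ((-1) ^ m * iteratedDeriv m (LSeries a) 2).re / m !, fun m ↦ ?_, ?_, fun m ↦ ?_⟩
  · have := (Complex.le_def.mp (hD m)).1
    simp only [Complex.zero_re] at this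
    positivity
  · simp only [pow_zero, one_mul, iteratedDeriv_zero, Nat.factorial_zero, Nat.cast_one, div_one]
    have hS := hsum 2 (by simp)
    rw [LSeries, Complex.re_tsum hS]
    have h1 : (LSeries.term a 2 1).re = 1 := by
      rw [LSeries.term_of_ne_zero one_ne_zero]
      simp [ha1]
    rw [← h1]
    refine (Complex.hasSum_re hS.hasSum).summable.le_tsum 1 fun n _ ↦ ?_
    have := (Complex.le_def.mp (LSeries.term_nonneg (ha n) 2)).1
    simpa using this
  · rw [hiter]
    have him := (Complex.le_def.mp (hD m)).2
    have hre : (((-1) ^ m * iteratedDeriv m (LSeries a) 2).re : ℂ) =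
        (-1) ^ m * iteratedDeriv m (LSeries a) 2 := by
      apply Complex.ext
      · simp
      · simpa using him
    have hf : (m ! : ℂ) ≠ 0 := by exact_mod_cast m.factorial_ne_zero
    have hpm : ((-1 : ℂ) ^ m) * (-1) ^ m = 1 := by
      rw [← mul_pow]; simp
    push_cast
    rw [hre, mul_sub, mul_sub, show (-1 : ℂ) ^ m * ((-1) ^ m * iteratedDeriv m (LSeries a) 2 / m !) =
      ((-1) ^ m * (-1) ^ m) * (iteratedDeriv m (LSeries a) 2 / m !) by ring, hpm]
    field_simp

lemma hasSum_dslope {P : ℂ → ℂ} (hP : Differentiable ℂ P) {b : ℕ → ℝ}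
    (hb : ∀ m, (m.factorial : ℂ)⁻¹ * iteratedDeriv m (dslope P 1) 2 = (-1) ^ m * (b m - P 1))
    (β : ℝ) : HasSum (fun m ↦ ((b m : ℂ) - P 1) * ((2 - β : ℝ) : ℂ) ^ m) (dslope P 1 β) := by
  have hd : Differentiable ℂ (dslope P 1) := by
    rw [← differentiableOn_univ, Complex.differentiableOn_dslope Filter.univ_mem]
    exact hP.differentiableOn
  have heq : (fun m ↦ ((b m : ℂ) - P 1) * ((2 - β : ℝ) : ℂ) ^ m) = fun m ↦
      (m.factorial : ℂ)⁻¹ • ((β : ℂ) - 2) ^ m • iteratedDeriv m (dslope P 1) 2 := by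
    ext m
    rw [smul_eq_mul, smul_eq_mul, mul_left_comm, hb, show (β : ℂ) - 2 = -1 * ((2 - β : ℝ) : ℂ) by
      push_cast; ring, mul_pow]
    have hpm : ((-1 : ℂ) ^ m) * (-1) ^ m = 1 := by
      rw [← mul_pow]; simp
    linear_combination (-((b m : ℂ) - P 1) * ((2 - β : ℝ) : ℂ) ^ m) * hpm
  rw [heq]
  exact Complex.hasSum_taylorSeries_of_entire hd 2 (β : ℂ)

lemma im_apply_real_eq_zero {P : ℂ → ℂ} (hP : Differentiable ℂ P) {b : ℕ → ℝ}
    (hb : ∀ m, (m.factorial : ℂ)⁻¹ * iteratedDeriv m (dslope P 1) 2 = (-1) ^ m * (b m - P 1))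
    (β : ℝ) : (P β).im = 0 := by
  have h1 : (P 1).im = 0 := by
    have h := (Complex.hasSum_im (hasSum_dslope hP hb 1)).summable.tendsto_atTop_zero
    norm_num at h
    exact h
  have h2 : (dslope P 1 β).im = 0 := by
    rw [← (Complex.hasSum_im (hasSum_dslope hP hb β)).tsum_eq]
    convert tsum_zero with m
    rw [← Complex.ofReal_pow, Complex.im_mul_ofReal]
    simp [h1]
  have h3 : P β = P 1 + (β - 1) * dslope P 1 β := by
    have := sub_smul_dslope P 1 (β : ℂ)
    rw [smul_eq_mul] at this
    rw [this]
    ring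
  rw [h3]
  simp [h1, h2]

lemma estermann_real {b : ℕ → ℝ} {L G x θ B : ℝ} (hb : ∀ m, 0 ≤ b m) (hb0 : 1 ≤ b 0)
    (hx : 1 < x) (hθ : 0 < θ) (hθ1 : θ < 1) (hsum : HasSum (fun m ↦ (b m - L) * x ^ m) G)
    (hbd : ∀ m, |(b m - L) * x ^ m| ≤ B * θ ^ m) (hG : G ≤ L / (x - 1)) (M : ℕ) (hM : 0 < M) :
    1 - B * θ ^ M / (1 - θ) ≤ L * x ^ M / (x - 1) := by
  have htail := (hasSum_nat_add_iff' M).mpr hsum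
  have hgeom : HasSum (fun m ↦ B * θ ^ (m + M)) (B * θ ^ M / (1 - θ)) := by
    have := (hasSum_geometric_of_lt_one hθ.le hθ1).mul_left (B * θ ^ M)
    simpa only [mul_assoc, ← pow_add, add_comm M, ← div_eq_mul_inv] using this
  have h1 : ‖G - ∑ i ∈ range M, (b i - L) * x ^ i‖ ≤ B * θ ^ M / (1 - θ) := by
    rw [← htail.tsum_eq]
    exact tsum_of_norm_bounded hgeom fun m ↦ hbd (m + M)
  have h2 : 1 - L * ((x ^ M - 1) / (x - 1)) ≤ ∑ i ∈ range M, (b i - L) * x ^ i := by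
    rw [← geom_sum_eq hx.ne', mul_sum]
    simp only [sub_mul, sum_sub_distrib]
    gcongr
    calc (1 : ℝ) ≤ b 0 * x ^ 0 := by simpa using hb0
      _ ≤ ∑ i ∈ range M, b i * x ^ i :=
        single_le_sum (f := fun i ↦ b i * x ^ i) (fun i _ ↦ mul_nonneg (hb i) (by positivity))
          (mem_range.mpr hM)
  have h3 := (abs_le.mp (Real.norm_eq_abs _ ▸ h1)).1
  have h4 : L * x ^ M / (x - 1) = L * ((x ^ M - 1) / (x - 1)) + L / (x - 1) := by ring
  linarith

lemma norm_taylor_coeff_le {P : ℂ → ℂ} (hP : Differentiable ℂ P) {b : ℕ → ℝ}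
    (hb : ∀ m, (m.factorial : ℂ)⁻¹ * iteratedDeriv m (dslope P 1) 2 = (-1) ^ m * (b m - P 1))
    {K : ℝ} (hK : ∀ s : ℂ, ‖s - 2‖ ≤ 3 / 2 → ‖P s‖ ≤ K) (m : ℕ) :
    ‖(b m : ℂ) - P 1‖ ≤ 4 * K / (3 / 2) ^ m := by
  have hd : Differentiable ℂ (dslope P 1) := by
    rw [← differentiableOn_univ, Complex.differentiableOn_dslope Filter.univ_mem]
    exact hP.differentiableOn
  have h1 : ‖P 1‖ ≤ K := hK 1 (by norm_num)
  have hsph : ∀ s ∈ Metric.sphere (2 : ℂ) (3 / 2), ‖dslope P 1 s‖ ≤ 4 * K := by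
    intro s hs
    rw [mem_sphere_iff_norm] at hs
    have h2 : 1 / 2 ≤ ‖s - 1‖ := by
      have := norm_sub_le (s - 1) 1
      rw [show s - 1 - 1 = s - 2 by ring, hs] at this
      norm_num at this
      linarith
    have h3 : s ≠ 1 := by
      rintro rfl
      norm_num at h2
    rw [dslope_of_ne _ h3, slope_def_field, norm_div, div_le_iff₀ (by linarith)]
    have := norm_sub_le (P s) (P 1)
    have := hK s hs.le
    have := norm_nonneg (P 1)
    nlinarith
  have h4 := Complex.norm_iteratedDeriv_le_of_forall_mem_sphere_norm_le m
    (show (0 : ℝ) < 3 / 2 by norm_num) hd.diffContOnCl hsph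
  have h5 : ‖(b m : ℂ) - P 1‖ = ‖(m.factorial : ℂ)⁻¹ * iteratedDeriv m (dslope P 1) 2‖ := by
    rw [hb m, norm_mul, norm_pow, norm_neg, norm_one, one_pow, one_mul]
  have hf : (0 : ℝ) < m.factorial := by exact_mod_cast m.factorial_pos
  rw [h5, norm_mul, norm_inv, Complex.norm_natCast, inv_mul_le_iff₀ hf]
  exact h4.trans (le_of_eq (by ring))

open scoped ComplexOrder in
/-- Estermann's lower bound for the residue of a Dirichlet series with nonnegative coefficients
having a value of suitable sign at a real point near `1`. -/
lemma estermann {a : ℕ → ℂ} (ha : 0 ≤ a) (ha1 : a 1 = 1)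
    (hsum : ∀ s : ℂ, 1 < s.re → LSeriesSummable a s) {P : ℂ → ℂ} (hP : Differentiable ℂ P)
    (hPa : ∀ s : ℂ, 1 < s.re → P s = (s - 1) * LSeries a s) :
    (∀ β : ℝ, (P β).im = 0) ∧ ∀ K : ℝ, 1 ≤ K → (∀ s : ℂ, ‖s - 2‖ ≤ 3 / 2 → ‖P s‖ ≤ K) →
      ∀ β : ℝ, 3 / 4 ≤ β → β < 1 → 0 ≤ (P β).re →
        1 - β ≤ 6 * ((P 1).re * (48 * K) ^ (6 * (1 - β))) := by
  obtain ⟨b, hb0, hb1, hb⟩ := exists_taylor_coeff ha ha1 hsum hPa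
  refine ⟨im_apply_real_eq_zero hP hb, fun K hK1 hK β hβ hβ1 hβP ↦ ?_⟩
  have him : (P 1).im = 0 := by
    simpa using im_apply_real_eq_zero hP hb 1
  have hP1 : P 1 = ((P 1).re : ℂ) := Complex.ext (by simp) (by simpa using him)
  set L := (P 1).re with hL
  set x : ℝ := 2 - β with hx
  have hx1 : 1 < x := by linarith
  have hsumR : HasSum (fun m ↦ (b m - L) * x ^ m) (dslope P 1 β).re := by
    have h := Complex.hasSum_re (hasSum_dslope hP hb β)
    convert h using 2 with m
    rw [hP1]
    norm_cast
  have hbd : ∀ m, |(b m - L) * x ^ m| ≤ 4 * K * (5 / 6) ^ m := by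
    intro m
    have h1 := norm_taylor_coeff_le hP hb hK m
    rw [hP1, ← Complex.ofReal_sub, Complex.norm_real, Real.norm_eq_abs] at h1
    rw [abs_mul, abs_of_pos (show 0 < x ^ m by positivity)]
    calc |b m - L| * x ^ m ≤ 4 * K / (3 / 2) ^ m * (5 / 4) ^ m := by
          gcongr
          linarith
      _ = 4 * K * (5 / 6) ^ m := by
          rw [div_mul_eq_mul_div, mul_div_assoc, ← div_pow]
          norm_num
  have hG : (dslope P 1 β).re ≤ L / (x - 1) := by
    have hne : (β : ℂ) ≠ 1 := by exact_mod_cast hβ1.ne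
    rw [dslope_of_ne _ hne, slope_def_field, hP1, show (β : ℂ) - 1 = ((β - 1 : ℝ) : ℂ) by push_cast; rfl,
      Complex.div_ofReal_re, Complex.sub_re, Complex.ofReal_re, ← neg_div_neg_eq,
      show -(β - 1) = x - 1 by rw [hx]; ring]
    gcongr
    · linarith
  set M := ⌈6 * Real.log (48 * K)⌉₊ with hM
  have hlogK : 0 < Real.log (48 * K) := Real.log_pos (by linarith)
  have hM0 : 0 < M := Nat.ceil_pos.mpr (by positivity)
  have hM1 : 6 * Real.log (48 * K) ≤ M := Nat.le_ceil _
  have hM2 : (M : ℝ) ≤ 6 * Real.log (48 * K) + 1 := (Nat.ceil_lt_add_one (by positivity)).le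
  have hmain := estermann_real hb0 hb1 hx1 (show (0 : ℝ) < 5 / 6 by norm_num) (by norm_num)
    hsumR hbd hG M hM0
  have hθM : ((5 : ℝ) / 6) ^ M ≤ 1 / (48 * K) := by
    have h1 : Real.log (5 / 6) ≤ -(1 / 6) := by
      have := Real.log_le_sub_one_of_pos (show (0 : ℝ) < 5 / 6 by norm_num)
      linarith
    rw [← Real.log_le_log_iff (by positivity) (by positivity), Real.log_pow, one_div, Real.log_inv]
    nlinarith
  have h24 : 4 * K * (5 / 6) ^ M / (1 - 5 / 6) ≤ 1 / 2 := by
    have : 4 * K * (5 / 6) ^ M ≤ 4 * K * (1 / (48 * K)) := by gcongr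
    have h2 : 4 * K * (1 / (48 * K)) = 1 / 12 := by field_simp; norm_num
    rw [div_le_iff₀ (by norm_num)]
    linarith
  have hxM : x ^ M ≤ 3 * (48 * K) ^ (6 * (1 - β)) := by
    have hx2 : x ≤ Real.exp (1 - β) := by
      have := Real.add_one_le_exp (1 - β)
      linarith
    calc x ^ M ≤ Real.exp (1 - β) ^ M := by gcongr
      _ = Real.exp (M * (1 - β)) := by rw [← Real.exp_nat_mul]
      _ ≤ Real.exp (1 + Real.log (48 * K) * (6 * (1 - β))) := by
          rw [Real.exp_le_exp]
          nlinarith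
      _ = Real.exp 1 * (48 * K) ^ (6 * (1 - β)) := by
          rw [Real.exp_add, Real.rpow_def_of_pos (by linarith)]
      _ ≤ 3 * (48 * K) ^ (6 * (1 - β)) := by
          gcongr
          exact Real.exp_one_lt_three.le
  have hx1' : x - 1 = 1 - β := by rw [hx]; ring
  rw [hx1', le_div_iff₀ (by linarith)] at hmain
  have hL0 : 0 ≤ L := by
    by_contra! hneg
    have : L * x ^ M ≤ 0 := mul_nonpos_of_nonpos_of_nonneg hneg.le (by positivity)
    nlinarith
  have := mul_le_mul_of_nonneg_left hxM hL0
  nlinarith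

/-- The arithmetic function attached to a Dirichlet character. -/
noncomputable def charAF {N : ℕ} (χ : DirichletCharacter ℂ N) : ArithmeticFunction ℂ :=
  toArithmeticFunction (χ ·)

lemma charAF_apply {N : ℕ} (χ : DirichletCharacter ℂ N) {n : ℕ} (hn : n ≠ 0) :
    charAF χ n = χ n := by
  simp [charAF, toArithmeticFunction, hn]

/-- The convolution `1 * χ₁ * χ₂ * χ₁χ₂`. -/
noncomputable def biquadraticMul {N : ℕ} (χ₁ χ₂ : DirichletCharacter ℂ N) :
    ArithmeticFunction ℂ :=
  χ₁.zetaMul * (charAF χ₂ * charAF (χ₁ * χ₂))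

lemma biquadraticMul_comm {N : ℕ} (χ₁ χ₂ : DirichletCharacter ℂ N) :
    biquadraticMul χ₁ χ₂ = biquadraticMul χ₂ χ₁ := by
  have h : ∀ χ : DirichletCharacter ℂ N,
      χ.zetaMul = (ArithmeticFunction.zeta : ArithmeticFunction ℂ) * charAF χ := fun _ ↦ rfl
  rw [biquadraticMul, biquadraticMul, h, h, mul_comm χ₁ χ₂]
  ring

lemma charAF_mul_prime_pow {N : ℕ} (χ₁ χ₂ : DirichletCharacter ℂ N) {p : ℕ} (hp : p.Prime)
    (k : ℕ) : (charAF χ₂ * charAF (χ₁ * χ₂)) (p ^ k) = χ₂ p ^ k * χ₁.zetaMul (p ^ k) := by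
  have hp0 : ∀ i, p ^ i ≠ 0 := fun i ↦ pow_ne_zero i hp.ne_zero
  rw [ArithmeticFunction.mul_apply, Nat.sum_divisorsAntidiagonal
    (f := fun i j ↦ charAF χ₂ i * charAF (χ₁ * χ₂) j), Nat.sum_divisors_prime_pow hp,
    DirichletCharacter.zetaMul, ArithmeticFunction.coe_zeta_mul_apply,
    Nat.sum_divisors_prime_pow hp, ← sum_range_reflect, mul_sum]
  refine sum_congr rfl fun i hi ↦ ?_
  have hik : i ≤ k := by rw [mem_range] at hi; omega
  rw [show k + 1 - 1 - i = k - i by omega, Nat.pow_div (by omega) hp.pos,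
    show k - (k - i) = i by omega, charAF_apply _ (hp0 _), charAF_apply _ (hp0 _)]
  change _ = _ * charAF χ₁ (p ^ i)
  rw [charAF_apply _ (hp0 _)]
  simp only [MulChar.mul_apply, Nat.cast_pow, map_pow]
  nth_rewrite 2 [show k = k - i + i by omega]
  rw [pow_add]
  ring

open scoped ComplexOrder

lemma mul_prime_pow_eq_sum (f g : ArithmeticFunction ℂ) {p : ℕ} (hp : p.Prime) (k : ℕ) :
    (f * g) (p ^ k) = ∑ i ∈ range (k + 1), f (p ^ i) * g (p ^ (k - i)) := by
  rw [ArithmeticFunction.mul_apply, Nat.sum_divisorsAntidiagonal (f := fun i j ↦ f i * g j),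
    Nat.sum_divisors_prime_pow hp]
  refine sum_congr rfl fun i hi ↦ ?_
  rw [mem_range] at hi
  rw [Nat.pow_div (by omega) hp.pos]

lemma biquadraticMul_prime_pow_nonneg_of_nonneg {N : ℕ} {χ₁ χ₂ : DirichletCharacter ℂ N}
    (h₁ : χ₁ ^ 2 = 1) {p : ℕ} (hp : p.Prime) (k : ℕ) (h : 0 ≤ χ₂ p) :
    0 ≤ biquadraticMul χ₁ χ₂ (p ^ k) := by
  rw [biquadraticMul, mul_prime_pow_eq_sum _ _ hp]
  refine sum_nonneg fun i _ ↦ mul_nonneg (DirichletCharacter.zetaMul_prime_pow_nonneg h₁ hp i) ?_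
  rw [charAF_mul_prime_pow _ _ hp]
  exact mul_nonneg (pow_nonneg h _) (DirichletCharacter.zetaMul_prime_pow_nonneg h₁ hp _)

lemma biquadraticMul_prime_pow_nonneg {N : ℕ} {χ₁ χ₂ : DirichletCharacter ℂ N}
    (h₁ : χ₁ ^ 2 = 1) (h₂ : χ₂ ^ 2 = 1) {p : ℕ} (hp : p.Prime) (k : ℕ) :
    0 ≤ biquadraticMul χ₁ χ₂ (p ^ k) := by
  by_cases hχ₂ : 0 ≤ χ₂ p
  · exact biquadraticMul_prime_pow_nonneg_of_nonneg h₁ hp k hχ₂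
  by_cases hχ₁ : 0 ≤ χ₁ p
  · rw [biquadraticMul_comm]
    exact biquadraticMul_prime_pow_nonneg_of_nonneg h₂ hp k hχ₁
  have h₁' : χ₁ p = -1 := by
    rcases MulChar.isQuadratic_iff_sq_eq_one.mpr h₁ p with h | h | h
    · simp [h] at hχ₁
    · simp [h] at hχ₁
    · exact h
  have h₂' : χ₂ p = -1 := by
    rcases MulChar.isQuadratic_iff_sq_eq_one.mpr h₂ p with h | h | h
    · simp [h] at hχ₂
    · simp [h] at hχ₂
    · exact h
  have hz : ∀ i, χ₁.zetaMul (p ^ i) = if Even i then 1 else 0 := by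
    intro i
    have : χ₁.zetaMul (p ^ i) = ∑ j ∈ range (i + 1), (-1) ^ j := by
      rw [DirichletCharacter.zetaMul, ArithmeticFunction.coe_zeta_mul_apply,
        Nat.sum_divisors_prime_pow hp]
      refine sum_congr rfl fun j _ ↦ ?_
      change charAF χ₁ (p ^ j) = _
      rw [charAF_apply _ (pow_ne_zero j hp.ne_zero)]
      simp [h₁']
    rw [this, neg_one_geom_sum]
    simp only [Nat.even_add_one, ite_not]
  rw [biquadraticMul, mul_prime_pow_eq_sum _ _ hp]
  refine sum_nonneg fun i _ ↦ mul_nonneg (DirichletCharacter.zetaMul_prime_pow_nonneg h₁ hp i) ?_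
  rw [charAF_mul_prime_pow _ _ hp, hz, h₂']
  split_ifs with h
  · simp [h.neg_one_pow]
  · simp

lemma isMultiplicative_biquadraticMul {N : ℕ} (χ₁ χ₂ : DirichletCharacter ℂ N) :
    (biquadraticMul χ₁ χ₂).IsMultiplicative :=
  χ₁.isMultiplicative_zetaMul.mul ((DirichletCharacter.isMultiplicative_toArithmeticFunction χ₂).mul
    (DirichletCharacter.isMultiplicative_toArithmeticFunction (χ₁ * χ₂)))

lemma biquadraticMul_nonneg {N : ℕ} {χ₁ χ₂ : DirichletCharacter ℂ N}
    (h₁ : χ₁ ^ 2 = 1) (h₂ : χ₂ ^ 2 = 1) (n : ℕ) : 0 ≤ biquadraticMul χ₁ χ₂ n := by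
  rcases eq_or_ne n 0 with rfl | hn
  · simp
  · rw [(isMultiplicative_biquadraticMul χ₁ χ₂).multiplicative_factorization _ hn]
    exact prod_nonneg fun p hp ↦ biquadraticMul_prime_pow_nonneg h₁ h₂
      (Nat.prime_of_mem_primeFactors hp) _

lemma LSeriesSummable_charAF {N : ℕ} (χ : DirichletCharacter ℂ N) {s : ℂ} (hs : 1 < s.re) :
    LSeriesSummable (charAF χ) s :=
  (LSeriesSummable_congr _ fun h ↦ (charAF_apply χ h).symm).mp (χ.LSeriesSummable_of_one_lt_re hs)

lemma LSeries_charAF {N : ℕ} [NeZero N] (χ : DirichletCharacter ℂ N) {s : ℂ} (hs : 1 < s.re) :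
    LSeries (charAF χ) s = DirichletCharacter.LFunction χ s := by
  rw [DirichletCharacter.LFunction_eq_LSeries χ hs]
  exact LSeries_congr (fun h ↦ charAF_apply χ h) s

lemma lfunOne_modOne_eq {s : ℂ} (hs : s ≠ 1) :
    lfunOne (1 : DirichletCharacter ℂ 1) s = (s - 1) * riemannZeta s := by
  rw [lfunOne_eq_mul _ hs, DirichletCharacter.LFunction_modOne_eq]

lemma lfunOne_modOne_one : lfunOne (1 : DirichletCharacter ℂ 1) 1 = 1 := by
  rw [lfunOne, if_pos rfl, DirichletCharacter.LFunctionTrivChar₁]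
  simp

lemma LSeries_zetaMul {N : ℕ} [NeZero N] (χ : DirichletCharacter ℂ N) {s : ℂ} (hs : 1 < s.re) :
    (s - 1) * LSeries χ.zetaMul s =
      lfunOne (1 : DirichletCharacter ℂ 1) s * DirichletCharacter.LFunction χ s := by
  have hs1 : s ≠ 1 := by rintro rfl; simp at hs
  have h : χ.zetaMul = (ArithmeticFunction.zeta : ArithmeticFunction ℂ) * charAF χ := rfl
  rw [lfunOne_modOne_eq hs1, h, ArithmeticFunction.LSeries_mul' _ (LSeriesSummable_charAF χ hs),
    LSeries_charAF χ hs, mul_assoc]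
  · congr 2
    rw [← ArithmeticFunction.LSeries_zeta_eq_riemannZeta hs]
    simp [ArithmeticFunction.natCoe_apply]
  · exact ArithmeticFunction.LSeriesSummable_zeta_iff.mpr hs

lemma LSeriesSummable_biquadraticMul {N : ℕ} (χ₁ χ₂ : DirichletCharacter ℂ N) {s : ℂ}
    (hs : 1 < s.re) : LSeriesSummable (biquadraticMul χ₁ χ₂) s :=
  ArithmeticFunction.LSeriesSummable_mul (χ₁.LSeriesSummable_zetaMul hs)
    (ArithmeticFunction.LSeriesSummable_mul (LSeriesSummable_charAF χ₂ hs)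
      (LSeriesSummable_charAF (χ₁ * χ₂) hs))

lemma LSeries_biquadraticMul {N : ℕ} [NeZero N] (χ₁ χ₂ : DirichletCharacter ℂ N) {s : ℂ}
    (hs : 1 < s.re) : (s - 1) * LSeries (biquadraticMul χ₁ χ₂) s =
      lfunOne (1 : DirichletCharacter ℂ 1) s * DirichletCharacter.LFunction χ₁ s *
        (DirichletCharacter.LFunction χ₂ s * DirichletCharacter.LFunction (χ₁ * χ₂) s) := by
  rw [biquadraticMul, ArithmeticFunction.LSeries_mul' (χ₁.LSeriesSummable_zetaMul hs)
    (ArithmeticFunction.LSeriesSummable_mul (LSeriesSummable_charAF χ₂ hs)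
      (LSeriesSummable_charAF (χ₁ * χ₂) hs)), ArithmeticFunction.LSeries_mul'
    (LSeriesSummable_charAF χ₂ hs) (LSeriesSummable_charAF (χ₁ * χ₂) hs), LSeries_charAF _ hs,
    LSeries_charAF _ hs, ← mul_assoc, LSeries_zetaMul χ₁ hs]

open scoped ComplexOrder

lemma norm_im_le_of_norm_sub_two_le {s : ℂ} (hs : ‖s - 2‖ ≤ 3 / 2) :
    1 / 2 ≤ s.re ∧ s.re ≤ 4 ∧ |s.im| ≤ 3 / 2 ∧ ‖s - 1‖ ≤ 5 / 2 := by
  have h1 := (Complex.abs_re_le_norm (s - 2)).trans hs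
  have h2 := (Complex.abs_im_le_norm (s - 2)).trans hs
  simp only [Complex.sub_re, Complex.re_ofNat, Complex.sub_im, Complex.im_ofNat, sub_zero] at h1 h2
  rw [abs_le] at h1
  refine ⟨by linarith, by linarith, h2, ?_⟩
  calc ‖s - 1‖ = ‖(s - 2) + 1‖ := by ring_nf
    _ ≤ ‖s - 2‖ + ‖(1 : ℂ)‖ := norm_add_le _ _
    _ ≤ 5 / 2 := by rw [norm_one]; linarith

lemma norm_le_near_two : ∃ C : ℝ, 1 ≤ C ∧ ∀ s : ℂ, ‖s - 2‖ ≤ 3 / 2 →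
    ‖lfunOne (1 : DirichletCharacter ℂ 1) s‖ ≤ C ∧
    ∀ (q : ℕ) [NeZero q] (χ : DirichletCharacter ℂ q), χ ≠ 1 →
      ‖DirichletCharacter.LFunction χ s‖ ≤ C * q := by
  obtain ⟨C₁, hC₁, h₁⟩ := norm_lfunOne_le (δ := 1 / 2) (by norm_num) le_rfl
  obtain ⟨C₂, hC₂, h₂⟩ := norm_LFunction_le (δ := 1 / 2) (by norm_num) le_rfl
  refine ⟨14 * C₁ + 4 * C₂ + 1, by linarith, fun s hs ↦ ?_⟩
  obtain ⟨ha, hb, hc, hd⟩ := norm_im_le_of_norm_sub_two_le hs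
  constructor
  · refine (h₁ 1 1 s (by linarith) hb).trans ?_
    have hz : cond 1 s.im ^ (2 * (1 / 2) : ℝ) ≤ 7 / 2 := by
      norm_num [cond]; linarith
    have hn := norm_charMean_le (1 : DirichletCharacter ℂ 1)
    calc _ ≤ C₁ * (7 / 2) * (5 / 2 + 1) := by gcongr
      _ ≤ _ := by linarith
  · intro q _ χ hχ
    refine (h₂ q χ s (Or.inl hχ) (by linarith) hb).trans ?_
    have hz : cond q s.im ^ (2 * (1 / 2) : ℝ) ≤ q * 4 := by
      norm_num [cond]; gcongr; linarith
    rw [charMean_of_ne_one hχ, norm_zero, zero_div, add_zero, mul_one]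
    calc _ ≤ C₂ * (q * 4) := by gcongr
      _ = (4 * C₂) * q := by ring
      _ ≤ _ := by gcongr; linarith

lemma one_sub_le_quadratic {C : ℝ} (hC1 : 1 ≤ C) (hC : ∀ s : ℂ, ‖s - 2‖ ≤ 3 / 2 →
    ‖lfunOne (1 : DirichletCharacter ℂ 1) s‖ ≤ C ∧
    ∀ (q : ℕ) [NeZero q] (χ : DirichletCharacter ℂ q), χ ≠ 1 →
      ‖DirichletCharacter.LFunction χ s‖ ≤ C * q)
    {q : ℕ} [NeZero q] {χ : DirichletCharacter ℂ q} (hχ : χ ≠ 1) (hχ2 : χ ^ 2 = 1)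
    {β : ℝ} (hβ : 3 / 4 ≤ β) (hβ1 : β < 1)
    (hZ : ∀ x : ℝ, β ≤ x → x < 1 → lfunOne (1 : DirichletCharacter ℂ 1) x ≠ 0)
    (hL : (∀ x : ℝ, β < x → x < 1 → DirichletCharacter.LFunction χ x ≠ 0) ∨
      DirichletCharacter.LFunction χ β = 0) :
    1 - β ≤ 6 * (‖DirichletCharacter.LFunction χ 1‖ * (48 * (C * (C * q))) ^ (6 * (1 - β))) := by
  have hq : (1 : ℝ) ≤ q := by exact_mod_cast NeZero.one_le
  set P : ℂ → ℂ := fun s ↦ lfunOne (1 : DirichletCharacter ℂ 1) s *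
    DirichletCharacter.LFunction χ s with hPdef
  have hPd : Differentiable ℂ P :=
    (differentiable_lfunOne _).mul (DirichletCharacter.differentiable_LFunction hχ)
  have ha : (0 : ℕ → ℂ) ≤ χ.zetaMul := fun n ↦ DirichletCharacter.zetaMul_nonneg hχ2 n
  have ha1 : χ.zetaMul 1 = 1 := χ.isMultiplicative_zetaMul.1
  have hs : ∀ s : ℂ, 1 < s.re → LSeriesSummable χ.zetaMul s :=
    fun s hs ↦ χ.LSeriesSummable_zetaMul hs
  have hPa : ∀ s : ℂ, 1 < s.re → P s = (s - 1) * LSeries χ.zetaMul s :=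
    fun s hs ↦ (LSeries_zetaMul χ hs).symm
  obtain ⟨him, hest⟩ := estermann ha ha1 hs hPd hPa
  have hP2 : 0 < (P 2).re := by
    have h := LSeries.positive ha (by rw [ha1]; exact zero_lt_one) (x := 2)
      ((LSeries.abscissaOfAbsConv_le_of_forall_lt_LSeriesSummable (x := (3 / 2 : ℝ))
        fun y hy ↦ hs _ (by simp; linarith)).trans_lt (by
          rw [EReal.coe_lt_coe_iff]; norm_num))
    have h2 := hPa 2 (by norm_num)
    rw [h2]
    rw [show ((2 : ℂ) - 1) = 1 by norm_num, one_mul]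
    simpa using (Complex.pos_iff.mp h).1
  have hPβ : 0 ≤ (P β).re := by
    rcases hL with hL | hL
    swap
    · simp [hPdef, hL]
    by_contra! hneg
    have hcont : ContinuousOn (fun x : ℝ ↦ (P x).re) (Set.Icc β 2) :=
      (Complex.continuous_re.comp (hPd.continuous.comp Complex.continuous_ofReal)).continuousOn
    obtain ⟨x, hx, hx0⟩ := intermediate_value_Icc (by linarith) hcont
      (show (0 : ℝ) ∈ _ from ⟨hneg.le, by simpa using hP2.le⟩)
    have hPx : P x = 0 := Complex.ext hx0 (him x)
    rcases mul_eq_zero.mp hPx with h0 | h0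
    · rcases lt_or_ge x 1 with h | h
      · exact hZ x hx.1 h h0
      · rcases eq_or_lt_of_le h with rfl | h'
        · rw [Complex.ofReal_one, lfunOne_modOne_one] at h0
          exact one_ne_zero h0
        · have hx1 : (x : ℂ) ≠ 1 := by exact_mod_cast h'.ne'
          rw [lfunOne_modOne_eq hx1] at h0
          exact mul_ne_zero (sub_ne_zero.mpr hx1)
            (riemannZeta_ne_zero_of_one_le_re (by simpa using h)) h0
    · rcases lt_or_ge x 1 with h | h
      · refine hL x (lt_of_le_of_ne hx.1 ?_) h h0
        rintro rfl
        simp [hPdef, h0] at hneg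
      · exact DirichletCharacter.LFunction_ne_zero_of_one_le_re χ (Or.inl hχ) (by simpa using h) h0
  have hCq : 1 ≤ C * (C * q) := one_le_mul_of_one_le_of_one_le hC1
    (one_le_mul_of_one_le_of_one_le hC1 hq)
  refine (hest (C * (C * q)) hCq (fun s hs ↦ ?_) β hβ hβ1 hPβ).trans ?_
  · rw [hPdef]
    simp only [norm_mul]
    gcongr
    · exact (hC s hs).1
    · exact (hC s hs).2 q χ hχ
  · gcongr
    refine (Complex.re_le_norm _).trans (le_of_eq ?_)
    simp [hPdef, lfunOne_modOne_one]

lemma one_sub_le_biquadratic {C : ℝ} (hC1 : 1 ≤ C) (hC : ∀ s : ℂ, ‖s - 2‖ ≤ 3 / 2 →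
    ‖lfunOne (1 : DirichletCharacter ℂ 1) s‖ ≤ C ∧
    ∀ (q : ℕ) [NeZero q] (χ : DirichletCharacter ℂ q), χ ≠ 1 →
      ‖DirichletCharacter.LFunction χ s‖ ≤ C * q)
    {q : ℕ} [NeZero q] {χ₁ χ₂ : DirichletCharacter ℂ q} (h₁ : χ₁ ≠ 1) (h₂ : χ₂ ≠ 1)
    (h₁₂ : χ₁ * χ₂ ≠ 1) (hχ₁ : χ₁ ^ 2 = 1) (hχ₂ : χ₂ ^ 2 = 1)
    {β : ℝ} (hβ : 3 / 4 ≤ β) (hβ1 : β < 1) (hL : DirichletCharacter.LFunction χ₁ β = 0) :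
    1 - β ≤ 6 * (‖DirichletCharacter.LFunction χ₁ 1‖ * (‖DirichletCharacter.LFunction χ₂ 1‖ *
      ‖DirichletCharacter.LFunction (χ₁ * χ₂) 1‖) *
        (48 * (C * (C * q) * ((C * q) * (C * q)))) ^ (6 * (1 - β))) := by
  have hq : (1 : ℝ) ≤ q := by exact_mod_cast NeZero.one_le
  set P : ℂ → ℂ := fun s ↦ lfunOne (1 : DirichletCharacter ℂ 1) s *
    DirichletCharacter.LFunction χ₁ s * (DirichletCharacter.LFunction χ₂ s *
      DirichletCharacter.LFunction (χ₁ * χ₂) s) with hPdef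
  have hPd : Differentiable ℂ P :=
    ((differentiable_lfunOne _).mul (DirichletCharacter.differentiable_LFunction h₁)).mul
      ((DirichletCharacter.differentiable_LFunction h₂).mul
        (DirichletCharacter.differentiable_LFunction h₁₂))
  have ha : (0 : ℕ → ℂ) ≤ biquadraticMul χ₁ χ₂ := fun n ↦ biquadraticMul_nonneg hχ₁ hχ₂ n
  obtain ⟨him, hest⟩ := estermann ha (isMultiplicative_biquadraticMul χ₁ χ₂).1
    (fun s hs ↦ LSeriesSummable_biquadraticMul χ₁ χ₂ hs) hPd
    (fun s hs ↦ (LSeries_biquadraticMul χ₁ χ₂ hs).symm)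
  have hCq : 1 ≤ C * q := one_le_mul_of_one_le_of_one_le hC1 hq
  refine (hest (C * (C * q) * ((C * q) * (C * q))) ?_ (fun s hs ↦ ?_) β hβ hβ1 ?_).trans ?_
  · exact one_le_mul_of_one_le_of_one_le (one_le_mul_of_one_le_of_one_le hC1 hCq)
      (one_le_mul_of_one_le_of_one_le hCq hCq)
  · rw [hPdef]
    simp only [norm_mul]
    gcongr
    · exact (hC s hs).1
    · exact (hC s hs).2 q _ h₁
    · exact (hC s hs).2 q _ h₂
    · exact (hC s hs).2 q _ h₁₂
  · simp [hPdef, hL]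
  · gcongr
    refine (Complex.re_le_norm _).trans (le_of_eq ?_)
    simp [hPdef, lfunOne_modOne_one]

lemma norm_LFunction_changeLevel_le {q m : ℕ} [NeZero q] [NeZero m] {χ : DirichletCharacter ℂ q}
    (hχ : χ ≠ 1) (h : q ∣ m * q) :
    ‖DirichletCharacter.LFunction (DirichletCharacter.changeLevel h χ) 1‖ ≤
      ‖DirichletCharacter.LFunction χ 1‖ * 2 ^ m := by
  rw [DirichletCharacter.LFunction_changeLevel h χ (Or.inl hχ), norm_mul, norm_prod]
  gcongr
  calc _ ≤ ∏ p ∈ (m * q).primeFactors, if p ∈ m.primeFactors then (2 : ℝ) else 1 := by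
        refine prod_le_prod (fun _ _ ↦ norm_nonneg _) fun p hp ↦ ?_
        have hpp := Nat.prime_of_mem_primeFactors hp
        split_ifs with hpm
        · calc _ ≤ ‖(1 : ℂ)‖ + ‖χ p * (p : ℂ) ^ (-1 : ℂ)‖ := norm_sub_le _ _
            _ ≤ 1 + 1 * 1 := by
              rw [norm_one, norm_mul]
              gcongr
              · exact χ.norm_le_one _
              · rw [Complex.cpow_neg_one, norm_inv, Complex.norm_natCast]
                exact inv_le_one_of_one_le₀ (by exact_mod_cast hpp.one_le)
            _ = 2 := by norm_num
        · have hpq : p ∣ q := by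
            have := Nat.dvd_of_mem_primeFactors hp
            rcases hpp.dvd_mul.mp this with h | h
            · exact absurd (Nat.mem_primeFactors.mpr ⟨hpp, h, NeZero.ne m⟩) hpm
            · exact h
          have : χ (p : ZMod q) = 0 := by
            apply χ.map_nonunit
            rw [ZMod.isUnit_iff_coprime]
            exact fun hc ↦ hpp.one_lt.ne' (Nat.eq_one_of_dvd_coprimes hc dvd_rfl hpq)
          simp [this]
    _ = 2 ^ ((m * q).primeFactors ∩ m.primeFactors).card := by
        rw [prod_ite_mem, prod_const]
    _ ≤ 2 ^ m := by
        apply pow_le_pow_right₀ (by norm_num)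
        refine (card_le_card inter_subset_right).trans ?_
        refine (card_le_card (t := Icc 1 m) fun p hp ↦ ?_).trans (by simp)
        rw [mem_Icc]
        exact ⟨(Nat.prime_of_mem_primeFactors hp).one_le, Nat.le_of_mem_primeFactors hp⟩

lemma exists_lfunOne_ne_zero : ∃ η : ℝ, 0 < η ∧ ∀ x : ℝ, 1 - η ≤ x → x ≤ 1 →
    lfunOne (1 : DirichletCharacter ℂ 1) x ≠ 0 := by
  have hc : Continuous fun x : ℝ ↦ lfunOne (1 : DirichletCharacter ℂ 1) x :=
    (differentiable_lfunOne _).continuous.comp Complex.continuous_ofReal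
  have h : ∀ᶠ x : ℝ in nhds (1 : ℝ), lfunOne (1 : DirichletCharacter ℂ 1) x ≠ 0 := by
    apply hc.continuousAt.eventually_ne
    rw [Complex.ofReal_one, lfunOne_modOne_one]
    exact one_ne_zero
  obtain ⟨η, hη, h⟩ := Metric.eventually_nhds_iff.mp h
  refine ⟨η / 2, by positivity, fun x hx hx1 ↦ h ?_⟩
  rw [Real.dist_eq, abs_lt]
  constructor <;> linarith

/-- **Siegel's theorem**. -/
theorem siegel {ε : ℝ} (hε : 0 < ε) : ∃ c : ℝ, 0 < c ∧
    ∀ (q : ℕ) [NeZero q] (χ : DirichletCharacter ℂ q), χ ≠ 1 → χ ^ 2 = 1 →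
      c * (q : ℝ) ^ (-ε) ≤ ‖DirichletCharacter.LFunction χ 1‖ := by
  obtain ⟨η₀, hη₀, hZ₀⟩ := exists_lfunOne_ne_zero
  obtain ⟨C, hC1, hC⟩ := norm_le_near_two
  set η := min η₀ (min (1 / 4) (ε / 36)) with hη
  have hη0 : 0 < η := by positivity
  have hη4 : η ≤ 1 / 4 := (min_le_right _ _).trans (min_le_left _ _)
  have hηε : η ≤ ε / 36 := (min_le_right _ _).trans (min_le_right _ _)
  have hZ : ∀ x : ℝ, 1 - η ≤ x → x < 1 → lfunOne (1 : DirichletCharacter ℂ 1) x ≠ 0 :=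
    fun x hx hx1 ↦ hZ₀ x (by linarith [min_le_left η₀ (min (1 / 4) (ε / 36))]) hx1.le
  have hC0 : 0 < C := by linarith
  by_cases hex : ∃ (q : ℕ) (_ : NeZero q) (χ : DirichletCharacter ℂ q) (β : ℝ),
      χ ≠ 1 ∧ χ ^ 2 = 1 ∧ 1 - η ≤ β ∧ β < 1 ∧ DirichletCharacter.LFunction χ β = 0
  swap
  · refine ⟨η / (6 * (48 * (C * C)) ^ (6 * η)), by positivity, fun q _ χ hχ hχ2 ↦ ?_⟩
    have hq : (1 : ℝ) ≤ q := by exact_mod_cast NeZero.one_le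
    have h := one_sub_le_quadratic hC1 hC hχ hχ2 (β := 1 - η) (by linarith) (by linarith) hZ
      (Or.inl fun x hx hx1 h0 ↦ hex ⟨q, inferInstance, χ, x, hχ, hχ2, hx.le, hx1, h0⟩)
    rw [sub_sub_cancel, show 48 * (C * (C * (q : ℝ))) = 48 * (C * C) * q by ring,
      Real.mul_rpow (by positivity) (by positivity)] at h
    have hqε : (q : ℝ) ^ (6 * η) ≤ (q : ℝ) ^ ε :=
      Real.rpow_le_rpow_of_exponent_le hq (by linarith)
    rw [Real.rpow_neg (by positivity), ← div_eq_mul_inv, div_le_iff₀ (by positivity),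
      div_le_iff₀ (by positivity)]
    calc η ≤ _ := h
      _ ≤ 6 * (‖DirichletCharacter.LFunction χ 1‖ *
          ((48 * (C * C)) ^ (6 * η) * (q : ℝ) ^ ε)) := by gcongr
      _ = _ := by ring
  obtain ⟨q₁, _, χ₁, β, hχ₁, hχ₁2, hβη, hβ1, hβ0⟩ := hex
  obtain ⟨D, hD, hDle⟩ := norm_LFunction_le (δ := min (1 / 2) (ε / 8)) (by positivity)
    (min_le_left _ _)
  set δ := min (1 / 2) (ε / 8) with hδ
  have hδ0 : 0 < δ := by positivity
  have hδε : δ ≤ ε / 8 := min_le_right _ _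
  have hDle' : ∀ (q : ℕ) [NeZero q] (χ : DirichletCharacter ℂ q), χ ≠ 1 →
      ‖DirichletCharacter.LFunction χ 1‖ ≤ D * (2 * q) ^ (2 * δ) := by
    intro q _ χ hχ
    refine (hDle q χ 1 (Or.inl hχ) (by simp [hδ0.le]) (by simp)).trans (le_of_eq ?_)
    simp [charMean_of_ne_one hχ, cond, mul_comm]
  have hq₁ : (1 : ℝ) ≤ q₁ := by exact_mod_cast NeZero.one_le
  set T : ℝ := (1 + D * (2 * q₁) ^ (2 * δ)) ^ 2 * (2 ^ q₁ * (48 * (C ^ 4 * q₁ ^ 3)) ^ (6 * η))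
    with hT
  have hT0 : 0 < T := by positivity
  refine ⟨(1 - β) / (6 * T), by have : 0 < 1 - β := by linarith
                                positivity, fun q _ χ hχ hχ2 ↦ ?_⟩
  have hq : (1 : ℝ) ≤ q := by exact_mod_cast NeZero.one_le
  have hN : NeZero (q₁ * q) := ⟨mul_ne_zero (NeZero.ne _) (NeZero.ne _)⟩
  have hd : q ∣ q₁ * q := dvd_mul_left q q₁
  have hd₁ : q₁ ∣ q₁ * q := dvd_mul_right q₁ q
  set ψ := DirichletCharacter.changeLevel hd χ with hψ
  set ψ₁ := DirichletCharacter.changeLevel hd₁ χ₁ with hψ₁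
  have hψn : ψ ≠ 1 := by rwa [hψ, Ne, DirichletCharacter.changeLevel_eq_one_iff]
  have hψ₁n : ψ₁ ≠ 1 := by rwa [hψ₁, Ne, DirichletCharacter.changeLevel_eq_one_iff]
  have hψ2 : ψ ^ 2 = 1 := by rw [hψ, ← map_pow, hχ2, map_one]
  have hψ₁2 : ψ₁ ^ 2 = 1 := by rw [hψ₁, ← map_pow, hχ₁2, map_one]
  have hzero : DirichletCharacter.LFunction ψ₁ β = 0 := by
    rw [hψ₁, DirichletCharacter.LFunction_changeLevel hd₁ χ₁ (Or.inl hχ₁), hβ0, zero_mul]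
  have hLψ : ‖DirichletCharacter.LFunction ψ 1‖ ≤
      ‖DirichletCharacter.LFunction χ 1‖ * 2 ^ q₁ := norm_LFunction_changeLevel_le hχ hd
  have hqN : ((q₁ * q : ℕ) : ℝ) = q₁ * q := by push_cast; ring
  have hqN1 : (1 : ℝ) ≤ q₁ * q := one_le_mul_of_one_le_of_one_le hq₁ hq
  set E : ℝ := (1 + D * (2 * q₁) ^ (2 * δ)) * (q : ℝ) ^ (2 * δ) with hE
  have hq2 : 1 ≤ (q : ℝ) ^ (2 * δ) := Real.one_le_rpow hq (by positivity)
  have hE0 : 0 ≤ D * (2 * (q₁ : ℝ)) ^ (2 * δ) := by positivity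
  have hE1 : 1 ≤ E := one_le_mul_of_one_le_of_one_le (by linarith) hq2
  have hup : ∀ χ' : DirichletCharacter ℂ (q₁ * q), χ' ≠ 1 →
      ‖DirichletCharacter.LFunction χ' 1‖ ≤ E := by
    intro χ' h
    refine (hDle' _ χ' h).trans ?_
    rw [hqN, ← mul_assoc, Real.mul_rpow (by positivity) (by positivity), ← mul_assoc, hE]
    gcongr
    linarith
  have hpow : ∀ K : ℝ, 0 ≤ K → K ≤ C ^ 4 * (q₁ * q) ^ 3 → 1 ≤ 48 * K →
      (48 * K) ^ (6 * (1 - β)) ≤ (48 * (C ^ 4 * q₁ ^ 3)) ^ (6 * η) * (q : ℝ) ^ (18 * η) := by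
    intro K hK hK' hK1
    calc (48 * K) ^ (6 * (1 - β)) ≤ (48 * K) ^ (6 * η) :=
          Real.rpow_le_rpow_of_exponent_le hK1 (by linarith)
      _ ≤ (48 * (C ^ 4 * q₁ ^ 3) * (q : ℝ) ^ 3) ^ (6 * η) := by
          apply Real.rpow_le_rpow (by positivity) _ (by positivity)
          calc _ ≤ _ := mul_le_mul_of_nonneg_left hK' (by norm_num)
            _ = _ := by ring
      _ = _ := by
          rw [Real.mul_rpow (by positivity) (by positivity), ← Real.rpow_natCast (q : ℝ) 3,
            ← Real.rpow_mul (by positivity)]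
          congr 2
          push_cast; ring
  have key : 1 - β ≤ 6 * (‖DirichletCharacter.LFunction χ 1‖ * 2 ^ q₁ * E ^ 2 *
      ((48 * (C ^ 4 * q₁ ^ 3)) ^ (6 * η) * (q : ℝ) ^ (18 * η))) := by
    by_cases heq : ψ₁ * ψ = 1
    · have hψψ : ψ₁ = ψ := by
        have : ψ₁ * ψ * ψ = ψ := by rw [heq, one_mul]
        rwa [mul_assoc, ← sq, hψ2, mul_one] at this
      rw [hψψ] at hzero
      refine (one_sub_le_quadratic hC1 hC hψn hψ2 (β := β) (by linarith) hβ1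
        (fun x hx ↦ hZ x (by linarith)) (Or.inr hzero)).trans ?_
      gcongr
      · calc _ ≤ _ := hLψ
          _ = ‖DirichletCharacter.LFunction χ 1‖ * 2 ^ q₁ * 1 := by ring
          _ ≤ _ := by gcongr; exact one_le_pow₀ hE1
      · rw [hqN]
        refine hpow _ (by positivity) ?_ ?_
        · have h2 : (q₁ * q : ℝ) ≤ (q₁ * q) ^ 3 := le_self_pow₀ hqN1 (by norm_num)
          have h3 : C * C ≤ C ^ 4 := by
            rw [← sq]; exact pow_le_pow_right₀ hC1 (by norm_num)
          calc C * (C * (q₁ * q)) = C * C * (q₁ * q) := by ring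
            _ ≤ _ := by gcongr
        · exact one_le_mul_of_one_le_of_one_le (by norm_num) (one_le_mul_of_one_le_of_one_le hC1
            (one_le_mul_of_one_le_of_one_le hC1 hqN1))
    · refine (one_sub_le_biquadratic hC1 hC hψ₁n hψn heq hψ₁2 hψ2 (β := β) (by linarith) hβ1
        hzero).trans ?_
      have h1 := hup ψ₁ hψ₁n
      have h2 := hup (ψ₁ * ψ) heq
      have hCqN : 1 ≤ C * (q₁ * q) := one_le_mul_of_one_le_of_one_le hC1 hqN1
      refine mul_le_mul_of_nonneg_left (mul_le_mul ?_ ?_ (by positivity) (by positivity))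
        (by norm_num)
      · calc _ ≤ E * (‖DirichletCharacter.LFunction χ 1‖ * 2 ^ q₁ * E) :=
              mul_le_mul h1 (mul_le_mul hLψ h2 (norm_nonneg _) (by positivity)) (by positivity)
                (by positivity)
          _ = _ := by ring
      · rw [hqN]
        refine hpow _ (by positivity) ?_ ?_
        · exact le_of_eq (by ring)
        · exact one_le_mul_of_one_le_of_one_le (by norm_num) (one_le_mul_of_one_le_of_one_le
            (one_le_mul_of_one_le_of_one_le hC1 hCqN) (one_le_mul_of_one_le_of_one_le hCqN hCqN))
  have hqε : ((q : ℝ) ^ (2 * δ)) ^ 2 * (q : ℝ) ^ (18 * η) ≤ (q : ℝ) ^ ε := by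
    rw [← Real.rpow_natCast, ← Real.rpow_mul (by positivity), ← Real.rpow_add (by positivity)]
    apply Real.rpow_le_rpow_of_exponent_le hq
    push_cast
    linarith
  rw [Real.rpow_neg (by positivity), ← div_eq_mul_inv, div_le_iff₀ (by positivity),
    div_le_iff₀ (by positivity)]
  calc 1 - β ≤ _ := key
    _ = ‖DirichletCharacter.LFunction χ 1‖ * (((q : ℝ) ^ (2 * δ)) ^ 2 * (q : ℝ) ^ (18 * η)) *
        (6 * T) := by rw [hE, hT]; ring
    _ ≤ ‖DirichletCharacter.LFunction χ 1‖ * (q : ℝ) ^ ε * (6 * T) := by gcongr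

lemma cond_mono {q : ℕ} {t t' : ℝ} (h : |t'| ≤ |t|) : cond q t' ≤ cond q t := by
  unfold cond; gcongr

/-- The classical `3-4-1` lower bound, in terms of a bound `m` for the polar part of `L(s, χ²)`. -/
lemma norm_LFunction_ge_of_sq {δ : ℝ} (hδ : 0 < δ) (hδ' : δ ≤ 1 / 2) : ∃ D : ℝ, 1 ≤ D ∧
    ∀ (q : ℕ) [NeZero q] (χ : DirichletCharacter ℂ q) (y t m : ℝ), 0 < y → y ≤ 1 → 0 ≤ m →
      (χ ≠ 1 ∨ 1 ≤ |t|) →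
      (∀ x : ℝ, y ≤ x → ‖charMean (χ ^ 2)‖ / ‖(x + 2 * Complex.I * t : ℂ)‖ ≤ m) →
      1 / (16 * (D * cond q t ^ (2 * δ) * (1 + m)) ^ 7) ≤
        ‖DirichletCharacter.LFunction χ (1 + y + Complex.I * t)‖ := by
  obtain ⟨C₁, hC₁, h₁⟩ := norm_lfunOne_le hδ hδ'
  obtain ⟨C₂, hC₂, h₂⟩ := norm_LFunction_deriv_le hδ hδ'
  obtain ⟨C₃, hC₃, h₃⟩ := norm_LFunction_le hδ hδ'
  refine ⟨2 * C₁ + C₂ + 2 * C₃ + 1, by linarith, fun q _ χ y t m hy hy1 hm hχ hmx ↦ ?_⟩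
  have hz2 : 2 ≤ cond q t := two_le_cond q t
  have hz1 : 1 ≤ cond q t ^ (2 * δ) := Real.one_le_rpow (by linarith) (by positivity)
  have hB : ∀ K : ℝ, 0 ≤ K → K ≤ 2 * C₁ + C₂ + 2 * C₃ + 1 → K * cond q t ^ (2 * δ) ≤
      (2 * C₁ + C₂ + 2 * C₃ + 1) * cond q t ^ (2 * δ) * (1 + m) := fun K hK hK' ↦
    calc K * cond q t ^ (2 * δ) = K * cond q t ^ (2 * δ) * 1 := (mul_one _).symm
      _ ≤ _ := by gcongr; linarith
  refine norm_ge_of_product_ge_one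
    (f := fun x ↦ DirichletCharacter.LFunctionTrivChar q (1 + x))
    (g := fun x ↦ DirichletCharacter.LFunction χ (1 + x + Complex.I * t))
    (h := fun x ↦ DirichletCharacter.LFunction (χ ^ 2) (1 + x + 2 * Complex.I * t))
    ?_ hy hy1 (fun x hx hx1 ↦ ?_) (fun x hx hx1 ↦ ?_) (fun x hx hx1 ↦ ?_) (fun x hx hx1 ↦ ?_)
  · refine le_trans ?_ (hB 1 zero_le_one (by linarith))
    rwa [one_mul]
  · have := DirichletCharacter.norm_LFunction_product_ge_one χ (x := x) (by linarith) t
    simpa [norm_mul, norm_pow] using this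
  · have hx0 : 0 < x := by linarith
    have hne : (1 + x : ℂ) ≠ 1 := by simpa using hx0.ne'
    have h := h₁ q 1 (1 + x) (by simp; linarith) (by simp; linarith)
    rw [lfunOne_eq_mul _ hne, norm_mul] at h
    simp only [add_sub_cancel_left, Complex.norm_real, Real.norm_eq_abs, abs_of_pos hx0,
      Complex.add_im, Complex.one_im, Complex.ofReal_im, add_zero] at h
    refine h.trans (le_trans ?_ (hB (2 * C₁) (by positivity) (by linarith)))
    have hc : cond q 0 ≤ cond q t := cond_mono (by simp)
    have hc0 : 0 ≤ cond q 0 := by linarith [two_le_cond q 0]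
    calc _ ≤ C₁ * cond q t ^ (2 * δ) * (1 + 1) := by
          gcongr
          exact norm_charMean_le _
      _ = _ := by ring
  · have hne : (1 + x + 2 * Complex.I * t : ℂ) ≠ 1 := by
      intro h
      have := congrArg Complex.re h
      simp at this
      linarith
    have h := h₃ q (χ ^ 2) (1 + x + 2 * Complex.I * t) (Or.inr hne) (by simp; linarith)
      (by simp; linarith)
    rw [show (1 + x + 2 * Complex.I * t - 1 : ℂ) = x + 2 * Complex.I * t by ring] at h
    have him : (1 + x + 2 * Complex.I * t : ℂ).im = 2 * t := by simp
    rw [him] at h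
    have hc : cond q (2 * t) ^ (2 * δ) ≤ 2 * cond q t ^ (2 * δ) :=
      cond_rpow_le (by rw [abs_mul, abs_two]; linarith) (by positivity) (by linarith)
    refine h.trans ?_
    calc _ ≤ C₃ * (2 * cond q t ^ (2 * δ)) * (1 + m) := by
          gcongr
          exact hmx x hx
      _ = 2 * C₃ * cond q t ^ (2 * δ) * (1 + m) := by ring
      _ ≤ _ := by gcongr; linarith
  · refine le_trans ?_ (mul_le_mul_of_nonneg_right (hB C₂ hC₂.le (by linarith)) (by linarith))
    have hseg : ∀ s ∈ segment ℝ (1 + y + Complex.I * t : ℂ) (1 + x + Complex.I * t),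
        s.im = t ∧ y + 1 ≤ s.re ∧ s.re ≤ 2 := by
      rintro s ⟨a, b, ha, hb, hab, rfl⟩
      have hb' : b = 1 - a := by linarith
      subst hb'
      refine ⟨?_, ?_, ?_⟩
      · simp; ring
      · simp; nlinarith
      · simp; nlinarith
    have := Convex.norm_image_sub_le_of_norm_deriv_le
      (f := DirichletCharacter.LFunction χ) (C := C₂ * cond q t ^ (2 * δ))
      (fun s hs ↦ ?_) (fun s hs ↦ ?_) (convex_segment _ _)
      (left_mem_segment ℝ _ _) (right_mem_segment ℝ (1 + y + Complex.I * t : ℂ) (1 + x + Complex.I * t))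
    · refine this.trans (le_of_eq ?_)
      congr 1
      rw [show (1 + x + Complex.I * t - (1 + y + Complex.I * t) : ℂ) = ((x - y : ℝ) : ℂ) by
        push_cast; ring, Complex.norm_real, Real.norm_eq_abs, abs_of_nonneg (by linarith)]
    · obtain ⟨him, hre, hre2⟩ := hseg s hs
      refine DirichletCharacter.differentiableAt_LFunction χ s (Or.inl ?_)
      rintro rfl
      simp at hre
      linarith
    · obtain ⟨him, hre, hre2⟩ := hseg s hs
      rw [← him]
      refine (h₂ q χ s ?_ (by linarith) hre2).2
      refine hχ.imp_right fun h ↦ ?_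
      have := Complex.abs_im_le_norm (s - 1)
      simp only [Complex.sub_im, Complex.one_im, sub_zero, him] at this
      linarith

lemma norm_LFunction_ge {ε : ℝ} (hε : 0 < ε) : ∃ c : ℝ, 0 < c ∧
    ∀ (q : ℕ) [NeZero q] (χ : DirichletCharacter ℂ q) (y t : ℝ), 0 < y → y ≤ 1 →
      (χ ≠ 1 ∨ 1 ≤ |t|) → c * cond q t ^ (-ε) ≤
        ‖DirichletCharacter.LFunction χ (1 + y + Complex.I * t)‖ := by
  set δ := min (1 / 2) (ε / 35) with hδ
  have hδ0 : 0 < δ := by positivity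
  have hδ2 : δ ≤ 1 / 2 := min_le_left _ _
  have hδε : δ ≤ ε / 35 := min_le_right _ _
  obtain ⟨D, hD1, hD⟩ := norm_LFunction_ge_of_sq hδ0 hδ2
  obtain ⟨C, hC, hCd⟩ := norm_LFunction_deriv_le hδ0 hδ2
  obtain ⟨c₀, hc₀, hsieg⟩ := siegel hδ0
  set c₁ := min 1 (c₀ / (8 * C)) with hc₁
  have hc₁0 : 0 < c₁ := by positivity
  have hc₁1 : c₁ ≤ 1 := min_le_left _ _
  have hc₁C : 8 * C * c₁ ≤ c₀ := by
    rw [← le_div_iff₀' (by positivity)]; exact min_le_right _ _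
  refine ⟨min (1 / (16 * (2 * D / c₁) ^ 7)) (c₀ / 2), by positivity,
    fun q _ χ y t hy hy1 hχ ↦ ?_⟩
  set z := cond q t with hz
  have hz2 : 2 ≤ z := two_le_cond q t
  have hz0 : 0 < z := by linarith
  set η := c₁ * z ^ (-(3 * δ)) with hη
  have hη0 : 0 < η := by positivity
  have hη1 : η ≤ 1 := mul_le_one₀ hc₁1 (by positivity)
    (Real.rpow_le_one_of_one_le_of_nonpos (by linarith) (by linarith))
  by_cases hcase : χ ^ 2 = 1 ∧ χ ≠ 1 ∧ y < η ∧ |t| < η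
  · obtain ⟨hχ2, hχ1, hyη, htη⟩ := hcase
    have h1 := hsieg q χ hχ1 hχ2
    have hqz : (q : ℝ) ≤ z := by
      rw [hz, cond]; nlinarith [abs_nonneg t, show (0 : ℝ) ≤ q from q.cast_nonneg]
    have hq0 : (0 : ℝ) < q := by exact_mod_cast NeZero.pos q
    have h2 : c₀ * z ^ (-δ) ≤ ‖DirichletCharacter.LFunction χ 1‖ := by
      refine le_trans ?_ h1
      gcongr 1
      exact Real.rpow_le_rpow_of_nonpos hq0 hqz (by linarith)
    have hseg : ∀ s ∈ segment ℝ (1 : ℂ) (1 + y + Complex.I * t),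
        |s.im| ≤ |t| ∧ 1 ≤ s.re ∧ s.re ≤ 2 := by
      rintro s ⟨a, b, ha, hb, hab, rfl⟩
      have hb' : a = 1 - b := by linarith
      subst hb'
      refine ⟨?_, ?_, ?_⟩
      · simp [abs_mul, abs_of_nonneg hb]
        exact mul_le_of_le_one_left (abs_nonneg _) (by linarith)
      · simp; nlinarith
      · simp; nlinarith
    have h3 := Convex.norm_image_sub_le_of_norm_deriv_le
      (f := DirichletCharacter.LFunction χ) (C := C * z ^ (2 * δ))
      (fun s hs ↦ DirichletCharacter.differentiable_LFunction hχ1 s) (fun s hs ↦ ?_)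
      (convex_segment _ _)
      (left_mem_segment ℝ _ _) (right_mem_segment ℝ (1 : ℂ) (1 + y + Complex.I * t))
    swap
    · obtain ⟨him, hre, hre2⟩ := hseg s hs
      refine (hCd q χ s (Or.inl hχ1) hre hre2).2.trans ?_
      have := two_le_cond q s.im
      gcongr
      exact cond_mono him
    have h4 : ‖(1 + y + Complex.I * t - 1 : ℂ)‖ ≤ 2 * η := by
      calc _ = ‖(y + Complex.I * t : ℂ)‖ := by ring_nf
        _ ≤ ‖(y : ℂ)‖ + ‖Complex.I * t‖ := norm_add_le _ _
        _ ≤ _ := by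
          rw [norm_mul, Complex.norm_I, Complex.norm_real, Complex.norm_real, Real.norm_eq_abs,
            Real.norm_eq_abs, abs_of_pos hy]
          linarith
    have h5 : C * z ^ (2 * δ) * (2 * η) ≤ c₀ / 4 * z ^ (-δ) := by
      have : z ^ (2 * δ) * z ^ (-(3 * δ)) = z ^ (-δ) := by
        rw [← Real.rpow_add hz0]; congr 1; ring
      calc C * z ^ (2 * δ) * (2 * η) = 2 * C * c₁ * (z ^ (2 * δ) * z ^ (-(3 * δ))) := by
            rw [hη]; ring
        _ = 2 * C * c₁ * z ^ (-δ) := by rw [this]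
        _ ≤ _ := by gcongr; linarith
    have h6 : ‖DirichletCharacter.LFunction χ 1‖ ≤
        ‖DirichletCharacter.LFunction χ (1 + y + Complex.I * t)‖ +
        ‖DirichletCharacter.LFunction χ (1 + y + Complex.I * t) -
          DirichletCharacter.LFunction χ 1‖ := by
      have := norm_sub_norm_le (DirichletCharacter.LFunction χ 1)
        (DirichletCharacter.LFunction χ (1 + y + Complex.I * t))
      rw [norm_sub_rev] at this
      linarith
    have h7 : ‖DirichletCharacter.LFunction χ (1 + y + Complex.I * t) -
          DirichletCharacter.LFunction χ 1‖ ≤ c₀ / 4 * z ^ (-δ) :=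
      h3.trans (le_trans (by gcongr) h5)
    have h8 : z ^ (-ε) ≤ z ^ (-δ) := Real.rpow_le_rpow_of_exponent_le (by linarith) (by linarith)
    have h9 : 0 < z ^ (-δ) := by positivity
    calc _ ≤ c₀ / 2 * z ^ (-δ) := by gcongr; exact min_le_right _ _
      _ ≤ _ := by nlinarith
  · have hm : ∀ x : ℝ, y ≤ x → ‖charMean (χ ^ 2)‖ / ‖(x + 2 * Complex.I * t : ℂ)‖ ≤ 1 / η := by
      intro x hx
      by_cases hχ2 : χ ^ 2 = 1
      · have hre : x ≤ ‖(x + 2 * Complex.I * t : ℂ)‖ := by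
          have := Complex.re_le_norm (x + 2 * Complex.I * t : ℂ)
          simpa using this
        have him : 2 * |t| ≤ ‖(x + 2 * Complex.I * t : ℂ)‖ := by
          have := Complex.abs_im_le_norm (x + 2 * Complex.I * t : ℂ)
          simpa [abs_mul] using this
        have : η ≤ ‖(x + 2 * Complex.I * t : ℂ)‖ := by
          by_contra! hlt
          refine hcase ⟨hχ2, hχ.resolve_right fun h ↦ by linarith, by linarith, ?_⟩
          linarith [abs_nonneg t]
        gcongr
        exact norm_charMean_le _
      · rw [charMean_of_ne_one hχ2, norm_zero, zero_div]
        positivity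
    refine le_trans ?_ (hD q χ y t (1 / η) hy hy1 (by positivity) hχ hm)
    have hBle : D * z ^ (2 * δ) * (1 + 1 / η) ≤ 2 * D / c₁ * z ^ (5 * δ) := by
      have h1 : 1 + 1 / η ≤ 2 / η := by
        rw [le_div_iff₀ hη0, add_mul, one_div, inv_mul_cancel₀ hη0.ne']; linarith
      calc _ ≤ D * z ^ (2 * δ) * (2 / η) := by gcongr
        _ = 2 * D / c₁ * (z ^ (2 * δ) * z ^ (3 * δ)) := by
          rw [hη, Real.rpow_neg hz0.le]; field_simp
        _ = _ := by rw [← Real.rpow_add hz0]; ring_nf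
    have hpow : (z ^ (5 * δ)) ^ 7 ≤ z ^ ε := by
      rw [← Real.rpow_natCast, ← Real.rpow_mul hz0.le]
      apply Real.rpow_le_rpow_of_exponent_le (by linarith)
      push_cast; linarith
    calc _ ≤ 1 / (16 * (2 * D / c₁) ^ 7) * z ^ (-ε) := by gcongr; exact min_le_left _ _
      _ = 1 / (16 * (2 * D / c₁) ^ 7 * z ^ ε) := by
        rw [Real.rpow_neg hz0.le]; field_simp
      _ ≤ 1 / (16 * (2 * D / c₁ * z ^ (5 * δ)) ^ 7) := by
        rw [mul_pow, ← mul_assoc]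
        gcongr
      _ ≤ _ := by gcongr

/-- A local bound for the derivatives of a logarithmic derivative. -/
lemma norm_iteratedDeriv_logDeriv_le {H : ℂ → ℂ} {s : ℂ} {ρ W w : ℝ} (hρ : 0 < ρ) (hw : 0 < w)
    (hd : ∀ s', ‖s' - s‖ ≤ ρ → DifferentiableAt ℂ H s') (hW : ∀ s', ‖s' - s‖ ≤ ρ → ‖H s'‖ ≤ W)
    (hws : w ≤ ‖H s‖) (k : ℕ) :
    ‖iteratedDeriv k (logDeriv H) s‖ ≤ k.factorial * (4 * W / (ρ * w)) ^ (k + 1) := by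
  have hwW : w ≤ W := hws.trans (hW s (by simpa using hρ.le))
  have hW0 : 0 < W := hw.trans_le hwW
  set r := w * ρ / (4 * W) with hr
  have hr0 : 0 < r := by positivity
  have hrρ : r ≤ ρ / 4 := by
    rw [hr, div_le_iff₀ (by positivity)]; nlinarith
  have hderiv : ∀ s', ‖s' - s‖ ≤ ρ / 2 → ‖deriv H s'‖ ≤ 2 * W / ρ := by
    intro s' hs'
    have := Complex.norm_deriv_le_of_forall_mem_sphere_norm_le (c := s') (R := ρ / 2) (C := W)
      (f := H) (by positivity) ?_ ?_
    · refine this.trans (le_of_eq (by field_simp))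
    · refine DifferentiableOn.diffContOnCl fun u hu ↦ (hd u ?_).differentiableWithinAt
      have := Metric.closure_ball_subset_closedBall hu
      rw [mem_closedBall_iff_norm] at this
      calc ‖u - s‖ = ‖(u - s') + (s' - s)‖ := by ring_nf
        _ ≤ _ := norm_add_le _ _
        _ ≤ ρ := by linarith
    · intro u hu
      rw [mem_sphere_iff_norm] at hu
      refine hW u ?_
      calc ‖u - s‖ = ‖(u - s') + (s' - s)‖ := by ring_nf
        _ ≤ _ := norm_add_le _ _
        _ ≤ ρ := by linarith
  have hlow : ∀ s', ‖s' - s‖ ≤ r → w / 2 ≤ ‖H s'‖ := by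
    intro s' hs'
    have := Convex.norm_image_sub_le_of_norm_deriv_le (f := H) (C := 2 * W / ρ)
      (s := Metric.closedBall s (ρ / 2)) (x := s) (y := s')
      (fun u hu ↦ hd u (by rw [mem_closedBall_iff_norm] at hu; linarith))
      (fun u hu ↦ hderiv u (by rwa [mem_closedBall_iff_norm] at hu)) (convex_closedBall _ _)
      (Metric.mem_closedBall_self (by positivity))
      (by rw [mem_closedBall_iff_norm]; linarith)
    have h1 : ‖H s' - H s‖ ≤ w / 2 := by
      calc _ ≤ _ := this
        _ ≤ 2 * W / ρ * r := by gcongr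
        _ = w / 2 := by rw [hr]; field_simp; norm_num
    have h2 := norm_sub_norm_le (H s) (H s')
    rw [norm_sub_rev] at h2
    linarith
  have hne : ∀ s', ‖s' - s‖ ≤ r → H s' ≠ 0 := fun s' hs' h ↦ by
    have := hlow s' hs'
    rw [h, norm_zero] at this
    linarith
  have hdd : ∀ s', ‖s' - s‖ ≤ r → DifferentiableAt ℂ (logDeriv H) s' := by
    intro s' hs'
    have hA : DifferentiableOn ℂ H (Metric.ball s ρ) := fun u hu ↦
      (hd u (by rw [mem_ball_iff_norm] at hu; exact hu.le)).differentiableWithinAt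
    have hs'b : Metric.ball s ρ ∈ nhds s' := Metric.isOpen_ball.mem_nhds (by
      rw [mem_ball_iff_norm]; linarith)
    exact ((hA.deriv Metric.isOpen_ball).differentiableAt hs'b).div (hA.differentiableAt hs'b)
      (hne s' hs')
  have hbound := Complex.norm_iteratedDeriv_le_of_forall_mem_sphere_norm_le (c := s) (R := r)
    (C := 4 * W / (ρ * w)) (f := logDeriv H) k hr0 ?_ ?_
  · refine hbound.trans (le_of_eq ?_)
    rw [hr, pow_succ, div_pow, div_pow]
    field_simp
  · refine DifferentiableOn.diffContOnCl fun u hu ↦ (hdd u ?_).differentiableWithinAt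
    have := Metric.closure_ball_subset_closedBall hu
    rwa [mem_closedBall_iff_norm] at this
  · intro u hu
    rw [mem_sphere_iff_norm] at hu
    rw [logDeriv_apply, norm_div]
    calc _ ≤ (2 * W / ρ) / (w / 2) := by
          gcongr
          · exact hderiv u (by linarith)
          · exact hlow u hu.le
      _ = _ := by field_simp; norm_num

lemma norm_iteratedDeriv_logDeriv_LFunction_le (k : ℕ) {ε : ℝ} (hε : 0 < ε) : ∃ C : ℝ, 0 < C ∧
    ∀ (q : ℕ) [NeZero q] (χ : DirichletCharacter ℂ q) (y t : ℝ), 0 < y → y ≤ 1 →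
      (χ ≠ 1 ∨ 1 ≤ |t|) →
      ‖iteratedDeriv k (logDeriv (DirichletCharacter.LFunction χ)) (1 + y + Complex.I * t)‖ ≤
        C * cond q t ^ ε := by
  set ε' := ε / (2 * (k + 1)) with hε'
  have hε'0 : 0 < ε' := by positivity
  set δ := min (1 / 2) (ε' / 2) with hδ
  have hδ0 : 0 < δ := by positivity
  have hδ2 : δ ≤ 1 / 2 := min_le_left _ _
  have hδε : 2 * δ ≤ ε' := by linarith [min_le_right (1 / 2) (ε' / 2)]
  obtain ⟨C, hC, hCd⟩ := norm_LFunction_deriv_le hδ0 hδ2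
  obtain ⟨c, hc, hcl⟩ := norm_LFunction_ge hε'0
  refine ⟨k.factorial * (4 * C / (δ * c)) ^ (k + 1), by positivity,
    fun q _ χ y t hy hy1 hχ ↦ ?_⟩
  have hz2 := two_le_cond q t
  set z := cond q t with hz
  have hz0 : 0 < z := by linarith
  set s : ℂ := 1 + y + Complex.I * t with hs
  have hsre : s.re = 1 + y := by simp [hs]
  have hsim : s.im = t := by simp [hs]
  have hχ' : χ ≠ 1 ∨ 1 ≤ ‖s - 1‖ := hχ.imp_right fun h ↦ by
    have := Complex.abs_im_le_norm (s - 1)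
    simp only [Complex.sub_im, Complex.one_im, sub_zero, hsim] at this
    linarith
  have hW := (hCd q χ s hχ' (by linarith) (by linarith)).1
  rw [hsim] at hW
  have hd : ∀ s', ‖s' - s‖ ≤ δ → DifferentiableAt ℂ (DirichletCharacter.LFunction χ) s' := by
    intro s' hs'
    refine DirichletCharacter.differentiableAt_LFunction χ s' ?_
    rcases hχ' with h | h
    · exact Or.inr h
    · left
      rintro rfl
      rw [norm_sub_rev] at hs'
      linarith
  refine (norm_iteratedDeriv_logDeriv_le hδ0 (by positivity) hd hW (hcl q χ y t hy hy1 hχ)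
    k).trans ?_
  have h1 : 4 * (C * z ^ (2 * δ)) / (δ * (c * z ^ (-ε'))) ≤
      4 * C / (δ * c) * z ^ (2 * ε') := by
    rw [Real.rpow_neg hz0.le]
    calc _ = 4 * C / (δ * c) * (z ^ (2 * δ) * z ^ ε') := by field_simp
      _ ≤ 4 * C / (δ * c) * (z ^ ε' * z ^ ε') := by
        gcongr
        linarith
      _ = _ := by rw [← Real.rpow_add hz0]; ring_nf
  have h2 : (z ^ (2 * ε')) ^ (k + 1) = z ^ ε := by
    rw [← Real.rpow_natCast, ← Real.rpow_mul hz0.le, hε']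
    congr 1
    push_cast; field_simp
  calc _ ≤ k.factorial * (4 * C / (δ * c) * z ^ (2 * ε')) ^ (k + 1) := by gcongr
    _ = _ := by rw [mul_pow, h2]; ring

/-- The Dirichlet series with coefficients `Λ - 1`, in terms of the zeta function. -/
noncomputable def zetaDev (s : ℂ) : ℂ := -logDeriv riemannZeta s - riemannZeta s

lemma zetaDev_eq {s : ℂ} (hs : s ≠ 1) (hζ : riemannZeta s ≠ 0) :
    zetaDev s = -logDeriv (lfunOne (1 : DirichletCharacter ℂ 1)) s -
      dslope (lfunOne (1 : DirichletCharacter ℂ 1)) 1 s := by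
  have hs1 : s - 1 ≠ 0 := sub_ne_zero.mpr hs
  have hev : lfunOne (1 : DirichletCharacter ℂ 1) =ᶠ[nhds s] fun s ↦ (s - 1) * riemannZeta s := by
    filter_upwards [isOpen_ne.mem_nhds hs] with u hu using lfunOne_modOne_eq hu
  have hld : logDeriv (lfunOne (1 : DirichletCharacter ℂ 1)) s =
      1 / (s - 1) + logDeriv riemannZeta s := by
    rw [logDeriv_apply, hev.deriv_eq, hev.eq_of_nhds, ← logDeriv_apply,
      logDeriv_mul (f := fun s ↦ s - 1) s hs1 hζ (by fun_prop) (differentiableAt_riemannZeta hs)]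
    congr 1
    rw [logDeriv_apply]
    simp
  rw [zetaDev, hld, dslope_of_ne _ hs, slope_def_field, lfunOne_modOne_one, lfunOne_modOne_eq hs]
  field_simp
  ring

lemma continuousOn_iteratedDeriv_of_isOpen {U : Set ℂ} (hU : IsOpen U) {f : ℂ → ℂ}
    (hf : DifferentiableOn ℂ f U) (k : ℕ) : ContinuousOn (iteratedDeriv k f) U := by
  have : DifferentiableOn ℂ (iteratedDeriv k f) U := by
    induction k with
    | zero => simpa using hf
    | succ k ih => rw [iteratedDeriv_succ]; exact ih.deriv hU
  exact this.continuousOn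

lemma norm_iteratedDeriv_zetaDev_le (k : ℕ) {ε : ℝ} (hε : 0 < ε) : ∃ C : ℝ, 0 < C ∧
    ∀ y t : ℝ, 0 < y → y ≤ 1 →
      ‖iteratedDeriv k zetaDev (1 + y + Complex.I * t)‖ ≤ C * cond 1 t ^ ε := by
  obtain ⟨C₁, hC₁, h₁⟩ := norm_iteratedDeriv_logDeriv_LFunction_le k hε
  set δ := min (1 / 2) (ε / 2) with hδ
  have hδ0 : 0 < δ := by positivity
  have hδ2 : δ ≤ 1 / 2 := min_le_left _ _
  have hδε : 2 * δ ≤ ε := by linarith [min_le_right (1 / 2) (ε / 2)]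
  obtain ⟨C₂, hC₂, h₂⟩ := norm_LFunction_deriv_le hδ0 hδ2
  set Z := lfunOne (1 : DirichletCharacter ℂ 1) with hZ
  have hZd : Differentiable ℂ Z := differentiable_lfunOne _
  set U : Set ℂ := {s | Z s ≠ 0} with hU
  have hUo : IsOpen U := isOpen_ne.preimage hZd.continuous
  set G : ℂ → ℂ := fun s ↦ -logDeriv Z s - dslope Z 1 s with hG
  have hGd : DifferentiableOn ℂ G U := by
    have hds : DifferentiableOn ℂ (dslope Z 1) Set.univ :=
      (Complex.differentiableOn_dslope Filter.univ_mem).mpr hZd.differentiableOn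
    have hZ' : Differentiable ℂ (deriv Z) :=
      fun u ↦ (hZd.differentiableOn.deriv isOpen_univ).differentiableAt Filter.univ_mem
    exact ((hZ'.differentiableOn.div hZd.differentiableOn fun s hs ↦ hs).neg).sub
      (hds.mono (Set.subset_univ _))
  set K : Set ℂ := Set.Icc (1 : ℝ) 2 ×ℂ Set.Icc (-1 : ℝ) 1 with hK
  have hKc : IsCompact K := isCompact_Icc.reProdIm isCompact_Icc
  have hKU : K ⊆ U := by
    intro s hs h0
    rcases eq_or_ne s 1 with rfl | hs1
    · rw [hZ, lfunOne_modOne_one] at h0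
      exact one_ne_zero h0
    · rw [hZ, lfunOne_modOne_eq hs1] at h0
      exact mul_ne_zero (sub_ne_zero.mpr hs1) (riemannZeta_ne_zero_of_one_le_re hs.1.1) h0
  obtain ⟨C₃, hC₃⟩ := hKc.exists_bound_of_continuousOn
    ((continuousOn_iteratedDeriv_of_isOpen hUo hGd k).mono hKU)
  refine ⟨C₁ + k.factorial * C₂ / δ ^ k + |C₃|, by positivity, fun y t hy hy1 ↦ ?_⟩
  have hz2 := two_le_cond 1 t
  have hz1 : 1 ≤ cond 1 t ^ ε := Real.one_le_rpow (by linarith) hε.le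
  set s : ℂ := 1 + y + Complex.I * t with hs
  have hsre : s.re = 1 + y := by simp [hs]
  have hsim : s.im = t := by simp [hs]
  rcases le_total |t| 1 with ht | ht
  · have hev : zetaDev =ᶠ[nhds s] G := by
      filter_upwards [(isOpen_lt continuous_const Complex.continuous_re).mem_nhds
        (show 1 < s.re by linarith)] with u hu
      have hu1 : u ≠ 1 := by rintro rfl; simp at hu
      exact zetaDev_eq hu1 (riemannZeta_ne_zero_of_one_le_re (le_of_lt hu))
    rw [hev.iteratedDeriv_eq]
    have hsK : s ∈ K := ⟨⟨by linarith, by linarith⟩, by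
      rw [Set.mem_preimage, hsim]; exact abs_le.mp ht⟩
    calc _ ≤ C₃ := hC₃ s hsK
      _ ≤ |C₃| * 1 := by rw [mul_one]; exact le_abs_self _
      _ ≤ |C₃| * cond 1 t ^ ε := by gcongr
      _ ≤ _ := by gcongr; linarith [show 0 ≤ k.factorial * C₂ / δ ^ k by positivity]
  · have hns : 1 ≤ ‖s - 1‖ := by
      have := Complex.abs_im_le_norm (s - 1)
      simp only [Complex.sub_im, Complex.one_im, sub_zero, hsim] at this
      linarith
    have h1 := h₁ 1 1 y t hy hy1 (Or.inr ht)
    have h2 := (h₂ 1 1 s (Or.inr hns) (by linarith) (by linarith)).1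
    rw [DirichletCharacter.LFunction_modOne_eq] at h1 h2
    rw [← hs] at h1
    rw [hsim] at h2
    have hs1 : s ≠ 1 := by
      rintro h
      rw [h, sub_self, norm_zero] at hns
      linarith
    have hζd : DifferentiableOn ℂ riemannZeta {1}ᶜ := fun u hu ↦
      (differentiableAt_riemannZeta hu).differentiableWithinAt
    have hζa : AnalyticAt ℂ riemannZeta s := hζd.analyticAt (isOpen_compl_singleton.mem_nhds hs1)
    have hζ0 : riemannZeta s ≠ 0 := riemannZeta_ne_zero_of_one_le_re (by linarith)
    have hlda : AnalyticAt ℂ (logDeriv riemannZeta) s := hζa.deriv.div hζa hζ0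
    have h3 : ‖iteratedDeriv k riemannZeta s‖ ≤ k.factorial * (C₂ * cond 1 t ^ (2 * δ)) / δ ^ k := by
      refine Complex.norm_iteratedDeriv_le_of_forall_mem_sphere_norm_le k hδ0 ?_ fun u hu ↦
        h2 u (by rw [mem_sphere_iff_norm] at hu; exact hu.le)
      refine (hζd.mono fun u hu ↦ ?_).diffContOnCl
      have := Metric.closure_ball_subset_closedBall hu
      rw [mem_closedBall_iff_norm] at this
      rintro rfl
      rw [norm_sub_rev] at this
      linarith
    have h4 : iteratedDeriv k zetaDev s =
        -iteratedDeriv k (logDeriv riemannZeta) s - iteratedDeriv k riemannZeta s := by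
      have : zetaDev = (-logDeriv riemannZeta) - riemannZeta := rfl
      rw [this, iteratedDeriv_sub hlda.neg.contDiffAt hζa.contDiffAt, iteratedDeriv_neg]
    have h5 : cond 1 t ^ (2 * δ) ≤ cond 1 t ^ ε :=
      Real.rpow_le_rpow_of_exponent_le (by linarith) hδε
    rw [h4]
    calc _ ≤ ‖iteratedDeriv k (logDeriv riemannZeta) s‖ + ‖iteratedDeriv k riemannZeta s‖ := by
          refine (norm_sub_le _ _).trans ?_
          rw [norm_neg]
      _ ≤ C₁ * cond 1 t ^ ε + k.factorial * (C₂ * cond 1 t ^ ε) / δ ^ k := by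
          gcongr
          exact h3.trans (by gcongr)
      _ = (C₁ + k.factorial * C₂ / δ ^ k) * cond 1 t ^ ε := by ring
      _ ≤ _ := mul_le_mul_of_nonneg_right (by linarith [abs_nonneg C₃]) (by positivity)

open MeasureTheory

lemma norm_rieszKernel_le {σ : ℝ} (hσ : 1 ≤ σ) (y : ℝ) :
    ‖1 / (((σ : ℂ) + y * Complex.I) * ((σ : ℂ) + y * Complex.I + 1))‖ ≤ (1 + y ^ 2)⁻¹ := by
  have h : ∀ w : ℝ, 1 ≤ w → 1 + y ^ 2 ≤ ‖(w : ℂ) + y * Complex.I‖ ^ 2 := fun w hw ↦ by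
    rw [Complex.sq_norm, Complex.normSq_add_mul_I]
    nlinarith
  have h1 := h σ hσ
  have h2 := h (σ + 1) (by linarith)
  have h3 : (σ : ℂ) + y * Complex.I + 1 = ((σ + 1 : ℝ) : ℂ) + y * Complex.I := by push_cast; ring
  rw [h3, norm_div, norm_one, norm_mul, one_div]
  refine inv_anti₀ (by positivity) ?_
  refine abs_le_of_sq_le_sq' ?_ (by positivity) |>.2
  rw [mul_pow, sq (1 + y ^ 2)]
  gcongr

lemma ne_zero_of_one_le {σ : ℝ} (hσ : 1 ≤ σ) (y : ℝ) : (σ : ℂ) + y * Complex.I ≠ 0 := by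
  intro h
  have := congrArg Complex.re h
  simp at this
  linarith

lemma continuous_rieszKernel {σ : ℝ} (hσ : 1 ≤ σ) : Continuous fun y : ℝ ↦
    1 / (((σ : ℂ) + y * Complex.I) * ((σ : ℂ) + y * Complex.I + 1)) := by
  refine continuous_const.div (by fun_prop) fun y ↦ mul_ne_zero (ne_zero_of_one_le hσ y) ?_
  have := ne_zero_of_one_le (σ := σ + 1) (by linarith) y
  push_cast at this
  rwa [add_right_comm] at this

lemma integrable_rieszKernel {σ : ℝ} (hσ : 1 ≤ σ) : Integrable fun y : ℝ ↦
    1 / (((σ : ℂ) + y * Complex.I) * ((σ : ℂ) + y * Complex.I + 1)) :=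
  integrable_inv_one_add_sq.mono' (continuous_rieszKernel hσ).aestronglyMeasurable
    (Filter.Eventually.of_forall fun y ↦ norm_rieszKernel_le hσ y)

lemma integral_rieszKernel {σ : ℝ} (hσ : 1 ≤ σ) {u : ℝ} (hu : 0 < u) :
    (1 / (2 * π)) • ∫ y : ℝ, (u : ℂ) ^ (-((σ : ℂ) + y * Complex.I)) •
      (1 / (((σ : ℂ) + y * Complex.I) * ((σ : ℂ) + y * Complex.I + 1))) =
      ((max (1 - u) 0 : ℝ) : ℂ) := by
  set f : ℝ → ℂ := fun u ↦ (Set.Ioc 0 1).indicator (fun _ ↦ (1 : ℂ)) u -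
    (Set.Ioc 0 1).indicator (fun t : ℝ ↦ (t : ℂ) ^ (1 : ℂ)) u with hf
  have hM : ∀ s : ℂ, 0 < s.re → MellinConvergent f s ∧ mellin f s = 1 / (s * (s + 1)) := by
    intro s hs
    obtain ⟨h1, h1'⟩ := hasMellin_one_Ioc hs
    obtain ⟨h2, h2'⟩ := hasMellin_cpow_Ioc 1 (s := s) (by simp; linarith)
    obtain ⟨h3, h3'⟩ := hasMellin_sub h1 h2
    refine ⟨h3, ?_⟩
    rw [hf, h3', h1', h2']
    have hs0 : s ≠ 0 := by rintro rfl; simp at hs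
    have hs1 : s + 1 ≠ 0 := by
      intro h; have := congrArg Complex.re h; simp at this; linarith
    field_simp
    ring
  have hfu : ∀ u : ℝ, 0 < u → f u = ((max (1 - u) 0 : ℝ) : ℂ) := by
    intro u hu
    simp only [hf, Set.indicator, Set.mem_Ioc, hu, true_and, Complex.cpow_one]
    split_ifs with h
    · rw [max_eq_left (by linarith)]; push_cast; ring
    · rw [max_eq_right (by linarith)]; simp
  have hre : ∀ y : ℝ, 0 < ((σ : ℂ) + y * Complex.I).re := fun y ↦ by simp; linarith
  have hinteg := mellinInv_mellin_eq σ f hu (hM σ (by simp; linarith)).1 ?_ ?_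
  · rw [← hfu u hu, ← hinteg, mellinInv]
    congr 2
    funext y
    rw [(hM _ (hre y)).2]
  · rw [Complex.VerticalIntegrable]
    refine (integrable_rieszKernel hσ).congr (Filter.Eventually.of_forall fun y ↦ ?_)
    exact (hM _ (hre y)).2.symm
  · have hc : ContinuousAt (fun u : ℝ ↦ ((max (1 - u) 0 : ℝ) : ℂ)) u := by fun_prop
    refine hc.congr ?_
    filter_upwards [Ioi_mem_nhds hu] with v hv using (hfu v hv).symm

lemma integrable_one_add_abs_rpow : Integrable fun y : ℝ ↦ (1 + |y|) ^ (-(3 / 2) : ℝ) := by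
  have := integrable_one_add_norm (E := ℝ) (μ := volume) (r := 3 / 2) (by norm_num)
  simpa [Real.norm_eq_abs] using this

lemma perron_riesz : ∃ C : ℝ, 0 < C ∧ ∀ (c : ℕ → ℂ) (σ x E : ℝ), 1 ≤ σ → 0 < x → 0 ≤ E →
    LSeriesSummable c σ →
    (∀ y : ℝ, ‖LSeries c (σ + y * Complex.I)‖ ≤ E * (|y| + 2) ^ (1 / 2 : ℝ)) →
    ‖∑ n ∈ Icc 1 ⌊x⌋₊, c n * (x - n)‖ ≤ C * E * x ^ (1 + σ) := by
  set I := ∫ y : ℝ, (1 + |y|) ^ (-(3 / 2) : ℝ) with hI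
  have hI0 : 0 ≤ I := integral_nonneg fun y ↦ by positivity
  refine ⟨8 * I / (2 * π) + 1, by positivity, fun c σ x E hσ hx hE hs hL ↦ ?_⟩
  set K : ℝ → ℂ := fun y ↦ 1 / (((σ : ℂ) + y * Complex.I) * ((σ : ℂ) + y * Complex.I + 1)) with hK
  have hKc := continuous_rieszKernel hσ
  have hKi := integrable_rieszKernel hσ
  have hre : ∀ y : ℝ, ((σ : ℂ) + y * Complex.I).re = σ := fun y ↦ by simp
  have hxs : ∀ y : ℝ, ‖(x : ℂ) ^ ((σ : ℂ) + y * Complex.I)‖ = x ^ σ := fun y ↦ by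
    rw [Complex.norm_cpow_eq_rpow_re_of_pos hx, hre]
  have hsum : ∀ y : ℝ, LSeriesSummable c (σ + y * Complex.I) := fun y ↦
    hs.of_re_le_re (by simp)
  set F : ℕ → ℝ → ℂ := fun n y ↦ LSeries.term c (σ + y * Complex.I) n *
    ((x : ℂ) ^ ((σ : ℂ) + y * Complex.I) * K y) with hF
  have hFn : ∀ n y, ‖F n y‖ = ‖LSeries.term c σ n‖ * (x ^ σ * ‖K y‖) := by
    intro n y
    rw [hF]
    simp only [norm_mul]
    rw [hxs, LSeries.norm_term_eq, LSeries.norm_term_eq, hre, Complex.ofReal_re]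
  have hFi : ∀ n, Integrable (F n) := by
    intro n
    have hcont : Continuous (F n) := by
      refine Continuous.mul ?_ (Continuous.mul ?_ hKc)
      · rcases eq_or_ne n 0 with rfl | hn
        · simp only [LSeries.term_zero]; exact continuous_const
        · simp only [LSeries.term_of_ne_zero hn]
          refine continuous_const.div (Continuous.const_cpow (by fun_prop) (Or.inl ?_)) fun y ↦ ?_
          · exact_mod_cast hn
          · rw [Complex.cpow_ne_zero_iff]; left; exact_mod_cast hn
      · exact Continuous.const_cpow (by fun_prop) (Or.inl (by exact_mod_cast hx.ne'))
    refine (hKi.norm.const_mul (‖LSeries.term c σ n‖ * x ^ σ)).mono' hcont.aestronglyMeasurable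
      (Filter.Eventually.of_forall fun y ↦ ?_)
    rw [hFn, mul_assoc]
  have hS : Summable fun n ↦ ∫ y, ‖F n y‖ := by
    simp_rw [hFn, integral_const_mul]
    exact hs.norm.mul_right _
  have hmain := hasSum_integral_of_summable_integral_norm hFi hS
  have hterm : ∀ n, ∫ y, F n y = 2 * π * (if n = 0 then 0 else c n *
      ((max (1 - n / x) 0 : ℝ) : ℂ)) := by
    intro n
    rcases eq_or_ne n 0 with rfl | hn
    · simp [hF]
    have hn0 : (0 : ℝ) < n := by exact_mod_cast Nat.pos_of_ne_zero hn
    rw [if_neg hn, ← integral_rieszKernel hσ (div_pos hn0 hx)]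
    have : ∀ y, F n y = c n * ((((n : ℝ) / x : ℝ) : ℂ) ^ (-((σ : ℂ) + y * Complex.I)) • K y) := by
      intro y
      simp only [hF, LSeries.term_of_ne_zero hn, smul_eq_mul]
      rw [Complex.ofReal_div, Complex.div_cpow_ofReal_nonneg hn0.le hx.le, Complex.cpow_neg,
        Complex.cpow_neg, Complex.ofReal_natCast]
      field_simp
    simp_rw [this]
    rw [integral_const_mul, Complex.real_smul]
    have hπ : 2 * (π : ℂ) * ((1 / (2 * π) : ℝ) : ℂ) = 1 := by
      have : (π : ℂ) ≠ 0 := by exact_mod_cast pi_ne_zero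
      push_cast
      field_simp
    rw [mul_left_comm, ← mul_assoc (2 * (π : ℂ)), hπ, one_mul]
  have hfin : ∑ n ∈ Icc 1 ⌊x⌋₊, c n * (x - n) =
      x / (2 * π) * ∫ y, ∑' n, F n y := by
    have h0 : ∀ n ∉ Icc 1 ⌊x⌋₊, ∫ y, F n y = 0 := by
      intro n hn
      rw [hterm]
      split_ifs with h
      · simp
      · rw [mem_Icc, not_and, Nat.le_floor_iff hx.le, not_le] at hn
        have := hn (Nat.one_le_iff_ne_zero.mpr h)
        rw [max_eq_right]
        · simp
        · rw [sub_nonpos, one_le_div hx]; exact this.le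
    rw [hmain.unique (hasSum_sum_of_ne_finset_zero h0), mul_sum]
    refine sum_congr rfl fun n hn ↦ ?_
    rw [mem_Icc, Nat.le_floor_iff hx.le] at hn
    rw [hterm, if_neg (by omega), max_eq_left]
    · have hπ : (π : ℂ) ≠ 0 := by exact_mod_cast pi_ne_zero
      have hx' : (x : ℂ) ≠ 0 := by exact_mod_cast hx.ne'
      push_cast
      field_simp
    · rw [sub_nonneg, div_le_one hx]; exact hn.2
  rw [hfin, norm_mul]
  have hb : ‖∫ y, ∑' n, F n y‖ ≤ ∫ y : ℝ, E * x ^ σ * 8 * (1 + |y|) ^ (-(3 / 2) : ℝ) := by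
    refine norm_integral_le_of_norm_le (integrable_one_add_abs_rpow.const_mul _)
      (Filter.Eventually.of_forall fun y ↦ ?_)
    have : ∑' n, F n y = LSeries c (σ + y * Complex.I) *
        ((x : ℂ) ^ ((σ : ℂ) + y * Complex.I) * K y) := by
      simp only [hF, tsum_mul_right, LSeries]
    rw [this, norm_mul, norm_mul, hxs]
    have h1 : (1 + y ^ 2)⁻¹ ≤ 8 * (|y| + 2) ^ (-2 : ℝ) := by
      rw [Real.rpow_neg (by positivity), ← div_eq_mul_inv, inv_eq_one_div, div_le_div_iff₀
        (by positivity) (by positivity), Real.rpow_two]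
      nlinarith [sq_abs y, sq_nonneg (|y| - 2), sq_nonneg (|y| - 1)]
    have h2 : (|y| + 2) ^ (1 / 2 : ℝ) * (|y| + 2) ^ (-2 : ℝ) ≤ (1 + |y|) ^ (-(3 / 2) : ℝ) := by
      rw [← Real.rpow_add (by positivity)]
      norm_num
      exact Real.rpow_le_rpow_of_nonpos (by positivity) (by linarith) (by norm_num)
    calc _ ≤ E * (|y| + 2) ^ (1 / 2 : ℝ) * (x ^ σ * (8 * (|y| + 2) ^ (-2 : ℝ))) := by
          gcongr
          · exact hL y
          · exact (norm_rieszKernel_le hσ y).trans h1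
      _ = E * x ^ σ * 8 * ((|y| + 2) ^ (1 / 2 : ℝ) * (|y| + 2) ^ (-2 : ℝ)) := by ring
      _ ≤ _ := by gcongr
  rw [integral_const_mul, ← hI] at hb
  have hn1 : ‖(x : ℂ) / (2 * π)‖ = x / (2 * π) := by
    rw [show (x : ℂ) / (2 * π) = ((x / (2 * π) : ℝ) : ℂ) by push_cast; ring, Complex.norm_real,
      Real.norm_eq_abs, abs_of_pos (by positivity)]
  rw [hn1, Real.rpow_add hx, Real.rpow_one]
  calc _ ≤ x / (2 * π) * (E * x ^ σ * 8 * I) := by gcongr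
    _ = 8 * I / (2 * π) * E * (x * x ^ σ) := by ring
    _ ≤ _ := by gcongr; linarith

lemma logMul_iterate_apply (f : ℕ → ℂ) (k n : ℕ) :
    LSeries.logMul^[k] f n = ((Real.log n ^ k : ℝ) : ℂ) * f n := by
  induction k with
  | zero => simp
  | succ k ih =>
    rw [Function.iterate_succ_apply', LSeries.logMul, ih, pow_succ', Complex.ofReal_mul,
      Complex.ofReal_log (Nat.cast_nonneg n), Complex.ofReal_natCast, mul_assoc]

lemma one_le_log {x : ℝ} (hx : 3 ≤ x) : 1 ≤ Real.log x := by
  rw [Real.le_log_iff_exp_le (by linarith)]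
  linarith [Real.exp_one_lt_d9]

lemma norm_riesz_sum_le (k : ℕ) : ∃ C : ℝ, 0 < C ∧ ∀ (f : ℕ → ℂ) (G : ℂ → ℂ) (Q : ℝ), 0 ≤ Q →
    (∀ s : ℂ, 1 < s.re → LSeriesSummable f s) →
    (∀ s : ℂ, 1 < s.re → LSeries f s = G s) →
    (∀ y t : ℝ, 0 < y → y ≤ 1 →
      ‖iteratedDeriv k G (1 + y + Complex.I * t)‖ ≤ Q * (|t| + 2) ^ (1 / 2 : ℝ)) →
    ∀ x : ℝ, 3 ≤ x →
      ‖∑ n ∈ Icc 1 ⌊x⌋₊, ((Real.log n ^ k : ℝ) : ℂ) * f n * (x - n)‖ ≤ C * Q * x ^ 2 := by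
  obtain ⟨C, hC, h⟩ := perron_riesz
  refine ⟨C * Real.exp 1, by positivity, fun f G Q hQ hs hG hb x hx ↦ ?_⟩
  have hl := one_le_log hx
  have hx0 : 0 < x := by linarith
  set y := 1 / Real.log x with hy
  have hy0 : 0 < y := by positivity
  have hy1 : y ≤ 1 := by rw [hy, div_le_one (by linarith)]; exact hl
  have habs : LSeries.abscissaOfAbsConv f ≤ (1 : ℝ) :=
    LSeries.abscissaOfAbsConv_le_of_forall_lt_LSeriesSummable fun u hu ↦ hs u (by simpa using hu)
  have habs' : ∀ s : ℂ, 1 < s.re → LSeries.abscissaOfAbsConv f < s.re := fun s h ↦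
    habs.trans_lt (by exact_mod_cast h)
  have hre : ∀ t : ℝ, (1 : ℝ) < (((1 + y : ℝ) : ℂ) + t * Complex.I).re := fun t ↦ by
    simp; linarith
  have key := h (LSeries.logMul^[k] f) (1 + y) x Q (by linarith) hx0 hQ ?_ fun t ↦ ?_
  · simp_rw [logMul_iterate_apply] at key
    refine key.trans (le_of_eq ?_)
    rw [show 1 + (1 + y) = 2 + y by ring, Real.rpow_add hx0, Real.rpow_two,
      show x ^ y = Real.exp 1 by
        rw [Real.rpow_def_of_pos hx0, hy, mul_one_div_cancel (by linarith)]]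
    ring
  · apply LSeriesSummable_of_abscissaOfAbsConv_lt_re
    rw [LSeries.absicssaOfAbsConv_logPowMul]
    exact habs' _ (by simpa using hy0)
  · set s : ℂ := ((1 + y : ℝ) : ℂ) + t * Complex.I with hsdef
    have h1 := LSeries_iteratedDeriv (f := f) k (habs' s (hre t))
    have hev : LSeries f =ᶠ[nhds s] G := by
      filter_upwards [(isOpen_lt continuous_const Complex.continuous_re).mem_nhds (hre t)]
        with u hu using hG u hu
    rw [hev.iteratedDeriv_eq] at h1
    have h2 : ‖LSeries (LSeries.logMul^[k] f) s‖ = ‖iteratedDeriv k G s‖ := by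
      rw [h1, norm_mul, norm_pow, norm_neg, norm_one, one_pow, one_mul]
    rw [h2, show s = 1 + y + Complex.I * t by rw [hsdef]; push_cast; ring]
    exact hb y t hy0 hy1

lemma log_pow_le_mul (k : ℕ) {x : ℝ} (hx : 1 ≤ x) : Real.log x ^ k ≤ k.factorial * x := by
  have := Real.pow_div_factorial_le_exp (Real.log x) (Real.log_nonneg hx) k
  rw [Real.exp_log (by linarith), div_le_iff₀ (by positivity)] at this
  linarith

lemma log_pow_le_mul_sqrt (k : ℕ) {x : ℝ} (hx : 1 ≤ x) :
    Real.log x ^ k ≤ 2 ^ k * k.factorial * √x := by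
  have := log_pow_le_mul k (Real.one_le_sqrt.mpr hx)
  rw [Real.log_sqrt (by linarith), div_pow, div_le_iff₀ (by positivity)] at this
  linarith

lemma norm_log_pow_mul_le {k : ℕ} {f : ℕ → ℂ} (hf : ∀ n, ‖f n‖ ≤ Real.log n + 1) {x : ℝ}
    (hx : 3 ≤ x) {n : ℕ} (hn : (n : ℝ) ≤ 2 * x) :
    ‖((Real.log n ^ k : ℝ) : ℂ) * f n‖ ≤ 3 * 2 ^ k * Real.log x ^ (k + 1) := by
  have hl := one_le_log hx
  have h1 : Real.log n ≤ 2 * Real.log x := by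
    rcases Nat.eq_zero_or_pos n with rfl | h
    · simp; linarith
    · rw [← Nat.cast_ofNat, ← Real.log_pow]
      exact Real.log_le_log (by exact_mod_cast h) (hn.trans (by nlinarith))
  have h0 : 0 ≤ Real.log n := Real.log_natCast_nonneg n
  rw [norm_mul, Complex.norm_real, norm_pow, Real.norm_eq_abs, abs_of_nonneg h0]
  calc _ ≤ (2 * Real.log x) ^ k * (3 * Real.log x) := by
        gcongr
        exact (hf n).trans (by linarith)
    _ = _ := by ring

lemma unsmooth {c : ℕ → ℂ} {x h B D : ℝ} (hx : 0 ≤ x) (hh : 0 < h) (hB : 0 ≤ B)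
    (hc : ∀ n : ℕ, (n : ℝ) ≤ x + h → ‖c n‖ ≤ B)
    (h1 : ‖∑ n ∈ Icc 1 ⌊x⌋₊, c n * (x - n)‖ ≤ D)
    (h2 : ‖∑ n ∈ Icc 1 ⌊x + h⌋₊, c n * ((x + h : ℝ) - n)‖ ≤ D) :
    ‖∑ n ∈ Icc 1 ⌊x⌋₊, c n‖ ≤ 2 * D / h + (h + 1) * B := by
  have hle : ⌊x⌋₊ ≤ ⌊x + h⌋₊ := Nat.floor_mono (by linarith)
  have hsplit : Icc 1 ⌊x + h⌋₊ = Icc 1 ⌊x⌋₊ ∪ Ioc ⌊x⌋₊ ⌊x + h⌋₊ := by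
    ext n; simp only [mem_Icc, mem_union, mem_Ioc]; omega
  have hdisj : Disjoint (Icc 1 ⌊x⌋₊) (Ioc ⌊x⌋₊ ⌊x + h⌋₊) := by
    rw [disjoint_left]; intro n; simp only [mem_Icc, mem_Ioc]; omega
  have hid : (h : ℂ) * ∑ n ∈ Icc 1 ⌊x⌋₊, c n =
      ∑ n ∈ Icc 1 ⌊x + h⌋₊, c n * ((x + h : ℝ) - n) - ∑ n ∈ Icc 1 ⌊x⌋₊, c n * (x - n) -
        ∑ n ∈ Ioc ⌊x⌋₊ ⌊x + h⌋₊, c n * ((x + h : ℝ) - n) := by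
    rw [hsplit, sum_union hdisj, add_sub_right_comm, add_sub_cancel_right, ← sum_sub_distrib,
      mul_sum]
    refine sum_congr rfl fun n _ ↦ ?_
    push_cast
    ring
  have hcard : ((Ioc ⌊x⌋₊ ⌊x + h⌋₊).card : ℝ) ≤ h + 1 := by
    rw [Nat.card_Ioc, Nat.cast_sub hle]
    linarith [Nat.floor_le (show 0 ≤ x + h by linarith), Nat.lt_floor_add_one x]
  have htail : ‖∑ n ∈ Ioc ⌊x⌋₊ ⌊x + h⌋₊, c n * ((x + h : ℝ) - n)‖ ≤ (h + 1) * (B * h) := by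
    refine (norm_sum_le_of_le _ (f := fun n ↦ c n * (((x + h : ℝ) : ℂ) - n))
      (n := fun _ ↦ B * h) fun n hn ↦ ?_).trans ?_
    · rw [mem_Ioc] at hn
      have ha : x < n := (Nat.floor_lt hx).mp hn.1
      have hb : (n : ℝ) ≤ x + h := (Nat.le_floor_iff (by linarith)).mp hn.2
      rw [norm_mul, ← Complex.ofReal_natCast, ← Complex.ofReal_sub, Complex.norm_real,
        Real.norm_eq_abs, abs_of_nonneg (by linarith)]
      gcongr
      · exact hc n hb
      · linarith
    · rw [sum_const, nsmul_eq_mul]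
      gcongr
  have hnorm : h * ‖∑ n ∈ Icc 1 ⌊x⌋₊, c n‖ ≤ D + D + (h + 1) * (B * h) := by
    rw [← abs_of_pos hh, ← Real.norm_eq_abs, ← Complex.norm_real, ← norm_mul, hid]
    refine (norm_sub_le _ _).trans (add_le_add ((norm_sub_le _ _).trans (add_le_add h2 h1)) ?_)
    simpa [abs_of_pos hh] using htail
  rw [← mul_le_mul_iff_right₀ hh]
  refine hnorm.trans (le_of_eq ?_)
  field_simp
  ring

lemma norm_sum_mul_le_of_antitone {c : ℕ → ℂ} {g : ℕ → ℝ} {N₀ N : ℕ} {B : ℝ} (hN : N₀ ≤ N)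
    (hg : AntitoneOn g (Set.Ici N₀)) (hg0 : 0 ≤ g N)
    (hB : ∀ m, N₀ ≤ m → m ≤ N → ‖∑ n ∈ Ioc N₀ m, c n‖ ≤ B) :
    ‖∑ n ∈ Ioc N₀ N, (g n : ℂ) * c n‖ ≤ g N₀ * B := by
  have key : ∀ m, N₀ ≤ m → m ≤ N →
      ‖∑ n ∈ Ioc N₀ m, (g n : ℂ) * c n - g m * ∑ n ∈ Ioc N₀ m, c n‖ ≤ (g N₀ - g m) * B := by
    intro m hm
    induction m, hm using Nat.le_induction with
    | base => simp
    | succ m hm ih =>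
      intro hmN
      rw [← Finset.insert_Ioc_right_eq_Ioc_add_one hm, sum_insert (by simp), sum_insert (by simp)]
      have e : (g (m + 1) : ℂ) * c (m + 1) + ∑ n ∈ Ioc N₀ m, (g n : ℂ) * c n -
          g (m + 1) * (c (m + 1) + ∑ n ∈ Ioc N₀ m, c n) =
          (∑ n ∈ Ioc N₀ m, (g n : ℂ) * c n - g m * ∑ n ∈ Ioc N₀ m, c n) +
          ((g m - g (m + 1) : ℝ) : ℂ) * ∑ n ∈ Ioc N₀ m, c n := by
        push_cast; ring
      have hd : 0 ≤ g m - g (m + 1) := sub_nonneg.mpr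
        (hg (Set.mem_Ici.mpr hm) (Set.mem_Ici.mpr (by omega)) (Nat.le_succ m))
      rw [e]
      have h2 : ‖((g m - g (m + 1) : ℝ) : ℂ) * ∑ n ∈ Ioc N₀ m, c n‖ ≤ (g m - g (m + 1)) * B := by
        rw [norm_mul, Complex.norm_real, Real.norm_eq_abs, abs_of_nonneg hd]
        exact mul_le_mul_of_nonneg_left (hB m hm (by omega)) hd
      refine (norm_add_le _ _).trans ((add_le_add (ih (by omega)) h2).trans (le_of_eq ?_))
      ring
  have h1 := key N hN le_rfl
  have h2 := norm_add_le (∑ n ∈ Ioc N₀ N, (g n : ℂ) * c n - g N * ∑ n ∈ Ioc N₀ N, c n)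
    (g N * ∑ n ∈ Ioc N₀ N, c n)
  rw [sub_add_cancel, norm_mul, Complex.norm_real, Real.norm_eq_abs, abs_of_nonneg hg0] at h2
  have h3 := mul_le_mul_of_nonneg_left (hB N hN le_rfl) hg0
  linarith

lemma norm_log_pow_sum_le (m : ℕ) : ∃ C : ℝ, 0 < C ∧ ∀ (f : ℕ → ℂ) (G : ℂ → ℂ) (Q : ℝ), 0 ≤ Q →
    (∀ n, ‖f n‖ ≤ Real.log n + 1) →
    (∀ s : ℂ, 1 < s.re → LSeriesSummable f s) →
    (∀ s : ℂ, 1 < s.re → LSeries f s = G s) →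
    (∀ y t : ℝ, 0 < y → y ≤ 1 →
      ‖iteratedDeriv (2 * m + 1) G (1 + y + Complex.I * t)‖ ≤ Q * (|t| + 2) ^ (1 / 2 : ℝ)) →
    ∀ x : ℝ, 3 ≤ x → ∀ N : ℕ, (N : ℝ) ≤ x →
      ‖∑ n ∈ Icc 1 N, ((Real.log n ^ (2 * m + 1) : ℝ) : ℂ) * f n‖ ≤
        C * (1 + Q) * (x * Real.log x ^ (m + 1)) := by
  set k := 2 * m + 1 with hk
  obtain ⟨C, hC, h⟩ := norm_riesz_sum_le k
  set K₀ := 2 * (3 * 2 ^ k * Real.log 3 ^ (k + 1)) with hK₀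
  set K₁ : ℝ := ((m + 1).factorial + 1) * (3 * 2 ^ k) with hK₁
  have hl3 := one_le_log le_rfl
  have hK₀0 : 0 < K₀ := by positivity
  have hK₁0 : 0 < K₁ := by positivity
  refine ⟨K₀ + K₁ + 8 * C, by positivity, fun f G Q hQ hf hs hG hb x hx N hN ↦ ?_⟩
  have hl := one_le_log hx
  have hlp : 1 ≤ Real.log x ^ (m + 1) := one_le_pow₀ hl
  rcases lt_or_ge N 3 with h3 | h3
  · have h1 : ‖∑ n ∈ Icc 1 N, ((Real.log n ^ k : ℝ) : ℂ) * f n‖ ≤ K₀ := by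
      refine (norm_sum_le_of_le _ (f := fun n : ℕ ↦ ((Real.log n ^ k : ℝ) : ℂ) * f n)
        (n := fun _ ↦ 3 * 2 ^ k * Real.log 3 ^ (k + 1)) fun n hn ↦ ?_).trans ?_
      · refine norm_log_pow_mul_le hf le_rfl ?_
        rw [mem_Icc] at hn
        have : n ≤ 6 := by omega
        norm_num
        exact_mod_cast this
      · rw [sum_const, nsmul_eq_mul, Nat.card_Icc, hK₀]
        gcongr
        exact_mod_cast (by omega : N + 1 - 1 ≤ 2)
    calc _ ≤ K₀ := h1
      _ = K₀ * 1 * (1 * 1) := by ring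
      _ ≤ _ := by
        gcongr <;> linarith
  · have h3' : (3 : ℝ) ≤ N := by exact_mod_cast h3
    set l := Real.log N with hldef
    have hlN := one_le_log h3'
    have hlN0 : 0 < l := by linarith
    have hN0 : (0 : ℝ) < N := by linarith
    have hlp1 : 1 ≤ l ^ (m + 1) := one_le_pow₀ hlN
    set η := (N : ℝ) / l ^ (m + 1) with hη
    have hη0 : 0 < η := by positivity
    have hηN : η ≤ N := div_le_self hN0.le hlp1
    have hR := h f G Q hQ hs hG hb
    have key := unsmooth (c := fun n ↦ ((Real.log n ^ k : ℝ) : ℂ) * f n) (x := N) (h := η)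
      (B := 3 * 2 ^ k * l ^ (k + 1)) (D := 4 * C * Q * N ^ 2) hN0.le hη0 (by positivity)
      (fun n hn ↦ norm_log_pow_mul_le hf h3' (by linarith))
      ((hR N h3').trans (by nlinarith [show 0 ≤ C * Q * (N : ℝ) ^ 2 by positivity]))
      ((hR (N + η) (by linarith)).trans ?_)
    · rw [Nat.floor_natCast] at key
      have hle : l ≤ Real.log x := Real.log_le_log hN0 hN
      have e1 : 2 * (4 * C * Q * (N : ℝ) ^ 2) / η = 8 * C * Q * (N * l ^ (m + 1)) := by
        rw [hη]; field_simp; ring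
      have e2 : (η + 1) * (3 * 2 ^ k * l ^ (k + 1)) ≤ K₁ * (N * l ^ (m + 1)) := by
        have : 1 ≤ (m + 1).factorial * η := by
          rw [hη, ← mul_div_assoc, le_div_iff₀ (by positivity), one_mul]
          exact log_pow_le_mul (m + 1) (by linarith)
        calc _ ≤ (((m + 1).factorial + 1) * η) * (3 * 2 ^ k * l ^ (k + 1)) := by
              gcongr; linarith
          _ = K₁ * (η * l ^ (m + 1)  * l ^ (m + 1)) := by
              rw [hK₁, hk, show 2 * m + 1 + 1 = (m + 1) + (m + 1) by ring, pow_add]; ring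
          _ = _ := by rw [hη, div_mul_cancel₀ _ (by positivity)]
      calc _ ≤ _ := key
        _ ≤ 8 * C * Q * (N * l ^ (m + 1)) + K₁ * (N * l ^ (m + 1)) := by rw [e1]; gcongr
        _ ≤ (K₀ + K₁ + 8 * C) * (1 + Q) * (N * l ^ (m + 1)) := by
          rw [← add_mul]
          gcongr
          nlinarith [mul_nonneg hK₀0.le hQ, mul_nonneg hK₁0.le hQ]
        _ ≤ _ := by gcongr
    · calc _ ≤ C * Q * (2 * N) ^ 2 := by gcongr; linarith
        _ = _ := by ring

lemma norm_sum_le_of_iteratedDeriv (m : ℕ) : ∃ C : ℝ, 0 < C ∧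
    ∀ (f : ℕ → ℂ) (G : ℂ → ℂ) (Q : ℝ), 0 ≤ Q →
    (∀ n, ‖f n‖ ≤ Real.log n + 1) →
    (∀ s : ℂ, 1 < s.re → LSeriesSummable f s) →
    (∀ s : ℂ, 1 < s.re → LSeries f s = G s) →
    (∀ y t : ℝ, 0 < y → y ≤ 1 →
      ‖iteratedDeriv (2 * m + 1) G (1 + y + Complex.I * t)‖ ≤ Q * (|t| + 2) ^ (1 / 2 : ℝ)) →
    ∀ x : ℝ, 3 ≤ x → ∀ N : ℕ, (N : ℝ) ≤ x →
      ‖∑ n ∈ Icc 1 N, f n‖ ≤ C * (1 + Q) * (x / Real.log x ^ m) := by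
  set k := 2 * m + 1 with hk
  obtain ⟨C, hC, h⟩ := norm_log_pow_sum_le m
  set K₀ : ℝ := 4 * (2 ^ (m + 1) * (m + 1).factorial) with hK₀
  have hK₀0 : 0 < K₀ := by positivity
  refine ⟨K₀ + 2 ^ k * 2 * C, by positivity, fun f G Q hQ hf hs hG hb x hx N hN ↦ ?_⟩
  have hS := h f G Q hQ hf hs hG hb x hx
  have hl := one_le_log hx
  have hl0 : 0 < Real.log x := by linarith
  set L := Real.log x with hL
  set w := √x with hw
  have hw1 : 1 < w := by rw [hw, Real.lt_sqrt (by norm_num)]; linarith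
  have hww : w * w = x := Real.mul_self_sqrt (by linarith)
  have hsmall : w * L ≤ 2 ^ (m + 1) * (m + 1).factorial * (x / L ^ m) := by
    have := log_pow_le_mul_sqrt (m + 1) (show 1 ≤ x by linarith)
    rw [← hL, ← hw] at this
    rw [← mul_div_assoc, le_div_iff₀ (by positivity)]
    calc w * L * L ^ m = w * L ^ (m + 1) := by ring
      _ ≤ w * (2 ^ (m + 1) * (m + 1).factorial * w) := by gcongr
      _ = _ := by rw [← hww]; ring
  set N₀ := ⌈w⌉₊ with hN₀
  have hN₀w : w ≤ N₀ := Nat.le_ceil w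
  have hN₀w' : (N₀ : ℝ) ≤ 2 * w := by linarith [Nat.ceil_lt_add_one (show 0 ≤ w by linarith)]
  have htriv : ∀ N' : ℕ, N' ≤ N₀ → (N' : ℝ) ≤ x → ‖∑ n ∈ Icc 1 N', f n‖ ≤ K₀ * (x / L ^ m) := by
    intro N' h1 h1'
    refine (norm_sum_le_of_le _ (f := f) (n := fun _ ↦ 2 * L) fun n hn ↦ ?_).trans ?_
    · rw [mem_Icc] at hn
      have : Real.log n ≤ L := Real.log_le_log (by exact_mod_cast hn.1)
        (le_trans (by exact_mod_cast hn.2) h1')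
      linarith [hf n]
    · rw [sum_const, nsmul_eq_mul, Nat.card_Icc, Nat.add_sub_cancel]
      have h2 : (N' : ℝ) ≤ 2 * w := le_trans (by exact_mod_cast h1) hN₀w'
      calc (N' : ℝ) * (2 * L) ≤ 2 * w * (2 * L) := by gcongr
        _ = 4 * (w * L) := by ring
        _ ≤ 4 * (2 ^ (m + 1) * (m + 1).factorial * (x / L ^ m)) := by gcongr
        _ = _ := by rw [hK₀]; ring
  have hxL : 0 ≤ x / L ^ m := by positivity
  rcases le_total N N₀ with hc | hc
  · refine (htriv N hc hN).trans ?_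
    refine mul_le_mul_of_nonneg_right ?_ hxL
    nlinarith [show 0 ≤ 2 ^ k * 2 * C by positivity, mul_nonneg hK₀0.le hQ,
      mul_nonneg (show 0 ≤ 2 ^ k * 2 * C by positivity) hQ]
  · have hlog : ∀ n : ℕ, N₀ ≤ n → L / 2 ≤ Real.log n := fun n hn ↦ by
      rw [hL, ← Real.log_sqrt (by linarith), ← hw]
      exact Real.log_le_log (by linarith) (hN₀w.trans (by exact_mod_cast hn))
    have hsp : ∀ m', N₀ ≤ m' → ∀ F : ℕ → ℂ,
        ∑ n ∈ Icc 1 m', F n = ∑ n ∈ Icc 1 N₀, F n + ∑ n ∈ Ioc N₀ m', F n := by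
      intro m' hm' F
      rw [← sum_union]
      · refine sum_congr ?_ fun _ _ ↦ rfl
        have : 1 ≤ N₀ := by exact_mod_cast (hw1.le.trans hN₀w)
        ext n; simp only [mem_Icc, mem_union, mem_Ioc]; omega
      · rw [disjoint_left]; intro n; simp only [mem_Icc, mem_Ioc]; omega
    set c : ℕ → ℂ := fun n ↦ ((Real.log n ^ k : ℝ) : ℂ) * f n with hc'
    have hN₀x : (N₀ : ℝ) ≤ x := le_trans (by exact_mod_cast hc) hN
    have hBd : ∀ m', N₀ ≤ m' → m' ≤ N → ‖∑ n ∈ Ioc N₀ m', c n‖ ≤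
        2 * (C * (1 + Q) * (x * L ^ (m + 1))) := by
      intro m' h1 h2
      have e := hsp m' h1 c
      rw [← sub_eq_iff_eq_add'] at e
      rw [← e]
      refine (norm_sub_le _ _).trans ?_
      have := hS m' (le_trans (by exact_mod_cast h2) hN)
      have := hS N₀ hN₀x
      linarith
    have hmain := norm_sum_mul_le_of_antitone (g := fun n : ℕ ↦ (Real.log n ^ k)⁻¹) hc ?_
      (by positivity) hBd
    · have he : ∑ n ∈ Ioc N₀ N, (((Real.log n ^ k)⁻¹ : ℝ) : ℂ) * c n = ∑ n ∈ Ioc N₀ N, f n := by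
        refine sum_congr rfl fun n hn ↦ ?_
        have h1 := hlog n (mem_Ioc.mp hn).1.le
        have h2 : Real.log n ^ k ≠ 0 := (pow_pos (by linarith) k).ne'
        simp only [hc']
        rw [← mul_assoc, ← Complex.ofReal_mul, inv_mul_cancel₀ h2, Complex.ofReal_one, one_mul]
      rw [he] at hmain
      rw [hsp N hc f]
      refine (norm_add_le _ _).trans ((add_le_add (htriv N₀ le_rfl hN₀x) (hmain.trans
        (mul_le_mul_of_nonneg_right (inv_anti₀ (by positivity)
          (pow_le_pow_left₀ (by positivity) (hlog N₀ le_rfl) k)) (by positivity)))).trans ?_)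
      have e : ((L / 2) ^ k)⁻¹ * (2 * (C * (1 + Q) * (x * L ^ (m + 1)))) =
          2 ^ k * 2 * C * (1 + Q) * (x / L ^ m) := by
        rw [hk, div_pow, inv_div]
        field_simp
        ring
      rw [e, ← add_mul]
      refine mul_le_mul_of_nonneg_right ?_ hxL
      nlinarith [mul_nonneg hK₀0.le hQ]
    · intro i hi j hj hij
      have hi' := hlog i hi
      exact inv_anti₀ (pow_pos (by linarith) k) (pow_le_pow_left₀ (by linarith)
        (Real.log_le_log (lt_of_lt_of_le (by linarith) (hN₀w.trans (by exact_mod_cast hi)))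
          (by exact_mod_cast hij)) k)

lemma norm_sum_char_mul_vonMangoldt_le (m : ℕ) : ∃ C : ℝ, 0 < C ∧
    ∀ (q : ℕ) [NeZero q] (χ : DirichletCharacter ℂ q), χ ≠ 1 → ∀ x : ℝ, 3 ≤ x →
      ∀ N : ℕ, (N : ℝ) ≤ x →
        ‖∑ n ∈ Icc 1 N, χ n * (ArithmeticFunction.vonMangoldt n : ℂ)‖ ≤
          C * √q * (x / Real.log x ^ m) := by
  obtain ⟨C₁, hC₁, h₁⟩ := norm_sum_le_of_iteratedDeriv m
  obtain ⟨C₂, hC₂, h₂⟩ := norm_iteratedDeriv_logDeriv_LFunction_le (2 * m + 1)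
    (show (0 : ℝ) < 1 / 2 by norm_num)
  refine ⟨C₁ * (1 + C₂), by positivity, fun q _ χ hχ x hx N hN ↦ ?_⟩
  have hl := one_le_log hx
  have hq : 1 ≤ √(q : ℝ) := by
    rw [Real.one_le_sqrt]; exact_mod_cast Nat.one_le_iff_ne_zero.mpr (NeZero.ne q)
  refine (h₁ (fun n ↦ χ n * (ArithmeticFunction.vonMangoldt n : ℂ))
    (fun s ↦ -logDeriv (DirichletCharacter.LFunction χ) s) (C₂ * √q) (by positivity) ?_ ?_ ?_ ?_
    x hx N hN).trans ?_
  · intro n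
    rw [norm_mul, Complex.norm_real, Real.norm_eq_abs,
      abs_of_nonneg ArithmeticFunction.vonMangoldt_nonneg]
    have h1 := mul_le_mul_of_nonneg_right (χ.norm_le_one n)
      (ArithmeticFunction.vonMangoldt_nonneg (n := n))
    linarith [ArithmeticFunction.vonMangoldt_le_log (n := n)]
  · exact fun s hs ↦ DirichletCharacter.LSeriesSummable_twist_vonMangoldt χ hs
  · intro s hs
    have h1 := DirichletCharacter.LSeries_twist_vonMangoldt_eq χ hs
    have hev : DirichletCharacter.LFunction χ =ᶠ[nhds s] LSeries (fun n ↦ χ n) := by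
      filter_upwards [(isOpen_lt continuous_const Complex.continuous_re).mem_nhds hs]
        with u hu using DirichletCharacter.LFunction_eq_LSeries χ hu
    rw [logDeriv_apply, hev.deriv_eq, hev.eq_of_nhds, ← neg_div]
    exact h1
  · intro y t hy hy1
    have h := h₂ q χ y t hy hy1 (Or.inl hχ)
    have e : iteratedDeriv (2 * m + 1) (fun s ↦ -logDeriv (DirichletCharacter.LFunction χ) s)
        (1 + y + Complex.I * t) = -iteratedDeriv (2 * m + 1)
          (logDeriv (DirichletCharacter.LFunction χ)) (1 + y + Complex.I * t) :=
      iteratedDeriv_fun_neg ..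
    rw [e, norm_neg]
    refine h.trans (le_of_eq ?_)
    rw [cond, Real.mul_rpow (by positivity) (by positivity), ← Real.sqrt_eq_rpow (q : ℝ)]
    ring
  · have h0 : 0 ≤ x / Real.log x ^ m := by positivity
    refine mul_le_mul_of_nonneg_right ?_ h0
    rw [mul_assoc]
    exact mul_le_mul_of_nonneg_left (by nlinarith) hC₁.le

lemma abs_sum_vonMangoldt_sub_le (m : ℕ) : ∃ C : ℝ, 0 < C ∧ ∀ x : ℝ, 3 ≤ x →
    ∀ N : ℕ, (N : ℝ) ≤ x →
      |∑ n ∈ Icc 1 N, ArithmeticFunction.vonMangoldt n - N| ≤ C * (x / Real.log x ^ m) := by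
  obtain ⟨C₁, hC₁, h₁⟩ := norm_sum_le_of_iteratedDeriv m
  obtain ⟨C₂, hC₂, h₂⟩ := norm_iteratedDeriv_zetaDev_le (2 * m + 1)
    (show (0 : ℝ) < 1 / 2 by norm_num)
  refine ⟨C₁ * (1 + C₂), by positivity, fun x hx N hN ↦ ?_⟩
  have key := h₁ ((fun n ↦ (ArithmeticFunction.vonMangoldt n : ℂ)) - 1) zetaDev C₂ hC₂.le
    ?_ ?_ ?_ ?_ x hx N hN
  · have e : ∑ n ∈ Icc 1 N, ((fun n ↦ (ArithmeticFunction.vonMangoldt n : ℂ)) - 1) n =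
        ((∑ n ∈ Icc 1 N, ArithmeticFunction.vonMangoldt n - N : ℝ) : ℂ) := by
      simp [Finset.sum_sub_distrib]
    rwa [e, Complex.norm_real, Real.norm_eq_abs] at key
  · intro n
    simp only [Pi.sub_apply, Pi.one_apply]
    rw [← Complex.ofReal_one, ← Complex.ofReal_sub, Complex.norm_real, Real.norm_eq_abs, abs_le]
    constructor
    · linarith [ArithmeticFunction.vonMangoldt_nonneg (n := n), Real.log_natCast_nonneg n]
    · linarith [ArithmeticFunction.vonMangoldt_le_log (n := n)]
  · exact fun s hs ↦ (ArithmeticFunction.LSeriesSummable_vonMangoldt hs).sub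
      (LSeriesSummable_one_iff.mpr hs)
  · intro s hs
    have h1 := ArithmeticFunction.LSeries_vonMangoldt_eq_deriv_riemannZeta_div hs
    rw [LSeries_sub (ArithmeticFunction.LSeriesSummable_vonMangoldt hs)
      (LSeriesSummable_one_iff.mpr hs), LSeries_one_eq_riemannZeta hs, h1, zetaDev, logDeriv_apply,
      neg_div]
  · intro y t hy hy1
    refine (h₂ y t hy hy1).trans (le_of_eq ?_)
    simp [cond]

lemma card_primeFactors_le_log {n : ℕ} (hn : n ≠ 0) : n.primeFactors.card ≤ Nat.log 2 n := by
  refine Nat.le_log_of_pow_le one_lt_two ?_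
  calc 2 ^ n.primeFactors.card ≤ ∏ p ∈ n.primeFactors, p :=
        Finset.pow_card_le_prod _ _ _ fun p hp ↦ (Nat.prime_of_mem_primeFactors hp).two_le
    _ ≤ n := Nat.le_of_dvd (Nat.pos_of_ne_zero hn) n.prod_primeFactors_dvd

lemma natLog_two_le {n : ℕ} : (Nat.log 2 n : ℝ) ≤ 2 * Real.log n := by
  rcases Nat.eq_zero_or_pos n with rfl | hn
  · simp
  have h1 : (2 : ℝ) ^ Nat.log 2 n ≤ n := by exact_mod_cast Nat.pow_log_le_self 2 hn.ne'
  have h2 := Real.log_le_log (by positivity) h1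
  rw [Real.log_pow] at h2
  nlinarith [Real.log_two_gt_d9, show (0 : ℝ) ≤ Nat.log 2 n by positivity]

lemma card_primeFactors_le {n : ℕ} (hn : n ≠ 0) : (n.primeFactors.card : ℝ) ≤ 2 * Real.log n :=
  le_trans (by exact_mod_cast card_primeFactors_le_log hn) natLog_two_le

lemma sum_vonMangoldt_not_coprime_le {q : ℕ} (hq : q ≠ 0) (N : ℕ) :
    ∑ n ∈ (Icc 1 N).filter (fun n ↦ ¬ n.Coprime q), ArithmeticFunction.vonMangoldt n ≤
      q.primeFactors.card * Real.log N := by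
  set T := q.primeFactors.sigma fun p ↦ Icc 1 (Nat.log p N) with hT
  have h1 : ∑ n ∈ (Icc 1 N).filter (fun n ↦ ¬ n.Coprime q), ArithmeticFunction.vonMangoldt n ≤
      ∑ p ∈ q.primeFactors, ∑ k ∈ Icc 1 (Nat.log p N), Real.log p := by
    calc _ ≤ ∑ n ∈ T.image fun u ↦ u.1 ^ u.2, ArithmeticFunction.vonMangoldt n := by
          rw [← sum_filter_ne_zero]
          refine sum_le_sum_of_subset_of_nonneg (fun n hn ↦ ?_)
            fun _ _ _ ↦ ArithmeticFunction.vonMangoldt_nonneg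
          simp only [mem_filter, mem_Icc] at hn
          obtain ⟨⟨⟨hn1, hnN⟩, hnc⟩, hn0⟩ := hn
          rw [ArithmeticFunction.vonMangoldt_ne_zero_iff, isPrimePow_nat_iff] at hn0
          obtain ⟨p, k, hp, hk, rfl⟩ := hn0
          rw [Nat.coprime_pow_left_iff hk, hp.coprime_iff_not_dvd, not_not] at hnc
          exact mem_image.mpr ⟨⟨p, k⟩, by
            simp only [hT, mem_sigma, mem_Icc, Nat.mem_primeFactors]
            exact ⟨⟨hp, hnc, hq⟩, hk, Nat.le_log_of_pow_le hp.one_lt hnN⟩, rfl⟩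
      _ ≤ ∑ u ∈ T, ArithmeticFunction.vonMangoldt (u.1 ^ u.2) :=
          sum_image_le_of_nonneg fun _ _ ↦ ArithmeticFunction.vonMangoldt_nonneg
      _ = _ := by
          rw [hT, sum_sigma]
          refine sum_congr rfl fun p hp ↦ sum_congr rfl fun k hk ↦ ?_
          rw [mem_Icc] at hk
          rw [ArithmeticFunction.vonMangoldt_apply_pow (show k ≠ 0 by omega),
            ArithmeticFunction.vonMangoldt_apply_prime (Nat.prime_of_mem_primeFactors hp)]
  refine h1.trans ?_
  rw [← nsmul_eq_mul]
  refine sum_le_card_nsmul _ _ _ fun p hp ↦ ?_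
  have hp' := Nat.prime_of_mem_primeFactors hp
  rw [sum_const, nsmul_eq_mul, Nat.card_Icc, Nat.add_sub_cancel]
  rcases Nat.eq_zero_or_pos N with rfl | hN
  · simp
  rw [← Real.log_pow]
  refine Real.log_le_log (by have := hp'.pos; positivity) ?_
  exact_mod_cast Nat.pow_log_le_self p hN.ne'

theorem siegel_walfisz (m : ℕ) : ∃ C : ℝ, 0 < C ∧ ∀ (q : ℕ) [NeZero q] (a : ZMod q), IsUnit a →
    ∀ x : ℝ, 3 ≤ x → ∀ N : ℕ, (N : ℝ) ≤ x →
      |∑ n ∈ (Icc 1 N).filter (fun n : ℕ ↦ a = (n : ZMod q)), ArithmeticFunction.vonMangoldt n -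
        N / q.totient| ≤ C * √q * (x / Real.log x ^ m) := by
  obtain ⟨C₁, hC₁, h₁⟩ := norm_sum_char_mul_vonMangoldt_le m
  obtain ⟨C₂, hC₂, h₂⟩ := abs_sum_vonMangoldt_sub_le m
  refine ⟨C₁ + C₂ + 4 * (m + 1).factorial, by positivity, fun q _ a ha x hx N hN ↦ ?_⟩
  classical
  have hl := one_le_log hx
  have hl0 : 0 < Real.log x := by linarith
  have hq0 : q ≠ 0 := NeZero.ne q
  have hq1 : 1 ≤ √(q : ℝ) := by
    rw [Real.one_le_sqrt]; exact_mod_cast Nat.one_le_iff_ne_zero.mpr hq0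
  have hφ : (1 : ℝ) ≤ q.totient := by
    exact_mod_cast Nat.totient_pos.mpr (Nat.pos_of_ne_zero hq0)
  set Y := x / Real.log x ^ m with hY
  have hY0 : 0 < Y := by have : 0 < x := by linarith
                         positivity
  set S := ∑ n ∈ (Icc 1 N).filter (fun n : ℕ ↦ a = (n : ZMod q)),
    ArithmeticFunction.vonMangoldt n with hS
  set ψ : DirichletCharacter ℂ q → ℂ := fun χ ↦
    ∑ n ∈ Icc 1 N, χ n * (ArithmeticFunction.vonMangoldt n : ℂ) with hψ
  have hid : ∑ χ, χ a⁻¹ * ψ χ = (q.totient : ℂ) * S := by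
    simp only [hψ, mul_sum]
    rw [sum_comm, hS, Complex.ofReal_sum, mul_sum, sum_filter]
    refine sum_congr rfl fun n _ ↦ ?_
    simp_rw [← mul_assoc]
    rw [← sum_mul, DirichletCharacter.sum_char_inv_mul_char_eq ℂ ha]
    split_ifs <;> simp
  have hψ1 : ψ 1 = ((∑ n ∈ Icc 1 N, ArithmeticFunction.vonMangoldt n -
      ∑ n ∈ (Icc 1 N).filter (fun n ↦ ¬ n.Coprime q), ArithmeticFunction.vonMangoldt n : ℝ) : ℂ) := by
    rw [sub_eq_of_eq_add' (sum_filter_not_add_sum_filter (Icc 1 N)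
      (fun n : ℕ ↦ n.Coprime q) ArithmeticFunction.vonMangoldt).symm, Complex.ofReal_sum,
      sum_filter]
    refine sum_congr rfl fun n _ ↦ ?_
    split_ifs with h
    · rw [MulChar.one_apply ((ZMod.isUnit_iff_coprime n q).mpr h), one_mul]
    · rw [MulChar.map_nonunit _ (mt (ZMod.isUnit_iff_coprime n q).mp h), zero_mul]
  have ha' : IsUnit a⁻¹ := by
    obtain ⟨u, rfl⟩ := ha
    rw [ZMod.inv_coe_unit]
    exact u⁻¹.isUnit
  have hE : ((q.totient * S - N : ℝ) : ℂ) =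
      ∑ χ ∈ univ.erase (1 : DirichletCharacter ℂ q), χ a⁻¹ * ψ χ + (ψ 1 - N) := by
    have := add_sum_erase univ (fun χ : DirichletCharacter ℂ q ↦ χ a⁻¹ * ψ χ) (mem_univ 1)
    rw [hid, MulChar.one_apply ha', one_mul] at this
    push_cast
    rw [← this]
    ring
  have hE1 : ‖∑ χ ∈ univ.erase (1 : DirichletCharacter ℂ q), χ a⁻¹ * ψ χ‖ ≤
      q.totient * (C₁ * √q * Y) := by
    refine (norm_sum_le_of_le _ (f := fun χ ↦ χ a⁻¹ * ψ χ) (n := fun _ ↦ C₁ * √q * Y)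
      fun χ hχ ↦ ?_).trans ?_
    · rw [norm_mul]
      exact (mul_le_of_le_one_left (norm_nonneg _) (χ.norm_le_one _)).trans
        (h₁ q χ (ne_of_mem_erase hχ) x hx N hN)
    · rw [sum_const, nsmul_eq_mul]
      refine mul_le_mul_of_nonneg_right ?_ (by positivity)
      rw [← DirichletCharacter.card_eq_totient_of_hasEnoughRootsOfUnity ℂ q,
        Nat.card_eq_fintype_card]
      exact_mod_cast card_le_univ _
  have hE2 : ‖ψ 1 - N‖ ≤ C₂ * Y + 4 * (m + 1).factorial * √q * Y := by
    have hc := sum_vonMangoldt_not_coprime_le hq0 N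
    have hc0 : 0 ≤ ∑ n ∈ (Icc 1 N).filter (fun n ↦ ¬ n.Coprime q),
      ArithmeticFunction.vonMangoldt n := sum_nonneg fun _ _ ↦ ArithmeticFunction.vonMangoldt_nonneg
    have hm := h₂ x hx N hN
    have hω : (q.primeFactors.card : ℝ) * Real.log N ≤ 4 * (m + 1).factorial * √q * Y := by
      have h1 : Real.log q ≤ 2 * √q := by
        have := Real.log_le_self (Real.sqrt_nonneg (q : ℝ))
        rw [Real.log_sqrt (Nat.cast_nonneg q)] at this
        linarith
      have h2 := card_primeFactors_le hq0
      have h3 : Real.log N ≤ Real.log x := by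
        rcases Nat.eq_zero_or_pos N with rfl | h
        · simp; linarith
        · exact Real.log_le_log (by exact_mod_cast h) hN
      have h4 : Real.log x ≤ (m + 1).factorial * Y := by
        rw [hY, ← mul_div_assoc, le_div_iff₀ (by positivity), ← pow_succ']
        exact log_pow_le_mul (m + 1) (by linarith)
      calc _ ≤ (4 * √(q : ℝ)) * ((m + 1).factorial * Y) := by
            refine mul_le_mul (by linarith) (h3.trans h4) (Real.log_natCast_nonneg N) (by positivity)
        _ = _ := by ring
    rw [hψ1, ← Complex.ofReal_natCast, ← Complex.ofReal_sub, Complex.norm_real, Real.norm_eq_abs,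
      sub_right_comm]
    refine (abs_sub _ _).trans ?_
    rw [abs_of_nonneg hc0]
    linarith
  have hfin : |(q.totient * S - N : ℝ)| ≤ q.totient * ((C₁ + C₂ + 4 * (m + 1).factorial) * √q * Y) := by
    rw [← Real.norm_eq_abs, ← Complex.norm_real, hE]
    refine (norm_add_le _ _).trans ((add_le_add hE1 hE2).trans ?_)
    have e1 : C₂ * Y ≤ q.totient * (C₂ * √q * Y) := by
      have : 1 ≤ q.totient * √(q : ℝ) := one_le_mul_of_one_le_of_one_le hφ hq1
      nlinarith [mul_pos hC₂ hY0]
    have e2 : 4 * (m + 1).factorial * √q * Y ≤ q.totient * (4 * (m + 1).factorial * √q * Y) :=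
      le_mul_of_one_le_left (by positivity) hφ
    linarith
  have hφ0 : (0 : ℝ) < q.totient := by linarith
  rw [show S - N / q.totient = (q.totient * S - N) / q.totient by field_simp, abs_div,
    abs_of_pos hφ0, div_le_iff₀ hφ0]
  linarith

lemma toNat_add_mul_cast {a : ℤ} {s q : ℕ} (hs : 1 ≤ s) (hq : a.natAbs ≤ q) :
    (((a + q * s).toNat : ℕ) : ℤ) = a + q * s := by
  refine Int.toNat_of_nonneg ?_
  have : (q : ℤ) ≤ q * s := le_mul_of_one_le_right (by positivity) (by exact_mod_cast hs)
  omega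

lemma toNat_add_mul_injOn {a : ℤ} {s Q : ℕ} (hs : 1 ≤ s) (hQ : a.natAbs ≤ Q) (U : ℕ) :
    Set.InjOn (fun q : ℕ ↦ (a + q * s).toNat) (Ioc Q U) := by
  intro q hq q' hq' h
  rw [coe_Ioc, Set.mem_Ioc] at hq hq'
  have h1 := toNat_add_mul_cast hs (a := a) (q := q) (by omega)
  have h2 := toNat_add_mul_cast hs (a := a) (q := q') (by omega)
  simp only at h
  rw [h, h2] at h1
  have h3 : (q' : ℤ) * s = q * s := by linarith
  have hs0 : (s : ℤ) ≠ 0 := by positivity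
  exact_mod_cast (mul_right_cancel₀ hs0 h3).symm

lemma toNat_add_mul_le {a : ℤ} {s Q U q : ℕ} {x : ℝ} (hs : 1 ≤ s) (hQ : a.natAbs ≤ Q)
    (hU : (a : ℝ) + U * s ≤ x) (hq : Q ≤ q) (hqU : q ≤ U) :
    (((a + q * s).toNat : ℕ) : ℝ) ≤ x := by
  have h1 := toNat_add_mul_cast hs (a := a) (q := q) (by omega)
  have h2 : (((a + q * s).toNat : ℕ) : ℝ) = a + q * s := by exact_mod_cast h1
  rw [h2]
  have : (q : ℝ) * s ≤ U * s := by gcongr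
  linarith

lemma sum_vonMangoldt_toNat_not_coprime_le {a : ℤ} (ha : a ≠ 0) {s Q U : ℕ} {x : ℝ} (hx : 3 ≤ x)
    (hax : |(a : ℝ)| ≤ x) (hs : 1 ≤ s) (hQ : a.natAbs ≤ Q) (hU : (a : ℝ) + U * s ≤ x)
    {T : Finset ℕ} (hT : T ⊆ Ioc Q U)
    (hTc : ∀ q ∈ T, ¬ ((a + q * s).toNat).Coprime a.natAbs) :
    ∑ q ∈ T, ArithmeticFunction.vonMangoldt (a + q * s).toNat ≤ 2 * Real.log x ^ 2 := by
  have hl := one_le_log hx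
  have hinj := (toNat_add_mul_injOn hs hQ U).mono (coe_subset.mpr hT)
  rw [← sum_image (f := fun n ↦ ArithmeticFunction.vonMangoldt n) hinj]
  have ha' : a.natAbs ≠ 0 := Int.natAbs_ne_zero.mpr ha
  have hx0 : 0 ≤ x := by linarith
  calc _ ≤ ∑ n ∈ (Icc 1 ⌊x⌋₊).filter (fun n ↦ ¬ n.Coprime a.natAbs),
        ArithmeticFunction.vonMangoldt n := by
        rw [← sum_filter_ne_zero]
        refine sum_le_sum_of_subset_of_nonneg (fun n hn ↦ ?_)
          fun _ _ _ ↦ ArithmeticFunction.vonMangoldt_nonneg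
        obtain ⟨hn, hn0⟩ := mem_filter.mp hn
        obtain ⟨q, hq, rfl⟩ := mem_image.mp hn
        have hq' := mem_Ioc.mp (hT hq)
        rw [mem_filter, mem_Icc, Nat.le_floor_iff hx0]
        refine ⟨⟨?_, toNat_add_mul_le hs hQ hU hq'.1.le hq'.2⟩, hTc q hq⟩
        rw [Nat.one_le_iff_ne_zero]
        intro h0
        rw [h0] at hn0
        simp at hn0
    _ ≤ a.natAbs.primeFactors.card * Real.log ⌊x⌋₊ := sum_vonMangoldt_not_coprime_le ha' _
    _ ≤ (2 * Real.log x) * Real.log x := by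
        have h1 : (a.natAbs : ℝ) ≤ x := by rwa [Nat.cast_natAbs, Int.cast_abs]
        have h2 : Real.log a.natAbs ≤ Real.log x :=
          Real.log_le_log (by exact_mod_cast Nat.pos_of_ne_zero ha') h1
        have h3 : Real.log ⌊x⌋₊ ≤ Real.log x :=
          Real.log_le_log (by exact_mod_cast Nat.floor_pos.mpr (by linarith)) (Nat.floor_le hx0)
        refine mul_le_mul ((card_primeFactors_le ha').trans (by linarith)) h3
          (Real.log_natCast_nonneg _) (by linarith)
    _ = _ := by ring

lemma sum_vonMangoldt_toNat_eq {a : ℤ} {s Q U : ℕ} (hs : 1 ≤ s) (hQ : a.natAbs ≤ Q)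
    (hQU : Q ≤ U) :
    ∑ q ∈ Ioc Q U, ArithmeticFunction.vonMangoldt (a + q * s).toNat =
      ∑ n ∈ (Icc 1 (a + U * s).toNat).filter (fun n : ℕ ↦ (a : ZMod s) = (n : ZMod s)),
        ArithmeticFunction.vonMangoldt n -
      ∑ n ∈ (Icc 1 (a + Q * s).toNat).filter (fun n : ℕ ↦ (a : ZMod s) = (n : ZMod s)),
        ArithmeticFunction.vonMangoldt n := by
  have hcU := toNat_add_mul_cast hs (a := a) (q := U) (by omega)
  have hcQ := toNat_add_mul_cast hs (a := a) (q := Q) hQ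
  have hle : (a + Q * s).toNat ≤ (a + U * s).toNat := by
    refine Int.toNat_le_toNat ?_
    gcongr
  have hsplit : (Icc 1 (a + U * s).toNat).filter (fun n : ℕ ↦ (a : ZMod s) = (n : ZMod s)) =
      (Icc 1 (a + Q * s).toNat).filter (fun n : ℕ ↦ (a : ZMod s) = (n : ZMod s)) ∪
      (Ioc (a + Q * s).toNat (a + U * s).toNat).filter
        (fun n : ℕ ↦ (a : ZMod s) = (n : ZMod s)) := by
    rw [← filter_union]
    congr 1
    ext n; simp only [mem_Icc, mem_union, mem_Ioc]; omega
  rw [hsplit, sum_union, add_sub_cancel_left]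
  · rw [← sum_image (f := fun n ↦ ArithmeticFunction.vonMangoldt n)
      (toNat_add_mul_injOn hs hQ U)]
    refine sum_congr ?_ fun _ _ ↦ rfl
    ext n
    rw [mem_image, mem_filter, mem_Ioc]
    have hs0 : (0 : ℤ) < s := by exact_mod_cast hs
    constructor
    · rintro ⟨q, hq, rfl⟩
      rw [mem_Ioc] at hq
      have hcq := toNat_add_mul_cast hs (a := a) (q := q) (by omega)
      refine ⟨⟨?_, ?_⟩, ?_⟩
      · zify; rw [hcQ, hcq]; gcongr; exact hq.1
      · zify; rw [hcU, hcq]; gcongr; exact hq.2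
      · have := congrArg (Int.cast : ℤ → ZMod s) hcq
        push_cast at this
        rw [this]
        simp
    · rintro ⟨⟨h1, h2⟩, h3⟩
      have h4 : (s : ℤ) ∣ n - a := by
        rw [← ZMod.intCast_zmod_eq_zero_iff_dvd]
        push_cast
        rw [h3, sub_self]
      obtain ⟨k, hk⟩ := h4
      zify at h1 h2
      rw [hcQ] at h1
      rw [hcU] at h2
      have hk1 : (Q : ℤ) < k := by
        by_contra! h
        have := mul_le_mul_of_nonneg_right h hs0.le
        linarith
      have hk2 : k ≤ U := by
        by_contra! h
        have := mul_lt_mul_of_pos_right h hs0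
        linarith
      lift k to ℕ using by omega
      refine ⟨k, mem_Ioc.mpr ⟨by omega, by omega⟩, ?_⟩
      have := toNat_add_mul_cast hs (a := a) (q := k) (by omega)
      zify
      rw [this]
      linarith
  · refine disjoint_filter_filter ?_
    rw [disjoint_left]; intro n; simp only [mem_Icc, mem_Ioc]; omega

theorem abs_sum_vonMangoldt_coprime_sub_le (P : ℕ) : ∃ K : ℝ, 0 < K ∧ ∀ x : ℝ, 3 ≤ x →
    ∀ a : ℤ, a ≠ 0 → |(a : ℝ)| ≤ x → ∀ s Q U : ℕ, 1 ≤ s → a.natAbs ≤ Q → Q ≤ U →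
      (a : ℝ) + U * s ≤ x →
      |∑ q ∈ (Ioc Q U).filter (fun q : ℕ ↦ Int.gcd (q : ℤ) a = 1),
          ArithmeticFunction.vonMangoldt (a + q * s).toNat -
        if s.Coprime a.natAbs then (s : ℝ) / s.totient * (U - Q) else 0| ≤
      K * s * (x / Real.log x ^ P) := by
  obtain ⟨C, hC, hSW⟩ := siegel_walfisz P
  refine ⟨2 * C + 2 * (P + 2).factorial, by positivity,
    fun x hx a ha hax s Q U hs hQ hQU hU ↦ ?_⟩
  have hl := one_le_log hx
  set Y := x / Real.log x ^ P with hY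
  have hY0 : 0 < Y := by have : 0 < x := by linarith
                         positivity
  have hs1 : (1 : ℝ) ≤ s := by exact_mod_cast hs
  have hL : 2 * Real.log x ^ 2 ≤ 2 * (P + 2).factorial * s * Y := by
    have : Real.log x ^ 2 ≤ (P + 2).factorial * Y := by
      rw [hY, ← mul_div_assoc, le_div_iff₀ (by positivity), ← pow_add, add_comm 2]
      exact log_pow_le_mul (P + 2) (by linarith)
    have h2 : (P + 2).factorial * Y ≤ s * ((P + 2).factorial * Y) :=
      le_mul_of_one_le_left (by positivity) hs1
    linarith
  have hgcd : ∀ q : ℕ, Q < q → Nat.gcd (a + q * s).toNat a.natAbs =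
      Int.gcd ((q : ℤ) * s) a := by
    intro q hq
    have h1 := toNat_add_mul_cast hs (a := a) (q := q) (by omega)
    have h2 : Nat.gcd (a + q * s).toNat a.natAbs = Int.gcd ((a + q * s).toNat : ℤ) a := rfl
    rw [h2, h1, Int.gcd_self_add_left]
  have hnn : ∀ T : Finset ℕ, 0 ≤ ∑ q ∈ T, ArithmeticFunction.vonMangoldt (a + q * s).toNat :=
    fun T ↦ sum_nonneg fun _ _ ↦ ArithmeticFunction.vonMangoldt_nonneg
  split_ifs with hsa
  · have hbad := sum_vonMangoldt_toNat_not_coprime_le ha hx hax hs hQ hU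
      (T := (Ioc Q U).filter (fun q : ℕ ↦ ¬ Int.gcd (q : ℤ) a = 1)) (filter_subset _ _) ?_
    · have hsp := sum_filter_add_sum_filter_not (Ioc Q U) (fun q : ℕ ↦ Int.gcd (q : ℤ) a = 1)
        (fun q ↦ ArithmeticFunction.vonMangoldt (a + q * s).toNat)
      have hall := sum_vonMangoldt_toNat_eq hs hQ hQU
      have : NeZero s := ⟨by omega⟩
      have hu : IsUnit (a : ZMod s) := by
        rw [ZMod.coe_int_isUnit_iff_isCoprime, Int.isCoprime_iff_gcd_eq_one]
        exact hsa
      have h1 := hSW s a hu x hx (a + U * s).toNat (toNat_add_mul_le hs hQ hU hQU le_rfl)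
      have h2 := hSW s a hu x hx (a + Q * s).toNat (toNat_add_mul_le hs hQ hU le_rfl hQU)
      have c1 : (((a + U * s).toNat : ℕ) : ℝ) = a + U * s := by
        exact_mod_cast toNat_add_mul_cast hs (a := a) (q := U) (by omega)
      have c2 : (((a + Q * s).toNat : ℕ) : ℝ) = a + Q * s := by
        exact_mod_cast toNat_add_mul_cast hs (a := a) (q := Q) hQ
      rw [c1] at h1
      rw [c2] at h2
      have hm : (s : ℝ) / s.totient * (U - Q) =
          (a + U * s) / s.totient - (a + Q * s) / s.totient := by ring
      have hsq : C * √(s : ℝ) * Y ≤ C * s * Y := by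
        have : √(s : ℝ) ≤ s := Real.sqrt_le_iff.mpr ⟨by linarith, by nlinarith⟩
        gcongr
      have := hnn ((Ioc Q U).filter (fun q : ℕ ↦ ¬ Int.gcd (q : ℤ) a = 1))
      rw [hm, abs_le] at *
      constructor <;> linarith
    · intro q hq h
      rw [mem_filter, mem_Ioc] at hq
      rw [Nat.Coprime, hgcd q hq.1.1] at h
      exact hq.2 (Nat.eq_one_of_dvd_one (h ▸ Int.gcd_dvd_gcd_mul_right_left ..))
  · have hbad := sum_vonMangoldt_toNat_not_coprime_le ha hx hax hs hQ hU
      (T := (Ioc Q U).filter (fun q : ℕ ↦ Int.gcd (q : ℤ) a = 1)) (filter_subset _ _) ?_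
    · rw [sub_zero, abs_of_nonneg (hnn _)]
      have : 0 ≤ 2 * C * s * Y := by positivity
      linarith
    · intro q hq h
      rw [mem_filter, mem_Ioc] at hq
      rw [Nat.Coprime, hgcd q hq.1.1] at h
      exact hsa (Nat.eq_one_of_dvd_one (h ▸ Int.gcd_dvd_gcd_mul_left_left ..))

/-- The arithmetic function with given nonzero values. -/
noncomputable def arithOf (f : ℕ → ℝ) : ArithmeticFunction ℝ :=
  ⟨fun n ↦ if n = 0 then 0 else f n, by simp⟩

lemma arithOf_apply {f : ℕ → ℝ} {n : ℕ} (hn : n ≠ 0) : arithOf f n = f n := by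
  simp [arithOf, hn]

lemma arithOf_isMultiplicative {f : ℕ → ℝ} (h1 : f 1 = 1)
    (hm : ∀ m n : ℕ, m.Coprime n → f (m * n) = f m * f n) : (arithOf f).IsMultiplicative := by
  rw [ArithmeticFunction.IsMultiplicative.iff_ne_zero]
  refine ⟨by rw [arithOf_apply one_ne_zero, h1], fun {m n} hm0 hn0 hmn ↦ ?_⟩
  rw [arithOf_apply (mul_ne_zero hm0 hn0), arithOf_apply hm0, arithOf_apply hn0, hm m n hmn]

lemma prod_one_sub_eq_sum_divisors {f : ℕ → ℝ} (h1 : f 1 = 1)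
    (hm : ∀ m n : ℕ, m.Coprime n → f (m * n) = f m * f n) {r : ℕ} (hr : Squarefree r) :
    ∏ p ∈ r.primeFactors, (1 - f p) =
      ∑ d ∈ r.divisors, (ArithmeticFunction.moebius d : ℝ) * f d := by
  have := ArithmeticFunction.IsMultiplicative.prodPrimeFactors_one_sub_of_squarefree
    (arithOf f) (arithOf_isMultiplicative h1 hm) hr
  rw [prod_congr rfl fun p hp ↦ by
    rw [← arithOf_apply (f := f) (Nat.prime_of_mem_primeFactors hp).ne_zero], this]
  exact sum_congr rfl fun d hd ↦ by rw [arithOf_apply (Nat.pos_of_mem_divisors hd).ne']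

lemma prod_one_add_eq_sum_divisors {f : ℕ → ℝ} (h1 : f 1 = 1)
    (hm : ∀ m n : ℕ, m.Coprime n → f (m * n) = f m * f n) {r : ℕ} (hr : Squarefree r) :
    ∏ p ∈ r.primeFactors, (1 + f p) = ∑ d ∈ r.divisors, f d := by
  have := (arithOf_isMultiplicative h1 hm).prodPrimeFactors_one_add_of_squarefree hr
  rw [prod_congr rfl fun p hp ↦ by
    rw [← arithOf_apply (f := f) (Nat.prime_of_mem_primeFactors hp).ne_zero], this]
  exact sum_congr rfl fun d hd ↦ by rw [arithOf_apply (Nat.pos_of_mem_divisors hd).ne']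

lemma mul_dvd_iff_of_coprime {u v n : ℕ} (h : u.Coprime v) : u * v ∣ n ↔ u ∣ n ∧ v ∣ n :=
  ⟨fun hd ↦ ⟨dvd_of_mul_right_dvd hd, dvd_of_mul_left_dvd hd⟩,
    fun hd ↦ h.mul_dvd_of_dvd_of_dvd hd.1 hd.2⟩

/-- `μ((r,n)) φ((r,n))`, the numerator of the `r`-th term of `FR`. -/
noncomputable def gcdWeight (r : ℕ) (n : ℤ) : ℝ :=
  (ArithmeticFunction.moebius (Int.gcd (r : ℤ) n) : ℝ) * (Nat.totient (Int.gcd (r : ℤ) n) : ℝ)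

lemma gcdWeight_one (n : ℤ) : gcdWeight 1 n = 1 := by simp [gcdWeight]

lemma gcdWeight_mul (n : ℤ) (u v : ℕ) (h : u.Coprime v) :
    gcdWeight (u * v) n = gcdWeight u n * gcdWeight v n := by
  have hg : Int.gcd ((u * v : ℕ) : ℤ) n = Int.gcd u n * Int.gcd v n := by
    simp only [Int.gcd, Int.natAbs_natCast]
    exact Nat.Coprime.mul_gcd h n.natAbs
  have hc : (Int.gcd u n).Coprime (Int.gcd v n) := by
    simp only [Int.gcd, Int.natAbs_natCast]
    exact Nat.Coprime.coprime_dvd_left (Nat.gcd_dvd_left _ _)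
      (h.coprime_dvd_right (Nat.gcd_dvd_left _ _))
  unfold gcdWeight
  rw [hg, ArithmeticFunction.isMultiplicative_moebius.map_mul_of_coprime hc,
    Nat.totient_mul hc]
  push_cast
  ring

lemma gcdWeight_prime {p : ℕ} (hp : p.Prime) (n : ℤ) :
    gcdWeight p n = 1 - if (p : ℤ) ∣ n then (p : ℝ) else 0 := by
  unfold gcdWeight
  have hg : Int.gcd p n = Nat.gcd p n.natAbs := by simp [Int.gcd]
  rw [hg]
  split_ifs with h
  · rw [Nat.gcd_eq_left (Int.natCast_dvd.mp h), ArithmeticFunction.moebius_apply_prime hp,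
      Nat.totient_prime hp, Nat.cast_sub hp.one_le]
    push_cast
    ring
  · rw [(hp.coprime_iff_not_dvd.mpr (fun h' ↦ h (Int.natCast_dvd.mpr h'))).gcd_eq_one]
    simp

lemma gcdWeight_eq_prod {r : ℕ} (hr : Squarefree r) (n : ℤ) :
    gcdWeight r n = ∏ p ∈ r.primeFactors, (1 - if (p : ℤ) ∣ n then (p : ℝ) else 0) := by
  have hM := arithOf_isMultiplicative (f := fun u ↦ gcdWeight u n) (gcdWeight_one n)
    (gcdWeight_mul n)
  have h := hM.map_prod_of_prime r.primeFactors fun p hp ↦ Nat.prime_of_mem_primeFactors hp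
  rw [Nat.prod_primeFactors_of_squarefree hr, arithOf_apply hr.ne_zero] at h
  rw [h]
  refine prod_congr rfl fun p hp ↦ ?_
  have := Nat.prime_of_mem_primeFactors hp
  rw [arithOf_apply this.ne_zero, gcdWeight_prime this]

lemma gcdWeight_eq_sum {r : ℕ} (hr : Squarefree r) (n : ℤ) :
    gcdWeight r n = ∑ e ∈ r.divisors,
      (ArithmeticFunction.moebius e : ℝ) * if (e : ℤ) ∣ n then (e : ℝ) else 0 := by
  rw [gcdWeight_eq_prod hr, prod_one_sub_eq_sum_divisors (f := fun e : ℕ ↦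
    if (e : ℤ) ∣ n then (e : ℝ) else 0) (by simp) ?_ hr]
  intro u v huv
  have : ((u * v : ℕ) : ℤ) ∣ n ↔ (u : ℤ) ∣ n ∧ (v : ℤ) ∣ n := by
    simp only [Int.natCast_dvd]
    exact mul_dvd_iff_of_coprime huv
  simp only [this]
  split_ifs <;> simp_all

lemma sum_moebius_gcd {r : ℕ} (hr : Squarefree r) (t : ℕ) (a : ℤ) :
    ∑ e ∈ r.divisors, (ArithmeticFunction.moebius e : ℝ) *
      (if ((e.gcd t : ℕ) : ℤ) ∣ a then ((e.gcd t : ℕ) : ℝ) else 0) =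
      if r ∣ t then gcdWeight r a else 0 := by
  rw [← prod_one_sub_eq_sum_divisors (f := fun e : ℕ ↦
    if ((e.gcd t : ℕ) : ℤ) ∣ a then ((e.gcd t : ℕ) : ℝ) else 0) (by simp) ?_ hr]
  · split_ifs with h
    · rw [gcdWeight_eq_prod hr]
      refine prod_congr rfl fun p hp ↦ ?_
      rw [Nat.gcd_eq_left ((Nat.dvd_of_mem_primeFactors hp).trans h)]
    · obtain ⟨p, hp, hpt⟩ : ∃ p ∈ r.primeFactors, ¬ p ∣ t := by
        by_contra! hall
        apply h
        rw [← Nat.prod_primeFactors_of_squarefree hr]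
        exact Finset.prod_primes_dvd t (fun p hp ↦ (Nat.prime_of_mem_primeFactors hp).prime) hall
      refine prod_eq_zero hp ?_
      rw [((Nat.prime_of_mem_primeFactors hp).coprime_iff_not_dvd.mpr hpt).gcd_eq_one]
      simp
  · intro u v huv
    have hg : (u * v).gcd t = u.gcd t * v.gcd t := Nat.Coprime.mul_gcd huv t
    have hc : (u.gcd t).Coprime (v.gcd t) :=
      Nat.Coprime.coprime_dvd_left (Nat.gcd_dvd_left _ _)
        (huv.coprime_dvd_right (Nat.gcd_dvd_left _ _))
    have : ((u.gcd t * v.gcd t : ℕ) : ℤ) ∣ a ↔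
        ((u.gcd t : ℕ) : ℤ) ∣ a ∧ ((v.gcd t : ℕ) : ℤ) ∣ a := by
      simp only [Int.natCast_dvd]
      exact mul_dvd_iff_of_coprime hc
    simp only [hg, this]
    split_ifs <;> simp_all

lemma abs_card_dvd_sub_le {e t V W : ℕ} (he : e ≠ 0) (hVW : V ≤ W) (a : ℤ) :
    |(((Ioc V W).filter fun q : ℕ ↦ (e : ℤ) ∣ a + t * q).card : ℝ) -
      (if ((e.gcd t : ℕ) : ℤ) ∣ a then ((e.gcd t : ℕ) : ℝ) else 0) / e * (W - V)| ≤ 1 := by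
  set g := e.gcd t with hg
  have hg0 : 0 < g := Nat.gcd_pos_of_pos_left _ (Nat.pos_of_ne_zero he)
  split_ifs with h
  · obtain ⟨b, hb⟩ := h
    obtain ⟨e', t', hco, he', ht'⟩ := Nat.exists_coprime e t
    rw [← hg] at he' ht'
    have he'0 : 0 < e' := by
      rcases Nat.eq_zero_or_pos e' with h | h
      · rw [h] at he'; simp at he'; omega
      · exact h
    obtain ⟨v, hv⟩ : ∃ v : ℕ, (e' : ℤ) ∣ b + t' * v := by
      have hu : IsUnit (t' : ZMod e') := (ZMod.isUnit_iff_coprime _ _).mpr hco.symm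
      obtain ⟨u, hu⟩ := hu
      have : NeZero e' := ⟨he'0.ne'⟩
      refine ⟨(-(b : ZMod e') * ((u⁻¹ : (ZMod e')ˣ) : ZMod e')).val, ?_⟩
      rw [← ZMod.intCast_zmod_eq_zero_iff_dvd]
      push_cast
      rw [ZMod.natCast_zmod_val, ← hu]
      have : (u : ZMod e') * (-(b : ZMod e') * ((u⁻¹ : (ZMod e')ˣ) : ZMod e')) = -b := by
        rw [mul_comm, mul_assoc, Units.inv_mul, mul_one]
      rw [this, add_neg_cancel]
    have hiff : ∀ q : ℕ, (e : ℤ) ∣ a + t * q ↔ q ≡ v [MOD e'] := by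
      intro q
      have hgz : (g : ℤ) ≠ 0 := by positivity
      have e1 : a + t * q = g * (b + t' * q) := by
        rw [hb, ht']; push_cast; ring
      rw [e1, he']
      push_cast
      rw [mul_comm (e' : ℤ), mul_dvd_mul_iff_left hgz]
      have e2 : b + t' * (q : ℤ) = (b + t' * v) + t' * ((q : ℤ) - v) := by ring
      rw [e2, dvd_add_right hv, Nat.ModEq.comm, Nat.modEq_iff_dvd]
      refine ⟨fun hd ↦ ?_, fun hd ↦ hd.mul_left _⟩
      exact (Nat.Coprime.isCoprime hco).dvd_of_dvd_mul_left hd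
    rw [filter_congr fun q _ ↦ hiff q]
    have hcard := Nat.Ioc_filter_modEq_card V W he'0 v
    have hle : (⌊((V : ℚ) - v) / e'⌋ : ℤ) ≤ ⌊((W : ℚ) - v) / e'⌋ := by
      gcongr
    rw [max_eq_left (by simpa using hle)] at hcard
    have hcard' : (((Ioc V W).filter fun q ↦ q ≡ v [MOD e']).card : ℝ) =
        (⌊((W : ℚ) - v) / e'⌋ : ℝ) - (⌊((V : ℚ) - v) / e'⌋ : ℝ) := by exact_mod_cast hcard
    rw [hcard']
    have hgr : (g : ℝ) / e = 1 / e' := by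
      have : (e : ℝ) = e' * g := by exact_mod_cast he'
      rw [this]
      have : (g : ℝ) ≠ 0 := by positivity
      have : (e' : ℝ) ≠ 0 := by positivity
      field_simp
    rw [hgr]
    have f1 : ((⌊((W : ℚ) - v) / e'⌋ : ℤ) : ℝ) ≤ ((W : ℝ) - v) / e' := by
      have := Int.floor_le (((W : ℚ) - v) / e'); exact_mod_cast (Rat.cast_le (K := ℝ)).mpr this
    have f2 : ((W : ℝ) - v) / e' < ((⌊((W : ℚ) - v) / e'⌋ : ℤ) : ℝ) + 1 := by
      have := Int.lt_floor_add_one (((W : ℚ) - v) / e')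
      exact_mod_cast (Rat.cast_lt (K := ℝ)).mpr this
    have f3 : ((⌊((V : ℚ) - v) / e'⌋ : ℤ) : ℝ) ≤ ((V : ℝ) - v) / e' := by
      have := Int.floor_le (((V : ℚ) - v) / e'); exact_mod_cast (Rat.cast_le (K := ℝ)).mpr this
    have f4 : ((V : ℝ) - v) / e' < ((⌊((V : ℚ) - v) / e'⌋ : ℤ) : ℝ) + 1 := by
      have := Int.lt_floor_add_one (((V : ℚ) - v) / e')
      exact_mod_cast (Rat.cast_lt (K := ℝ)).mpr this
    have e3 : 1 / (e' : ℝ) * (W - V) = ((W : ℝ) - v) / e' - ((V : ℝ) - v) / e' := by ring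
    rw [e3, abs_le]
    constructor <;> linarith
  · rw [filter_eq_empty_iff.mpr, card_empty]
    · simp
    · intro q _ hd
      apply h
      have h1 : ((g : ℕ) : ℤ) ∣ a + t * q :=
        (Int.natCast_dvd_natCast.mpr (Nat.gcd_dvd_left e t)).trans hd
      have h2 : ((g : ℕ) : ℤ) ∣ (t : ℤ) * q :=
        (Int.natCast_dvd_natCast.mpr (Nat.gcd_dvd_right e t)).mul_right _
      exact (dvd_add_left h2).mp h1

lemma abs_sum_gcdWeight_sub_le {r t V W : ℕ} (hr : Squarefree r) (hVW : V ≤ W) (a : ℤ) :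
    |∑ q ∈ Ioc V W, gcdWeight r (a + t * q) -
      (if r ∣ t then gcdWeight r a else 0) * ((W : ℝ) - V)| ≤ ∑ e ∈ r.divisors, (e : ℝ) := by
  simp_rw [gcdWeight_eq_sum hr (_ + _)]
  rw [sum_comm, ← sum_moebius_gcd hr t a, sum_mul, ← sum_sub_distrib]
  refine (abs_sum_le_sum_abs _ _).trans (sum_le_sum fun e he ↦ ?_)
  have he0 := (Nat.pos_of_mem_divisors he).ne'
  have he0' : (e : ℝ) ≠ 0 := by exact_mod_cast he0
  have h := abs_card_dvd_sub_le (t := t) he0 hVW a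
  rw [← mul_sum, ← sum_filter, sum_const, nsmul_eq_mul]
  set c := (((Ioc V W).filter fun q : ℕ ↦ (e : ℤ) ∣ a + t * q).card : ℝ)
  set G := (if ((e.gcd t : ℕ) : ℤ) ∣ a then ((e.gcd t : ℕ) : ℝ) else 0)
  have e1 : (ArithmeticFunction.moebius e : ℝ) * (c * e) -
      (ArithmeticFunction.moebius e : ℝ) * G * ((W : ℝ) - V) =
      (ArithmeticFunction.moebius e : ℝ) * e * (c - G / e * (W - V)) := by
    field_simp
  rw [e1, abs_mul, abs_mul, Nat.abs_cast]
  have hmu : |(ArithmeticFunction.moebius e : ℝ)| ≤ 1 := by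
    exact_mod_cast ArithmeticFunction.abs_moebius_le_one
  calc _ ≤ 1 * (e : ℝ) * 1 := by gcongr
    _ = e := by ring

lemma squarefree_prod_primeFactors (t : ℕ) : Squarefree (∏ p ∈ t.primeFactors, p) := by
  refine Finset.squarefree_prod_of_pairwise_isCoprime (fun p hp q hq hpq ↦ ?_)
    fun p hp ↦ (Nat.prime_of_mem_primeFactors hp).prime.squarefree
  exact Nat.coprime_iff_isRelPrime.mp <| (Nat.coprime_primes (Nat.prime_of_mem_primeFactors hp)
    (Nat.prime_of_mem_primeFactors hq)).mpr hpq

lemma divisors_filter_squarefree {t : ℕ} (ht : t ≠ 0) :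
    t.divisors.filter Squarefree = (∏ p ∈ t.primeFactors, p).divisors := by
  ext r
  rw [mem_filter, Nat.mem_divisors, Nat.mem_divisors]
  constructor
  · rintro ⟨⟨h1, -⟩, h2⟩
    refine ⟨?_, (squarefree_prod_primeFactors t).ne_zero⟩
    rw [← Nat.prod_primeFactors_of_squarefree h2]
    exact Finset.prod_dvd_prod_of_subset _ _ _ (Nat.primeFactors_mono h1 ht)
  · rintro ⟨h1, -⟩
    exact ⟨⟨h1.trans (Nat.prod_primeFactors_dvd t), ht⟩,
      (squarefree_prod_primeFactors t).squarefree_of_dvd h1⟩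

lemma moebius_sq_eq (r : ℕ) :
    (ArithmeticFunction.moebius r : ℝ) ^ 2 = if Squarefree r then 1 else 0 := by
  exact_mod_cast ArithmeticFunction.moebius_sq (n := r)

lemma prod_div_eq_div_totient {t : ℕ} (ht : t ≠ 0) :
    ∏ p ∈ t.primeFactors, ((p : ℝ) / (p - 1)) = (t : ℝ) / t.totient := by
  have h := Nat.totient_eq_mul_prod_factors t
  have h' : (t.totient : ℝ) = t * ∏ p ∈ t.primeFactors, (1 - (p : ℝ)⁻¹) := by
    have h2 := congrArg (Rat.cast : ℚ → ℝ) h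
    push_cast at h2
    exact h2
  have ht' : (t : ℝ) ≠ 0 := by exact_mod_cast ht
  rw [h', ← div_div, div_self ht', one_div, ← prod_inv_distrib]
  refine prod_congr rfl fun p hp ↦ ?_
  have hp1 : (1 : ℝ) < p := by exact_mod_cast (Nat.prime_of_mem_primeFactors hp).one_lt
  have : (p : ℝ) - 1 ≠ 0 := by linarith
  have : (p : ℝ) ≠ 0 := by linarith
  have h3 : 1 - (p : ℝ)⁻¹ = (p - 1) / p := by field_simp
  rw [h3, inv_div]

lemma sum_divisors_gcdWeight_div_totient {t : ℕ} (ht : t ≠ 0) (a : ℤ) :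
    ∑ r ∈ t.divisors, (ArithmeticFunction.moebius r : ℝ) ^ 2 * gcdWeight r a / r.totient =
      if t.Coprime a.natAbs then (t : ℝ) / t.totient else 0 := by
  simp_rw [moebius_sq_eq, ite_mul, one_mul, zero_mul, ite_div, zero_div]
  rw [← sum_filter, divisors_filter_squarefree ht,
    ← prod_one_add_eq_sum_divisors (f := fun r ↦ gcdWeight r a / r.totient) (by simp [gcdWeight])
      ?_ (squarefree_prod_primeFactors t), Nat.primeFactors_prod
        fun p hp ↦ Nat.prime_of_mem_primeFactors hp]
  · split_ifs with h
    · rw [← prod_div_eq_div_totient ht]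
      refine prod_congr rfl fun p hp ↦ ?_
      have hpp := Nat.prime_of_mem_primeFactors hp
      have hna : ¬ (p : ℤ) ∣ a := fun hd ↦ hpp.one_lt.ne'
        (Nat.eq_one_of_dvd_coprimes h (Nat.dvd_of_mem_primeFactors hp) (Int.natCast_dvd.mp hd))
      rw [gcdWeight_prime hpp, if_neg hna, Nat.totient_prime hpp, Nat.cast_sub hpp.one_le]
      have hp1 : (1 : ℝ) < p := by exact_mod_cast hpp.one_lt
      have : (p : ℝ) - 1 ≠ 0 := by linarith
      push_cast
      field_simp
      ring
    · obtain ⟨p, hpp, hpt, hpa⟩ := Nat.Prime.not_coprime_iff_dvd.mp h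
      refine prod_eq_zero (Nat.mem_primeFactors.mpr ⟨hpp, hpt, ht⟩) ?_
      rw [gcdWeight_prime hpp, if_pos (Int.natCast_dvd.mpr hpa), Nat.totient_prime hpp,
        Nat.cast_sub hpp.one_le]
      have hp1 : (1 : ℝ) < p := by exact_mod_cast hpp.one_lt
      have : (p : ℝ) - 1 ≠ 0 := by linarith
      push_cast
      field_simp
      ring
  · intro u v huv
    rw [gcdWeight_mul a u v huv, Nat.totient_mul huv]
    push_cast
    rw [mul_div_mul_comm]

lemma abs_gcdWeight_le {r : ℕ} (hr : r ≠ 0) (a : ℤ) : |gcdWeight r a| ≤ r.totient := by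
  unfold gcdWeight
  rw [abs_mul, Nat.abs_cast]
  have hmu : |(ArithmeticFunction.moebius (Int.gcd r a) : ℝ)| ≤ 1 := by
    exact_mod_cast ArithmeticFunction.abs_moebius_le_one
  have h2 : (Int.gcd r a).totient ≤ r.totient := by
    refine Nat.le_of_dvd (Nat.totient_pos.mpr (Nat.pos_of_ne_zero hr)) (Nat.totient_dvd_of_dvd ?_)
    exact_mod_cast Int.gcd_dvd_left (r : ℤ) a
  calc _ ≤ 1 * ((Int.gcd r a).totient : ℝ) := by gcongr
    _ ≤ _ := by rw [one_mul]; exact_mod_cast h2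

lemma abs_term_le_one {r : ℕ} (hr : r ≠ 0) (a : ℤ) :
    |(ArithmeticFunction.moebius r : ℝ) ^ 2 * gcdWeight r a / r.totient| ≤ 1 := by
  have hpos : (0 : ℝ) < r.totient := by
    exact_mod_cast Nat.totient_pos.mpr (Nat.pos_of_ne_zero hr)
  rw [abs_div, abs_mul, Nat.abs_cast, div_le_one hpos, moebius_sq_eq]
  refine le_trans ?_ (abs_gcdWeight_le hr a)
  split_ifs <;> simp

lemma sum_divisors_le {r : ℕ} (hr : r ≠ 0) :
    ∑ e ∈ r.divisors, (e : ℝ) ≤ r * (1 + Real.log r) := by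
  have h : ∑ e ∈ r.divisors, (e : ℝ) = ∑ e ∈ r.divisors, (r : ℝ) / e := by
    rw [← Nat.sum_div_divisors r fun e ↦ (e : ℝ)]
    refine sum_congr rfl fun e he ↦ ?_
    have he0 : (e : ℝ) ≠ 0 := by exact_mod_cast (Nat.pos_of_mem_divisors he).ne'
    rw [Nat.cast_div (Nat.dvd_of_mem_divisors he) he0]
  rw [h]
  calc ∑ e ∈ r.divisors, (r : ℝ) / e ≤ ∑ e ∈ Icc 1 r, (r : ℝ) / e :=
        sum_le_sum_of_subset_of_nonneg (fun e he ↦ mem_Icc.mpr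
          ⟨Nat.pos_of_mem_divisors he, Nat.divisor_le he⟩) fun _ _ _ ↦ by positivity
    _ = r * (harmonic r : ℝ) := by
        rw [harmonic_eq_sum_Icc, Rat.cast_sum, mul_sum]
        refine sum_congr rfl fun e _ ↦ ?_
        push_cast
        rw [div_eq_mul_inv]
    _ ≤ _ := by gcongr; exact harmonic_le_one_add_log r

lemma card_divisors_le (n : ℕ) : (n.divisors.card : ℝ) ≤ 2 * √n := by
  have hsub : n.divisors ⊆ Icc 1 n.sqrt ∪ (Icc 1 n.sqrt).image (n / ·) := by
    intro d hd
    have hd0 := Nat.pos_of_mem_divisors hd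
    obtain ⟨⟨k, hk⟩, hn⟩ := Nat.mem_divisors.mp hd
    have hk0 : 0 < k := by
      rcases Nat.eq_zero_or_pos k with h | h
      · rw [h] at hk; simp at hk; omega
      · exact h
    rw [mem_union, mem_image]
    by_cases h : d ≤ n.sqrt
    · exact Or.inl (mem_Icc.mpr ⟨hd0, h⟩)
    · refine Or.inr ⟨k, mem_Icc.mpr ⟨hk0, ?_⟩, ?_⟩
      · by_contra! hk'
        have h1 : n.sqrt + 1 ≤ d := by omega
        have h2 := Nat.mul_le_mul h1 (Nat.succ_le_of_lt hk')
        have h3 := Nat.lt_succ_sqrt n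
        simp only [Nat.succ_eq_add_one] at h2 h3
        rw [← hk] at h2
        omega
      · rw [hk, Nat.mul_div_cancel _ hk0]
  have h1 := (card_le_card hsub).trans (card_union_le _ _)
  have h2 := card_image_le (s := Icc 1 n.sqrt) (f := (n / ·))
  rw [Nat.card_Icc] at h1 h2
  have h3 : n.divisors.card ≤ 2 * n.sqrt := by omega
  have h4 : (n.sqrt : ℝ) ≤ √n := Real.nat_sqrt_le_real_sqrt
  have h5 : (n.divisors.card : ℝ) ≤ 2 * n.sqrt := by exact_mod_cast h3
  linarith

lemma prod_div_sub_one_le (S : Finset ℕ) (hS : ∀ p ∈ S, 2 ≤ p) :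
    ∏ p ∈ S, ((p : ℝ) / (p - 1)) ≤ S.card + 1 := by
  induction S using Finset.induction_on_max with
  | empty => simp
  | insert m S hm ih =>
    have hnot : m ∉ S := fun h ↦ (hm m h).false
    rw [prod_insert hnot, card_insert_of_notMem hnot]
    have ih' := ih fun p hp ↦ hS p (mem_insert_of_mem hp)
    have hcard : S.card + 2 ≤ m := by
      have hsub : S ⊆ Ico 2 m := fun p hp ↦
        mem_Ico.mpr ⟨hS p (mem_insert_of_mem hp), hm p hp⟩
      have h1 := card_le_card hsub
      rw [Nat.card_Ico] at h1
      have := hS m (mem_insert_self _ _)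
      omega
    have hc : (S.card : ℝ) + 2 ≤ m := by exact_mod_cast hcard
    have hpos : (0 : ℝ) < m - 1 := by
      have : (0 : ℝ) ≤ S.card := by positivity
      linarith
    calc (m : ℝ) / (m - 1) * ∏ p ∈ S, ((p : ℝ) / (p - 1)) ≤
          (m : ℝ) / (m - 1) * (S.card + 1) := by
          refine mul_le_mul_of_nonneg_left ih' (by positivity)
      _ ≤ _ := by
          rw [div_mul_eq_mul_div, div_le_iff₀ hpos]
          push_cast
          nlinarith

lemma div_totient_le {n : ℕ} (hn : n ≠ 0) :
    (n : ℝ) / n.totient ≤ 1 + 2 * Real.log n := by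
  rw [← prod_div_eq_div_totient hn]
  have h := prod_div_sub_one_le n.primeFactors
    fun p hp ↦ (Nat.prime_of_mem_primeFactors hp).two_le
  have h2 := card_primeFactors_le hn
  linarith

lemma sum_coprime_eq_sum_moebius {a : ℤ} (ha : a ≠ 0) (f : ℕ → ℝ) (Q U : ℕ) :
    ∑ q ∈ (Ioc Q U).filter (fun q : ℕ ↦ Int.gcd (q : ℤ) a = 1), f q =
      ∑ d ∈ a.natAbs.divisors, (ArithmeticFunction.moebius d : ℝ) *
        ∑ q ∈ Ioc (Q / d) (U / d), f (d * q) := by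
  have ha' := Int.natAbs_ne_zero.mpr ha
  have h1 : ∀ q : ℕ, (if Int.gcd (q : ℤ) a = 1 then f q else 0) =
      ∑ d ∈ a.natAbs.divisors, if d ∣ q then (ArithmeticFunction.moebius d : ℝ) * f q else 0 := by
    intro q
    have hg : Int.gcd (q : ℤ) a ≠ 0 := by
      rw [Ne, Int.gcd_eq_zero_iff]; tauto
    have h2 := ArithmeticFunction.coe_mul_zeta_apply
      (f := ArithmeticFunction.moebius) (x := Int.gcd (q : ℤ) a)
    rw [ArithmeticFunction.moebius_mul_coe_zeta, ArithmeticFunction.one_apply] at h2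
    have h3 : (if Int.gcd (q : ℤ) a = 1 then (1 : ℝ) else 0) =
        ∑ d ∈ (Int.gcd (q : ℤ) a).divisors, (ArithmeticFunction.moebius d : ℝ) := by
      exact_mod_cast h2
    rw [← sum_filter]
    have h4 : a.natAbs.divisors.filter (fun d ↦ d ∣ q) = (Int.gcd (q : ℤ) a).divisors := by
      ext d
      rw [mem_filter, Nat.mem_divisors, Nat.mem_divisors]
      simp only [Int.gcd, Int.natAbs_natCast, Nat.dvd_gcd_iff] at hg ⊢
      tauto
    rw [h4, ← sum_mul, ← h3]
    split_ifs <;> simp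
  rw [sum_filter, sum_congr rfl fun q _ ↦ h1 q, sum_comm]
  refine sum_congr rfl fun d hd ↦ ?_
  have hd0 := Nat.pos_of_mem_divisors hd
  rw [← sum_filter, mul_sum]
  symm
  refine sum_nbij (fun q ↦ d * q) ?_ ?_ ?_ ?_
  · intro q hq
    rw [mem_Ioc, Nat.div_lt_iff_lt_mul hd0, Nat.le_div_iff_mul_le hd0] at hq
    rw [mem_filter, mem_Ioc, mul_comm]
    exact ⟨hq, dvd_mul_left _ _⟩
  · intro q _ q' _ h
    exact Nat.eq_of_mul_eq_mul_left hd0 h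
  · intro q hq
    obtain ⟨hq, k, rfl⟩ := mem_filter.mp (mem_coe.mp hq)
    refine ⟨k, ?_, rfl⟩
    rw [mem_coe, mem_Ioc, Nat.div_lt_iff_lt_mul hd0, Nat.le_div_iff_mul_le hd0, mul_comm k]
    exact mem_Ioc.mp hq
  · intro q _
    rfl

lemma FR_eq_sum_gcdWeight (R : ℝ) (n : ℤ) :
    FR R n = ∑ r ∈ Icc 1 ⌊R⌋₊,
      (ArithmeticFunction.moebius r : ℝ) ^ 2 * gcdWeight r n / r.totient := by
  unfold FR gcdWeight
  refine sum_congr rfl fun r _ ↦ ?_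
  rw [mul_assoc]

lemma sum_moebius_sq_div_totient_mul_le {R : ℝ} (hR : 1 ≤ R) :
    ∑ r ∈ Icc 1 ⌊R⌋₊, (ArithmeticFunction.moebius r : ℝ) ^ 2 / r.totient *
      ∑ e ∈ r.divisors, (e : ℝ) ≤ R * ((1 + Real.log R) * (1 + 2 * Real.log R)) := by
  have hlR := Real.log_nonneg hR
  calc _ ≤ ∑ r ∈ Icc 1 ⌊R⌋₊, (1 + Real.log R) * (1 + 2 * Real.log R) := by
        refine sum_le_sum fun r hr ↦ ?_
        obtain ⟨h1, h2⟩ := mem_Icc.mp hr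
        have hr0 : r ≠ 0 := by omega
        have hrR : (r : ℝ) ≤ R := (Nat.cast_le.mpr h2).trans (Nat.floor_le (by linarith))
        have hr1 : (1 : ℝ) ≤ r := by exact_mod_cast h1
        have hlr : Real.log r ≤ Real.log R := Real.log_le_log (by linarith) hrR
        have hlr0 : 0 ≤ Real.log r := Real.log_nonneg hr1
        have hpos : (0 : ℝ) < r.totient := by
          exact_mod_cast Nat.totient_pos.mpr (Nat.pos_of_ne_zero hr0)
        have h3 := div_totient_le hr0
        have h4 := sum_divisors_le hr0
        have hmu : (ArithmeticFunction.moebius r : ℝ) ^ 2 ≤ 1 := by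
          rw [moebius_sq_eq]; split_ifs <;> norm_num
        calc _ ≤ 1 / (r.totient : ℝ) * (r * (1 + Real.log r)) := by gcongr
          _ = (1 + Real.log r) * ((r : ℝ) / r.totient) := by ring
          _ ≤ (1 + Real.log R) * (1 + 2 * Real.log R) := by
              refine mul_le_mul (by linarith) (by linarith) (by positivity) (by linarith)
    _ = ⌊R⌋₊ * ((1 + Real.log R) * (1 + 2 * Real.log R)) := by simp
    _ ≤ _ := by
        have := Nat.floor_le (show 0 ≤ R by linarith)
        gcongr

lemma abs_sum_dvd_gcdWeight_sub_le {t : ℕ} (ht : t ≠ 0) {R : ℝ} (hR : 1 ≤ R)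
    (htR : (t : ℝ) < 2 * R) (a : ℤ) :
    |∑ r ∈ Icc 1 ⌊R⌋₊, (ArithmeticFunction.moebius r : ℝ) ^ 2 / r.totient *
        (if r ∣ t then gcdWeight r a else 0) -
      if t.Coprime a.natAbs then (t : ℝ) / t.totient else 0| ≤ if (t : ℝ) ≤ R then 0 else 1 := by
  have hR0 : 0 ≤ R := by linarith
  set f := fun r : ℕ ↦ (ArithmeticFunction.moebius r : ℝ) ^ 2 * gcdWeight r a / r.totient with hf
  have h1 : ∑ r ∈ Icc 1 ⌊R⌋₊, (ArithmeticFunction.moebius r : ℝ) ^ 2 / r.totient *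
      (if r ∣ t then gcdWeight r a else 0) =
      ∑ r ∈ t.divisors.filter (fun r ↦ r ≤ ⌊R⌋₊), f r := by
    have h2 : t.divisors.filter (fun r ↦ r ≤ ⌊R⌋₊) = (Icc 1 ⌊R⌋₊).filter (fun r ↦ r ∣ t) := by
      ext r
      rw [mem_filter, mem_filter, Nat.mem_divisors, mem_Icc]
      constructor
      · rintro ⟨⟨h1, h2⟩, h3⟩
        exact ⟨⟨Nat.pos_of_dvd_of_pos h1 (Nat.pos_of_ne_zero ht), h3⟩, h1⟩
      · rintro ⟨⟨h1, h2⟩, h3⟩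
        exact ⟨⟨h3, ht⟩, h2⟩
    rw [h2, sum_filter]
    refine sum_congr rfl fun r _ ↦ ?_
    split_ifs
    · rw [hf]; ring
    · ring
  rw [h1, ← sum_divisors_gcdWeight_div_totient ht a, ← sum_filter_add_sum_filter_not t.divisors
    (fun r ↦ r ≤ ⌊R⌋₊) (fun r ↦ (ArithmeticFunction.moebius r : ℝ) ^ 2 * gcdWeight r a / r.totient),
    sub_add_cancel_left, abs_neg]
  split_ifs with h
  · rw [filter_eq_empty_iff.mpr, sum_empty, abs_zero]
    intro r hr
    rw [not_not]
    refine (Nat.divisor_le hr).trans ?_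
    exact Nat.le_floor h
  · refine le_trans ?_ (abs_term_le_one ht a)
    rw [sum_subset (s₂ := {t}), sum_singleton]
    · intro r hr
      rw [mem_filter, Nat.mem_divisors, Nat.le_floor_iff hR0] at hr
      obtain ⟨⟨⟨k, hk⟩, -⟩, h3⟩ := hr
      rw [mem_singleton]
      push Not at h3
      have hk1 : k < 2 := by
        by_contra! hk2
        have h4 : (t : ℝ) = r * k := by exact_mod_cast hk
        have h5 : (2 : ℝ) ≤ k := by exact_mod_cast hk2
        nlinarith
      interval_cases k
      · simp at hk; omega
      · omega
    · intro r hr hr2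
      rw [mem_singleton] at hr
      subst hr
      exfalso
      apply hr2
      rw [mem_filter, Nat.mem_divisors, Nat.le_floor_iff hR0]
      exact ⟨⟨dvd_rfl, ht⟩, h⟩

lemma abs_sum_FR_sub_le {t V W : ℕ} (ht : t ≠ 0) (hVW : V ≤ W) {R : ℝ} (hR : 1 ≤ R)
    (htR : (t : ℝ) < 2 * R) (a : ℤ) :
    |∑ q ∈ Ioc V W, FR R (a + t * q) -
      (if t.Coprime a.natAbs then (t : ℝ) / t.totient else 0) * ((W : ℝ) - V)| ≤
      R * ((1 + Real.log R) * (1 + 2 * Real.log R)) +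
        (if (t : ℝ) ≤ R then 0 else 1) * ((W : ℝ) - V) := by
  have hWV : (0 : ℝ) ≤ (W : ℝ) - V := by
    have : (V : ℝ) ≤ W := by exact_mod_cast hVW
    linarith
  simp_rw [FR_eq_sum_gcdWeight]
  rw [sum_comm]
  set T := ∑ r ∈ Icc 1 ⌊R⌋₊, (ArithmeticFunction.moebius r : ℝ) ^ 2 / r.totient *
        (if r ∣ t then gcdWeight r a else 0) with hT
  have h1 : |∑ r ∈ Icc 1 ⌊R⌋₊, ∑ q ∈ Ioc V W,
      (ArithmeticFunction.moebius r : ℝ) ^ 2 * gcdWeight r (a + t * q) / r.totient -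
      T * ((W : ℝ) - V)| ≤ R * ((1 + Real.log R) * (1 + 2 * Real.log R)) := by
    refine le_trans ?_ (sum_moebius_sq_div_totient_mul_le hR)
    rw [hT, sum_mul, ← sum_sub_distrib]
    refine (abs_sum_le_sum_abs _ _).trans (sum_le_sum fun r _ ↦ ?_)
    have e1 : ∑ q ∈ Ioc V W,
        (ArithmeticFunction.moebius r : ℝ) ^ 2 * gcdWeight r (a + t * q) / r.totient =
        (ArithmeticFunction.moebius r : ℝ) ^ 2 / r.totient *
          ∑ q ∈ Ioc V W, gcdWeight r (a + t * q) := by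
      rw [mul_sum]
      exact sum_congr rfl fun q _ ↦ by ring
    rw [e1, mul_assoc, ← mul_sub, abs_mul, abs_of_nonneg (by positivity)]
    by_cases hr : Squarefree r
    · exact mul_le_mul_of_nonneg_left (abs_sum_gcdWeight_sub_le hr hVW a) (by positivity)
    · rw [moebius_sq_eq, if_neg hr]
      simp
  have h2 := abs_sum_dvd_gcdWeight_sub_le ht hR htR a
  rw [← hT] at h2
  set m := (if t.Coprime a.natAbs then (t : ℝ) / t.totient else 0)
  have h3 : |T * ((W : ℝ) - V) - m * ((W : ℝ) - V)| ≤
      (if (t : ℝ) ≤ R then 0 else 1) * ((W : ℝ) - V) := by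
    rw [← sub_mul, abs_mul, abs_of_nonneg hWV]
    gcongr
  exact (abs_sub_le _ _ _).trans (add_le_add h1 h3)

lemma abs_sum_FR_coprime_sub_le {a : ℤ} (ha : a ≠ 0) {s Q U : ℕ} (hs : 1 ≤ s) (hQU : Q ≤ U)
    {R : ℝ} (hR : 1 ≤ R) (hsR : (s : ℝ) * a.natAbs < 2 * R)
    (hor : (s : ℝ) * a.natAbs ≤ R ∨ (U : ℝ) - Q ≤ a.natAbs + 2) :
    |∑ q ∈ (Ioc Q U).filter (fun q : ℕ ↦ Int.gcd (q : ℤ) a = 1), FR R (a + q * s) -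
      (if s.Coprime a.natAbs then (s : ℝ) / s.totient * ((U : ℝ) - Q) else 0)| ≤
      a.natAbs.divisors.card *
        (R * ((1 + Real.log R) * (1 + 2 * Real.log R)) + (a.natAbs + 2)) := by
  have ha' := Int.natAbs_ne_zero.mpr ha
  have hQUr : (Q : ℝ) ≤ U := by exact_mod_cast hQU
  rw [sum_coprime_eq_sum_moebius ha (fun q : ℕ ↦ FR R (a + q * s))]
  have hmain : (if s.Coprime a.natAbs then (s : ℝ) / s.totient * ((U : ℝ) - Q) else 0) =
      ∑ d ∈ a.natAbs.divisors, (ArithmeticFunction.moebius d : ℝ) *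
        ((if (s * d).Coprime a.natAbs then ((s * d : ℕ) : ℝ) / (s * d).totient else 0) *
          (((U / d : ℕ) : ℝ) - ((Q / d : ℕ) : ℝ))) := by
    rw [sum_eq_single 1]
    · simp
    · intro d hd hd1
      rw [if_neg, zero_mul, mul_zero]
      intro hc
      exact hd1 (Nat.eq_one_of_dvd_coprimes hc (dvd_mul_left _ _) (Nat.dvd_of_mem_divisors hd))
    · intro h
      exact absurd (Nat.one_mem_divisors.mpr ha') h
  rw [hmain, ← sum_sub_distrib, ← nsmul_eq_mul]
  refine (abs_sum_le_sum_abs _ _).trans (sum_le_card_nsmul _ _ _ fun d hd ↦ ?_)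
  have hd0 := Nat.pos_of_mem_divisors hd
  have hda : (d : ℝ) ≤ a.natAbs := by exact_mod_cast Nat.divisor_le hd
  have hsd : ((s * d : ℕ) : ℝ) ≤ s * a.natAbs := by push_cast; gcongr
  rw [← mul_sub, abs_mul]
  have hmu : |(ArithmeticFunction.moebius d : ℝ)| ≤ 1 := by
    exact_mod_cast ArithmeticFunction.abs_moebius_le_one
  have h := abs_sum_FR_sub_le (t := s * d) (V := Q / d) (W := U / d) (by positivity)
    (Nat.div_le_div_right hQU) hR (hsd.trans_lt hsR) a
  have e1 : ∑ q ∈ Ioc (Q / d) (U / d), FR R (a + ((d * q : ℕ) : ℤ) * s) =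
      ∑ q ∈ Ioc (Q / d) (U / d), FR R (a + ((s * d : ℕ) : ℤ) * q) := by
    refine sum_congr rfl fun q _ ↦ ?_
    congr 1
    push_cast
    ring
  rw [e1]
  have h2 : (if ((s * d : ℕ) : ℝ) ≤ R then (0 : ℝ) else 1) *
      (((U / d : ℕ) : ℝ) - ((Q / d : ℕ) : ℝ)) ≤ a.natAbs + 2 := by
    split_ifs with h
    · rw [zero_mul]; positivity
    · rcases hor with h' | h'
      · exact absurd (hsd.trans h') h
      · rw [one_mul]
        refine le_trans ?_ h'
        have h3 : U / d ≤ Q / d + (U - Q) := by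
          rw [← Nat.add_mul_div_right _ _ hd0]
          refine Nat.div_le_div_right ?_
          have := Nat.le_mul_of_pos_right (U - Q) hd0
          omega
        have h4 : ((U / d : ℕ) : ℝ) ≤ ((Q / d : ℕ) : ℝ) + ((U : ℝ) - Q) := by
          rw [← Nat.cast_sub hQU]
          exact_mod_cast h3
        linarith
  calc _ ≤ 1 * _ := mul_le_mul_of_nonneg_right hmu (abs_nonneg _)
    _ ≤ _ := by rw [one_mul]; exact h.trans (by gcongr)

lemma abs_sum_FR_coprime_sub_le_log (P : ℕ) :
    ∃ K : ℝ, 0 < K ∧ ∀ x : ℝ, 3 ≤ x → ∀ a : ℤ, a ≠ 0 → (a.natAbs : ℝ) ≤ √x →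
      ∀ R : ℝ, 1 ≤ R → R ≤ √x → ∀ s Q U : ℕ, 1 ≤ s → Q ≤ U → (s : ℝ) * a.natAbs < 2 * R →
      ((s : ℝ) * a.natAbs ≤ R ∨ (U : ℝ) - Q ≤ a.natAbs + 2) →
      |∑ q ∈ (Ioc Q U).filter (fun q : ℕ ↦ Int.gcd (q : ℤ) a = 1), FR R (a + q * s) -
        (if s.Coprime a.natAbs then (s : ℝ) / s.totient * ((U : ℝ) - Q) else 0)| ≤
        K * (x / Real.log x ^ P) := by
  refine ⟨18 * (4 ^ (P + 2) * (P + 2).factorial), by positivity, ?_⟩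
  intro x hx a ha hax R hR hRx s Q U hs hQU hsR hor
  refine (abs_sum_FR_coprime_sub_le ha hs hQU hR hsR hor).trans ?_
  have hL := one_le_log hx
  set L := Real.log x with hLdef
  set y := √x with hy
  have hy1 : 1 ≤ y := hR.trans hRx
  have hyx : y * y = x := Real.mul_self_sqrt (by linarith)
  have hyx' : y ≤ x := by nlinarith
  have hLy : L = 2 * Real.log y := by
    rw [hLdef, hy, Real.log_sqrt (by linarith)]; ring
  have hk := log_pow_le_mul_sqrt (P + 2) hy1
  have hk' : L ^ (P + 2) ≤ 4 ^ (P + 2) * (P + 2).factorial * √y := by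
    rw [hLy, mul_pow]
    calc _ ≤ 2 ^ (P + 2) * (2 ^ (P + 2) * (P + 2).factorial * √y) := by gcongr
      _ = 4 ^ (P + 2) * (P + 2).factorial * √y := by
          rw [show (4 : ℝ) = 2 * 2 by norm_num, mul_pow]; ring
  have hlR0 : 0 ≤ Real.log R := Real.log_nonneg hR
  have hlR : Real.log R ≤ L := Real.log_le_log (by linarith) (hRx.trans hyx')
  have hτ : (a.natAbs.divisors.card : ℝ) ≤ 2 * √y :=
    (card_divisors_le _).trans (by gcongr)
  have hyy : √y * √y = y := Real.mul_self_sqrt (by linarith)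
  calc _ ≤ 2 * √y * (y * ((2 * L) * (3 * L)) + (y + 2 * y)) := by
        gcongr
        · linarith
        · linarith
        · linarith
    _ ≤ 2 * √y * (y * ((2 * L) * (3 * L)) + (y + 2 * y) * (L * L)) := by
        gcongr
        refine le_mul_of_one_le_right (by linarith) (by nlinarith)
    _ = 18 * (y * √y) * L ^ 2 := by ring
    _ = 18 * (y * √y) * (L ^ (P + 2) / L ^ P) := by
        rw [pow_add, mul_div_cancel_left₀ _ (by positivity)]
    _ ≤ 18 * (y * √y) * (4 ^ (P + 2) * (P + 2).factorial * √y / L ^ P) := by gcongr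
    _ = 18 * (4 ^ (P + 2) * (P + 2).factorial) * (y * (√y * √y) / L ^ P) := by ring
    _ = _ := by rw [hyy, hyx]

lemma sum_progression_eq {a : ℤ} {q X S : ℕ} (hq : a.natAbs < q)
    (hS : ∀ s : ℕ, a + q * s ≤ X → s ≤ S) (f : ℤ → ℝ) :
    ∑ n ∈ (Icc 1 X).filter (fun n : ℕ ↦ a < (n : ℤ) ∧ (q : ℤ) ∣ (n : ℤ) - a), f n =
      ∑ s ∈ (Icc 1 S).filter (fun s : ℕ ↦ a + q * s ≤ X), f (a + q * s) := by
  have hq0 : (0 : ℤ) < q := by omega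
  symm
  refine sum_nbij (fun s ↦ (a + q * s).toNat) ?_ ?_ ?_ ?_
  · intro s hs
    rw [mem_filter, mem_Icc] at hs
    have h := toNat_add_mul_cast (a := a) (s := s) (q := q) hs.1.1 hq.le
    have h1 : (q : ℤ) ≤ q * s := le_mul_of_one_le_right hq0.le (by exact_mod_cast hs.1.1)
    rw [mem_filter, mem_Icc, h]
    refine ⟨⟨by omega, by omega⟩, by omega, ?_⟩
    rw [add_sub_cancel_left]
    exact dvd_mul_right _ _
  · intro s hs s' hs' h
    rw [mem_coe, mem_filter, mem_Icc] at hs hs'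
    have h1 := toNat_add_mul_cast (a := a) (s := s) (q := q) hs.1.1 hq.le
    have h2 := toNat_add_mul_cast (a := a) (s := s') (q := q) hs'.1.1 hq.le
    simp only at h
    rw [h, h2] at h1
    have h3 : (q : ℤ) * s' = q * s := by linarith
    exact_mod_cast (mul_left_cancel₀ hq0.ne' h3).symm
  · intro n hn
    rw [mem_coe, mem_filter, mem_Icc] at hn
    obtain ⟨⟨h1, h2⟩, h3, k, hk⟩ := hn
    have hk0 : 0 < k := by
      by_contra! hk'
      have := mul_nonpos_of_nonneg_of_nonpos hq0.le hk'
      omega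
    lift k to ℕ using hk0.le
    have hn' : a + q * k = n := by linarith
    have hle : a + (q : ℤ) * k ≤ X := by rw [hn']; exact_mod_cast h2
    refine ⟨k, ?_, ?_⟩
    · rw [mem_coe, mem_filter, mem_Icc]
      exact ⟨⟨by exact_mod_cast hk0, hS k hle⟩, hle⟩
    · simp only [hn', Int.toNat_natCast]
  · intro s hs
    rw [mem_filter, mem_Icc] at hs
    rw [toNat_add_mul_cast (a := a) (s := s) (q := q) hs.1.1 hq.le]

lemma psiStar_sub_rhoStar_eq {a : ℤ} {q S : ℕ} {x R : ℝ} (hq : a.natAbs < q)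
    (hS : ∀ s : ℕ, a + q * s ≤ (⌊x⌋₊ : ℤ) → s ≤ S) :
    psiStar x q a - rhoStar R x q a =
      ∑ s ∈ (Icc 1 S).filter (fun s : ℕ ↦ a + q * s ≤ (⌊x⌋₊ : ℤ)),
        (ArithmeticFunction.vonMangoldt (a + q * s).toNat - FR R (a + q * s)) := by
  rw [← sum_progression_eq hq hS fun n ↦ ArithmeticFunction.vonMangoldt n.toNat - FR R n]
  unfold psiStar rhoStar
  rw [← sum_sub_distrib]
  rfl

lemma sum_filter_add_mul_le {a : ℤ} {s X Q Q' : ℕ} (hs : 1 ≤ s) (haX : a ≤ X) (f : ℕ → ℝ)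
    (p : ℕ → Prop) [DecidablePred p] :
    ∑ q ∈ (Ioc Q Q').filter p, (if a + q * s ≤ (X : ℤ) then f q else 0) =
      ∑ q ∈ (Ioc Q (min Q' ((X - a) / s).toNat)).filter p, f q := by
  rw [← sum_filter, filter_filter]
  refine sum_congr ?_ fun _ _ ↦ rfl
  ext q
  have hs0 : (0 : ℤ) < s := by exact_mod_cast hs
  have h0 : 0 ≤ ((X : ℤ) - a) / s := Int.ediv_nonneg (by omega) hs0.le
  have h : a + q * s ≤ (X : ℤ) ↔ q ≤ (((X : ℤ) - a) / s).toNat := by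
    zify
    rw [Int.toNat_of_nonneg h0, Int.le_ediv_iff_mul_le hs0]
    constructor <;> intro h <;> linarith
  simp only [mem_filter, mem_Ioc, h, le_min_iff]
  tauto

lemma abs_sum_psiStar_sub_rhoStar_le (P : ℕ) :
    ∃ K : ℝ, 0 < K ∧ ∀ x : ℝ, 3 ≤ x → ∀ a : ℤ, a ≠ 0 → ∀ M : ℝ, 1 ≤ M → ∀ R : ℝ,
      2 * |(a : ℝ)| * M ≤ R → R ≤ √x →
      |∑ q ∈ (Ioc ⌊x / (2 * M)⌋₊ ⌊x / M⌋₊).filter (fun q : ℕ ↦ Int.gcd (q : ℤ) a = 1),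
        (psiStar x q a - rhoStar R x q a)| ≤ K * M ^ 2 * (x / Real.log x ^ P) := by
  obtain ⟨K₁, hK₁, h₁⟩ := abs_sum_vonMangoldt_coprime_sub_le P
  obtain ⟨K₂, hK₂, h₂⟩ := abs_sum_FR_coprime_sub_le_log P
  refine ⟨9 * (K₁ + K₂), by positivity, ?_⟩
  intro x hx a ha M hM R hMR hRx
  have hx0 : 0 < x := by linarith
  have hL := one_le_log hx
  have habs : |(a : ℝ)| = a.natAbs := by rw [Nat.cast_natAbs, Int.cast_abs]
  have hα1 : (1 : ℝ) ≤ a.natAbs := by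
    exact_mod_cast Nat.one_le_iff_ne_zero.mpr (Int.natAbs_ne_zero.mpr ha)
  rw [habs] at hMR
  set α : ℝ := (a.natAbs : ℝ) with hα
  have hαM : α ≤ α * M := le_mul_of_one_le_right (by linarith) hM
  have hsx : √x ≤ x := by
    rw [Real.sqrt_le_left (by linarith)]; nlinarith
  have hαx : α ≤ √x := by linarith
  have hR1 : 1 ≤ R := by linarith
  have haα : (a : ℝ) ≤ α := habs ▸ le_abs_self _
  have haα' : -α ≤ (a : ℝ) := habs ▸ neg_abs_le _
  set X := ⌊x⌋₊ with hX
  have hXx : (X : ℝ) ≤ x := Nat.floor_le hx0.le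
  have haX : a ≤ X := by
    have : a.natAbs ≤ X := Nat.le_floor (by linarith)
    omega
  set Q := ⌊x / (2 * M)⌋₊ with hQ
  set S := ⌊2 * M + 1⌋₊ with hS
  have hS3 : (S : ℝ) ≤ 2 * M + 1 := Nat.floor_le (by linarith)
  have hQlt : x / (2 * M) < Q + 1 := Nat.lt_floor_add_one _
  have haQ : a.natAbs ≤ Q := by
    refine Nat.le_floor ?_
    rw [le_div_iff₀ (by linarith)]
    linarith
  have hSq : ∀ q : ℕ, Q < q → ∀ s : ℕ, a + q * s ≤ (X : ℤ) → s ≤ S := by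
    intro q hq s hs
    refine Nat.le_floor ?_
    have h1 : (a : ℝ) + q * s ≤ X := by exact_mod_cast hs
    have h2 : x / (2 * M) ≤ q := hQlt.le.trans (by exact_mod_cast hq)
    have h3 : x / (2 * M) * s ≤ q * s := by gcongr
    have h4 : x / (2 * M) * s ≤ x + α := by linarith
    rw [div_mul_eq_mul_div, div_le_iff₀ (by linarith)] at h4
    have h5 : x * s ≤ x * (2 * M + 1) := by nlinarith
    exact le_of_mul_le_mul_left h5 hx0
  have hswap : ∑ q ∈ (Ioc Q ⌊x / M⌋₊).filter (fun q : ℕ ↦ Int.gcd (q : ℤ) a = 1),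
      (psiStar x q a - rhoStar R x q a) = ∑ s ∈ Icc 1 S,
        ∑ q ∈ (Ioc Q (min ⌊x / M⌋₊ ((X - a) / s).toNat)).filter
          (fun q : ℕ ↦ Int.gcd (q : ℤ) a = 1),
          (ArithmeticFunction.vonMangoldt (a + q * s).toNat - FR R (a + q * s)) := by
    rw [sum_congr rfl fun q hq ↦ by
      have hq' := (mem_Ioc.mp (mem_filter.mp hq).1).1
      rw [psiStar_sub_rhoStar_eq (haQ.trans_lt hq') (hSq q hq'), sum_filter], sum_comm]
    exact sum_congr rfl fun s hs ↦ sum_filter_add_mul_le (mem_Icc.mp hs).1 haX _ _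
  rw [hswap]
  have hE : 0 ≤ x / Real.log x ^ P := by positivity
  have hper : ∀ s ∈ Icc 1 S, |∑ q ∈ (Ioc Q (min ⌊x / M⌋₊ ((X - a) / s).toNat)).filter
      (fun q : ℕ ↦ Int.gcd (q : ℤ) a = 1),
      (ArithmeticFunction.vonMangoldt (a + q * s).toNat - FR R (a + q * s))| ≤
      (K₁ + K₂) * (3 * M) * (x / Real.log x ^ P) := by
    intro s hs
    obtain ⟨hs1, hsS⟩ := mem_Icc.mp hs
    have hsM : (s : ℝ) ≤ 2 * M + 1 := (Nat.cast_le.mpr hsS).trans hS3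
    have hs1' : (1 : ℝ) ≤ s := by exact_mod_cast hs1
    set U := min ⌊x / M⌋₊ ((X - a) / s).toNat with hU
    rcases le_or_gt Q U with hQU | hQU
    · have hs0 : (0 : ℤ) < s := by exact_mod_cast hs1
      have hUle : (U : ℤ) * s ≤ X - a := by
        rw [← Int.le_ediv_iff_mul_le hs0,
          ← Int.toNat_of_nonneg (Int.ediv_nonneg (by omega : 0 ≤ (X : ℤ) - a) hs0.le)]
        exact_mod_cast min_le_right _ _
      have hUle' : (U : ℝ) * s ≤ X - a := by exact_mod_cast hUle
      have b₁ := h₁ x hx a ha (by rw [habs]; linarith) s Q U hs1 haQ hQU (by linarith)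
      have hor : (s : ℝ) * a.natAbs ≤ R ∨ (U : ℝ) - Q ≤ a.natAbs + 2 := by
        rw [← hα]
        by_contra! hcon
        obtain ⟨c1, c2⟩ := hcon
        have c3 : 2 * M < s := by
          by_contra! h
          have : (s : ℝ) * α ≤ 2 * M * α := by gcongr
          linarith
        have c4 : (U : ℝ) * (2 * M) ≤ U * s := by gcongr
        have c5 : (U : ℝ) * (2 * M) ≤ x + α * (2 * M) := by nlinarith
        have c6 : (U : ℝ) ≤ x / (2 * M) + α := by
          rw [← sub_le_iff_le_add, le_div_iff₀ (by linarith)]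
          linarith
        linarith
      have hsR : (s : ℝ) * a.natAbs < 2 * R := by
        rw [← hα]
        have : (s : ℝ) * α ≤ (2 * M + 1) * α := by gcongr
        nlinarith
      have b₂ := h₂ x hx a ha hαx R hR1 hRx s Q U hs1 hQU hsR hor
      rw [sum_sub_distrib]
      have b₃ := (abs_sub_le _ _ _).trans (add_le_add b₁ ((abs_sub_comm _ _).trans_le b₂))
      refine b₃.trans ?_
      have b₄ : (K₂ : ℝ) ≤ K₂ * (3 * M) := le_mul_of_one_le_right hK₂.le (by linarith)
      calc _ ≤ K₁ * (3 * M) * (x / Real.log x ^ P) + K₂ * (3 * M) * (x / Real.log x ^ P) := by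
            gcongr
            linarith
        _ = _ := by ring
    · rw [Ioc_eq_empty_of_le hQU.le, filter_empty, sum_empty, abs_zero]
      positivity
  refine (abs_sum_le_sum_abs _ _).trans ((sum_le_card_nsmul _ _ _ hper).trans ?_)
  rw [Nat.card_Icc, add_tsub_cancel_right, nsmul_eq_mul]
  calc _ ≤ 3 * M * ((K₁ + K₂) * (3 * M) * (x / Real.log x ^ P)) := by
        gcongr
        linarith
    _ = _ := by ring

end SiegelWalfisz

/-- dyadic first moment of `ψ* - ρ_R*` over moduli coprime to `a`. -/
theorem dyadic_average_coprime_moduli (A B : ℝ) (hA : 1 ≤ A) (hB : 1 ≤ B) :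
    ∃ C : ℝ, 0 < C ∧ ∀ x : ℝ, 3 ≤ x → ∀ a : ℤ, a ≠ 0 →
      |(a : ℝ)| ≤ x / Real.log x ^ (A + B + 1) →
      ∀ M : ℝ, 1 ≤ M → M ≤ Real.log x ^ A →
      ∀ R : ℝ, 2 * |(a : ℝ)| * M ≤ R → R ≤ x ^ ((1 : ℝ) / 2) →
      |(1 / (((Nat.totient a.natAbs : ℝ) / (a.natAbs : ℝ)) * (x / (2 * M)))) *
          ∑ q ∈ (Finset.Ioc ⌊x / (2 * M)⌋₊ ⌊x / M⌋₊).filter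
              (fun q : ℕ => Int.gcd (q : ℤ) a = 1),
            (psiStar x q a - rhoStar R x q a)|
        ≤ C / Real.log x ^ B := by
  obtain ⟨K, hK, h⟩ := SiegelWalfisz.abs_sum_psiStar_sub_rhoStar_le ⌈3 * A + B + 1⌉₊
  refine ⟨6 * K, by positivity, ?_⟩
  intro x hx a ha hax M hM hMA R hMR hRx
  rw [← Real.sqrt_eq_rpow] at hRx
  have hx0 : 0 < x := by linarith
  have hL := SiegelWalfisz.one_le_log hx
  have hsum := h x hx a ha M hM R hMR hRx
  have ha' := Int.natAbs_ne_zero.mpr ha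
  have habs : |(a : ℝ)| = a.natAbs := by rw [Nat.cast_natAbs, Int.cast_abs]
  have hα0 : (0 : ℝ) < a.natAbs := by exact_mod_cast Nat.pos_of_ne_zero ha'
  have hφ0 : (0 : ℝ) < a.natAbs.totient := by
    exact_mod_cast Nat.totient_pos.mpr (Nat.pos_of_ne_zero ha')
  have hlog : Real.log a.natAbs ≤ Real.log x := by
    refine Real.log_le_log hα0 (habs ▸ hax.trans ?_)
    exact div_le_self hx0.le (Real.one_le_rpow hL (by linarith))
  have hφ := SiegelWalfisz.div_totient_le ha'
  have hpre : 1 / (((Nat.totient a.natAbs : ℝ) / (a.natAbs : ℝ)) * (x / (2 * M))) ≤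
      3 * Real.log x * (2 * M / x) := by
    have e1 : 1 / (((Nat.totient a.natAbs : ℝ) / (a.natAbs : ℝ)) * (x / (2 * M))) =
        (a.natAbs : ℝ) / a.natAbs.totient * (2 * M / x) := by field_simp
    rw [e1]
    gcongr
    linarith
  rw [abs_mul, abs_of_nonneg (by positivity)]
  set L := Real.log x with hLdef
  have hP : L ^ (3 * A + B + 1) ≤ L ^ ⌈3 * A + B + 1⌉₊ := by
    rw [← Real.rpow_natCast]
    exact Real.rpow_le_rpow_of_exponent_le hL (Nat.le_ceil _)
  have hL0 : 0 < L := by linarith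
  have hsplit : L ^ (3 * A + B + 1) = (L ^ A) ^ 3 * L ^ B * L := by
    rw [Real.rpow_add hL0, Real.rpow_add hL0, Real.rpow_one, mul_comm 3 A, Real.rpow_mul hL0.le]
    norm_num
  calc _ ≤ 3 * L * (2 * M / x) * (K * M ^ 2 * (x / L ^ ⌈3 * A + B + 1⌉₊)) := by gcongr
    _ = 6 * K * (M ^ 3 * L / L ^ ⌈3 * A + B + 1⌉₊) := by field_simp; ring
    _ ≤ 6 * K * ((L ^ A) ^ 3 * L / L ^ (3 * A + B + 1)) := by gcongr
    _ = _ := by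
        rw [hsplit]
        field_simp
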